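/- Let f : ℤ_p → ℚ_p be a subanalytic function. Then there exists a finite partition of ℤ_p into semialgebraic sets A such that for each A there exist polynomials P and Q over ℚ_p and an integer e > 0 with Q having no zeros on A and |f(x)| = |P(x)/Q(x)|^{1/e} for each x ∈ A. -/

import Mathlib

open Filter MeasureTheory
open scoped ENNReal

namespace PadicSub

variable (p : ℕ) [Fact p.Prime]

/-- The coefficients (indexed by multi-indices) of a restricted power series:
they tend to `0` along the cofinite filter. -/
def IsRestrictedCoeffs {m : ℕ} (a : (Fin m → ℕ) → ℚ_[p]) : Prop :=
  Filter.Tendsto a Filter.cofinite (nhds 0)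

/-- The restricted analytic function associated to a family of coefficients:
the sum of the power series on `ℤ_p^m`, and `0` outside `ℤ_p^m`. -/
noncomputable def ranalFn {m : ℕ} (a : (Fin m → ℕ) → ℚ_[p]) (x : Fin m → ℚ_[p]) : ℚ_[p] :=
  if ∀ j, ‖x j‖ ≤ 1 then ∑' i : (Fin m → ℕ), a i * ∏ j, x j ^ i j else 0

/-- `D`-functions: the functions obtained from restricted analytic functions, polynomial
maps, and the inverse function (with the convention `0⁻¹ = 0`) by repeated composition. -/
inductive IsDFunction : {m : ℕ} → ((Fin m → ℚ_[p]) → ℚ_[p]) → Prop where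
  | ranal {m : ℕ} (a : (Fin m → ℕ) → ℚ_[p]) (ha : IsRestrictedCoeffs p a) :
      IsDFunction (ranalFn p a)
  | poly {m : ℕ} (q : MvPolynomial (Fin m) ℚ_[p]) :
      IsDFunction (fun x => MvPolynomial.eval x q)
  | inv : IsDFunction (fun x : Fin 1 → ℚ_[p] => (x 0)⁻¹)
  | comp {m n : ℕ} (f : (Fin n → ℚ_[p]) → ℚ_[p]) (g : Fin n → (Fin m → ℚ_[p]) → ℚ_[p]) :
      IsDFunction f → (∀ i, IsDFunction (g i)) →
      IsDFunction (fun x => f (fun i => g i x))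

/-- `P_n`: the set of nonzero `n`-th powers in `ℚ_p`. -/
def Pset (n : ℕ) : Set ℚ_[p] := {x | ∃ y : ℚ_[p], y ≠ 0 ∧ y ^ n = x}

/-- The coset `μ P_n`. -/
def cosetP (μ : ℚ_[p]) (n : ℕ) : Set ℚ_[p] := {x | ∃ y ∈ Pset p n, x = μ * y}

/-- A (globally) subanalytic subset of `ℚ_p^m`: a finite union of finite intersections of
sets of the form `{x | f x = 0}` and `{x | f x ∈ P_n}`, `f` a `D`-function, `n > 0`. -/
def IsSubanalytic {m : ℕ} (X : Set (Fin m → ℚ_[p])) : Prop :=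
  ∃ (r s : ℕ) (F : Fin r → Fin s → Set (Fin m → ℚ_[p])),
    (∀ i j, (∃ f, IsDFunction p f ∧ F i j = {x | f x = 0}) ∨
            (∃ f n, IsDFunction p f ∧ 0 < n ∧ F i j = {x | f x ∈ Pset p n})) ∧
    X = ⋃ i, ⋂ j, F i j

/-- A semialgebraic subset of `ℚ_p^m`: a finite union of finite intersections of
sets of the form `{x | f x = 0}` and `{x | f x ∈ P_n}`, `f` a polynomial, `n > 0`. -/
def IsSemialgebraic {m : ℕ} (X : Set (Fin m → ℚ_[p])) : Prop :=
  ∃ (r s : ℕ) (F : Fin r → Fin s → Set (Fin m → ℚ_[p])),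
    (∀ i j, (∃ f : MvPolynomial (Fin m) ℚ_[p], F i j = {x | MvPolynomial.eval x f = 0}) ∨
            (∃ (f : MvPolynomial (Fin m) ℚ_[p]) (n : ℕ), 0 < n ∧
              F i j = {x | MvPolynomial.eval x f ∈ Pset p n})) ∧
    X = ⋃ i, ⋂ j, F i j

/-- The graph of the restriction to `X` of a map `ℚ_p^m → ℚ_p^n`, inside `ℚ_p^(m+n)`. -/
def graphMap {m n : ℕ} (X : Set (Fin m → ℚ_[p])) (F : (Fin m → ℚ_[p]) → (Fin n → ℚ_[p])) :
    Set (Fin (m + n) → ℚ_[p]) :=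
  {z | (fun i => z (Fin.castAdd n i)) ∈ X ∧
    F (fun i => z (Fin.castAdd n i)) = fun j => z (Fin.natAdd m j)}

/-- The graph of the restriction to `X` of a function `ℚ_p^m → ℚ_p`, inside `ℚ_p^(m+1)`. -/
def graphFun {m : ℕ} (X : Set (Fin m → ℚ_[p])) (f : (Fin m → ℚ_[p]) → ℚ_[p]) :
    Set (Fin (m + 1) → ℚ_[p]) :=
  {z | (fun i : Fin m => z i.castSucc) ∈ X ∧ f (fun i : Fin m => z i.castSucc) = z (Fin.last m)}

/-- A function `ℚ_p^m → ℚ_p` is subanalytic on `X` if its graph over `X` is subanalytic. -/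
def IsSubanalyticFnOn {m : ℕ} (X : Set (Fin m → ℚ_[p])) (f : (Fin m → ℚ_[p]) → ℚ_[p]) : Prop :=
  IsSubanalytic p (graphFun p X f)

/-- A (totally defined) subanalytic function `ℚ_p^m → ℚ_p`. -/
def IsSubanalyticFn {m : ℕ} (f : (Fin m → ℚ_[p]) → ℚ_[p]) : Prop :=
  IsSubanalyticFnOn p Set.univ f

/-- A function `ℚ_p^m → ℚ_p` is semialgebraic on `X` if its graph over `X` is
semialgebraic. -/
def IsSemialgebraicFnOn {m : ℕ} (X : Set (Fin m → ℚ_[p])) (f : (Fin m → ℚ_[p]) → ℚ_[p]) :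
    Prop :=
  IsSemialgebraic p (graphFun p X f)

/-- A subanalytic subset of `ℚ_p` (one-variable version). -/
def IsSubanalytic1 (X : Set ℚ_[p]) : Prop :=
  IsSubanalytic p {z : Fin 1 → ℚ_[p] | z 0 ∈ X}

/-- A semialgebraic subset of `ℚ_p` (one-variable version). -/
def IsSemialgebraic1 (X : Set ℚ_[p]) : Prop :=
  IsSemialgebraic p {z : Fin 1 → ℚ_[p] | z 0 ∈ X}

/-- A function `ℚ_p → ℚ_p` subanalytic on `X ⊆ ℚ_p`: its graph over `X` is a subanalytic
subset of `ℚ_p²`. -/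
def IsSubanalyticFnOn1 (X : Set ℚ_[p]) (f : ℚ_[p] → ℚ_[p]) : Prop :=
  IsSubanalytic p {z : Fin 2 → ℚ_[p] | z 0 ∈ X ∧ f (z 0) = z 1}

/-- A function `ℚ_p → ℚ_p` semialgebraic on `X ⊆ ℚ_p`: its graph over `X` is a
semialgebraic subset of `ℚ_p²`. -/
def IsSemialgebraicFnOn1 (X : Set ℚ_[p]) (f : ℚ_[p] → ℚ_[p]) : Prop :=
  IsSemialgebraic p {z : Fin 2 → ℚ_[p] | z 0 ∈ X ∧ f (z 0) = z 1}

/-- Interpretation of the symbols `□ᵢ` in the definition of cells: `true` means `<` and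
`false` means "no condition". -/
def sqRel (b : Bool) (x y : ℝ) : Prop := b = true → x < y

/-- A cell in `ℚ_p`, presented with its center `γ` and coset data `μ`, `n`. -/
def IsCell1 (A : Set ℚ_[p]) (γ μ : ℚ_[p]) (n : ℕ) : Prop :=
  0 < n ∧ A.Nonempty ∧
  ∃ (α β : ℚ_[p]) (b₁ b₂ : Bool), α ≠ 0 ∧ β ≠ 0 ∧
    A = {t | sqRel b₁ ‖α‖ ‖t - γ‖ ∧ sqRel b₂ ‖t - γ‖ ‖β‖ ∧ t - γ ∈ cosetP p μ n}

/-- Subanalytic cells in `ℚ_p^(m+1)`, defined inductively, presented with their center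
`γ : ℚ_p^m → ℚ_p` and coset data `μ`, `n`.  The projection of the cell onto the first `m`
coordinates is required to be a cell. -/
inductive IsCell : {m : ℕ} → Set (Fin (m + 1) → ℚ_[p]) →
    ((Fin m → ℚ_[p]) → ℚ_[p]) → ℚ_[p] → ℕ → Prop where
  | base (n : ℕ) (hn : 0 < n) (μ γ0 α β : ℚ_[p]) (hα : α ≠ 0) (hβ : β ≠ 0)
      (b₁ b₂ : Bool) (A : Set (Fin 1 → ℚ_[p])) (hne : A.Nonempty)
      (hA : A = {z | sqRel b₁ ‖α‖ ‖z 0 - γ0‖ ∧ sqRel b₂ ‖z 0 - γ0‖ ‖β‖ ∧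
        z 0 - γ0 ∈ cosetP p μ n}) :
      IsCell A (fun _ => γ0) μ n
  | succ {m : ℕ} {D : Set (Fin (m + 1) → ℚ_[p])} {γD : (Fin m → ℚ_[p]) → ℚ_[p]}
      {μD : ℚ_[p]} {nD : ℕ} (hD : IsCell D γD μD nD)
      (n : ℕ) (hn : 0 < n) (μ : ℚ_[p]) (α β γ : (Fin (m + 1) → ℚ_[p]) → ℚ_[p])
      (hα : IsSubanalyticFn p α) (hβ : IsSubanalyticFn p β) (hγ : IsSubanalyticFn p γ)
      (hα0 : ∀ x, α x ≠ 0) (hβ0 : ∀ x, β x ≠ 0)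
      (b₁ b₂ : Bool) (A : Set (Fin (m + 2) → ℚ_[p]))
      (hA : A = {z | (fun i : Fin (m + 1) => z i.castSucc) ∈ D ∧
          sqRel b₁ ‖α (fun i : Fin (m + 1) => z i.castSucc)‖
            ‖z (Fin.last (m + 1)) - γ (fun i : Fin (m + 1) => z i.castSucc)‖ ∧
          sqRel b₂ ‖z (Fin.last (m + 1)) - γ (fun i : Fin (m + 1) => z i.castSucc)‖
            ‖β (fun i : Fin (m + 1) => z i.castSucc)‖ ∧
          z (Fin.last (m + 1)) - γ (fun i : Fin (m + 1) => z i.castSucc) ∈ cosetP p μ n})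
      (hproj : (fun (z : Fin (m + 2) → ℚ_[p]) (i : Fin (m + 1)) => z i.castSucc) '' A = D) :
      IsCell A γ μ n

/-- Analytic cells in `ℚ_p^(m+1)`: as subanalytic cells, but at each stage of the inductive
definition the functions `α`, `β`, `γ` are moreover analytic on the projection of the cell. -/
inductive IsAnalyticCell : {m : ℕ} → Set (Fin (m + 1) → ℚ_[p]) →
    ((Fin m → ℚ_[p]) → ℚ_[p]) → ℚ_[p] → ℕ → Prop where
  | base (n : ℕ) (hn : 0 < n) (μ γ0 α β : ℚ_[p]) (hα : α ≠ 0) (hβ : β ≠ 0)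
      (b₁ b₂ : Bool) (A : Set (Fin 1 → ℚ_[p])) (hne : A.Nonempty)
      (hA : A = {z | sqRel b₁ ‖α‖ ‖z 0 - γ0‖ ∧ sqRel b₂ ‖z 0 - γ0‖ ‖β‖ ∧
        z 0 - γ0 ∈ cosetP p μ n}) :
      IsAnalyticCell A (fun _ => γ0) μ n
  | succ {m : ℕ} {D : Set (Fin (m + 1) → ℚ_[p])} {γD : (Fin m → ℚ_[p]) → ℚ_[p]}
      {μD : ℚ_[p]} {nD : ℕ} (hD : IsAnalyticCell D γD μD nD)
      (n : ℕ) (hn : 0 < n) (μ : ℚ_[p]) (α β γ : (Fin (m + 1) → ℚ_[p]) → ℚ_[p])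
      (hα : IsSubanalyticFn p α) (hβ : IsSubanalyticFn p β) (hγ : IsSubanalyticFn p γ)
      (hαan : AnalyticOn ℚ_[p] α D) (hβan : AnalyticOn ℚ_[p] β D)
      (hγan : AnalyticOn ℚ_[p] γ D)
      (hα0 : ∀ x, α x ≠ 0) (hβ0 : ∀ x, β x ≠ 0)
      (b₁ b₂ : Bool) (A : Set (Fin (m + 2) → ℚ_[p]))
      (hA : A = {z | (fun i : Fin (m + 1) => z i.castSucc) ∈ D ∧
          sqRel b₁ ‖α (fun i : Fin (m + 1) => z i.castSucc)‖
            ‖z (Fin.last (m + 1)) - γ (fun i : Fin (m + 1) => z i.castSucc)‖ ∧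
          sqRel b₂ ‖z (Fin.last (m + 1)) - γ (fun i : Fin (m + 1) => z i.castSucc)‖
            ‖β (fun i : Fin (m + 1) => z i.castSucc)‖ ∧
          z (Fin.last (m + 1)) - γ (fun i : Fin (m + 1) => z i.castSucc) ∈ cosetP p μ n})
      (hproj : (fun (z : Fin (m + 2) → ℚ_[p]) (i : Fin (m + 1)) => z i.castSucc) '' A = D) :
      IsAnalyticCell A γ μ n

/-- Generators of the algebra of subanalytic constructible functions on `ℚ_p^m`:
`ℤ`-valued valuations of nonvanishing subanalytic functions, and (`ℚ`-valued) norms of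
subanalytic functions. -/
def constructibleGens (m : ℕ) : Set ((Fin m → ℚ_[p]) → ℚ) :=
  {g | ∃ h : (Fin m → ℚ_[p]) → ℚ_[p], IsSubanalyticFn p h ∧ (∀ x, h x ≠ 0) ∧
        g = fun x => ((h x).valuation : ℚ)} ∪
  {g | ∃ h : (Fin m → ℚ_[p]) → ℚ_[p], IsSubanalyticFn p h ∧
        g = fun x => (padicNormE (h x) : ℚ)}

/-- The `ℚ`-algebra `C(ℚ_p^m)` of subanalytic constructible functions on `ℚ_p^m`. -/
noncomputable def ConstructibleAlg (m : ℕ) : Subalgebra ℚ ((Fin m → ℚ_[p]) → ℚ) :=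
  Algebra.adjoin ℚ (constructibleGens p m)

/-- `ℤ_p^m` as a subset of `ℚ_p^m`. -/
def ZpSet (m : ℕ) : Set (Fin m → ℚ_[p]) := {x | ∀ j, ‖x j‖ ≤ 1}

/-- A simple subset of `ℤ^n × ℚ_p^m`. -/
def IsSimpleSet (n m : ℕ) (A : Set ((Fin n → ℤ) × (Fin m → ℚ_[p]))) : Prop :=
  IsSubanalytic p {z : Fin (n + m) → ℚ_[p] |
    (∀ i : Fin n, z (Fin.castAdd m i) ≠ 0) ∧
    ((fun i : Fin n => (z (Fin.castAdd m i)).valuation),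
      fun j : Fin m => z (Fin.natAdd n j)) ∈ A}

/-- A simple function `ℤ^n × ℚ_p^m → ℤ`: one whose graph is a simple set. -/
def IsSimpleFn (n m : ℕ) (h : (Fin n → ℤ) × (Fin m → ℚ_[p]) → ℤ) : Prop :=
  IsSimpleSet p (n + 1) m
    {w | w.1 (Fin.last n) = h (fun i : Fin n => w.1 i.castSucc, w.2)}

/-- Generators of `C_simple(ℤ^n × ℚ_p^m)`: simple functions, and `p^h` for `h` simple. -/
def simpleGens (n m : ℕ) : Set ((Fin n → ℤ) × (Fin m → ℚ_[p]) → ℚ) :=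
  {g | ∃ h, IsSimpleFn p n m h ∧ g = fun w => (h w : ℚ)} ∪
  {g | ∃ h, IsSimpleFn p n m h ∧ g = fun w => (p : ℚ) ^ (h w)}

/-- The `ℚ`-algebra `C_simple(ℤ^n × ℚ_p^m)`. -/
noncomputable def SimpleAlg (n m : ℕ) : Subalgebra ℚ ((Fin n → ℤ) × (Fin m → ℚ_[p]) → ℚ) :=
  Algebra.adjoin ℚ (simpleGens p n m)

noncomputable instance : MeasurableSpace ℚ_[p] := borel _
instance : BorelSpace ℚ_[p] := ⟨rfl⟩

end PadicSub

section

open scoped Topology BoundedContinuousFunction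

namespace PadicSub

variable {p : ℕ} [Fact p.Prime]

/-! ### Restricted power series are analytic at every point -/

/-- The pairing of bounded families with a family of coefficients tending to zero. -/
lemma exists_pairing {ι : Type} [TopologicalSpace ι] [DiscreteTopology ι] (a : ι → ℚ_[p])
    (ha : Tendsto a cofinite (𝓝 0)) :
    ∃ L : (ι →ᵇ ℚ_[p]) →L[ℚ_[p]] ℚ_[p], ∀ β, L β = ∑' i, a i * β i := by
  have hsum : ∀ β : ι →ᵇ ℚ_[p], Summable (fun i => a i * β i) := by
    intro β
    apply NonarchimedeanAddGroup.summable_of_tendsto_cofinite_zero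
    apply squeeze_zero_norm (a := fun i => ‖a i‖ * ‖β‖)
    · intro i
      rw [norm_mul]
      exact mul_le_mul_of_nonneg_left (β.norm_coe_le_norm i) (norm_nonneg _)
    · simpa using (ha.norm.mul_const ‖β‖)
  obtain ⟨C, hC0, hC⟩ : ∃ C : ℝ, 0 ≤ C ∧ ∀ i, ‖a i‖ ≤ C := by
    have h1 : ∀ᶠ i in cofinite, ‖a i‖ ≤ 1 := by
      have := ha.norm
      rw [norm_zero] at this
      exact (this.eventually (gt_mem_nhds one_pos)).mono fun i hi => le_of_lt hi
    rw [eventually_cofinite] at h1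
    obtain ⟨C, hC⟩ := (h1.image (fun i => ‖a i‖)).bddAbove
    refine ⟨max C 1, by positivity, fun i => ?_⟩
    by_cases hi : ‖a i‖ ≤ 1
    · exact hi.trans (le_max_right _ _)
    · exact (hC ⟨i, hi, rfl⟩).trans (le_max_left _ _)
  let L0 : (ι →ᵇ ℚ_[p]) →ₗ[ℚ_[p]] ℚ_[p] :=
    { toFun := fun β => ∑' i, a i * β i
      map_add' := by
        intro β γ
        rw [← (hsum β).tsum_add (hsum γ)]
        exact tsum_congr fun i => by simp [mul_add]
      map_smul' := by
        intro c β
        simp only [BoundedContinuousFunction.coe_smul, smul_eq_mul, RingHom.id_apply]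
        rw [← tsum_mul_left]
        exact tsum_congr fun i => by ring }
  refine ⟨L0.mkContinuous C ?_, fun β => rfl⟩
  intro β
  apply IsUltrametricDist.norm_tsum_le_of_forall_le_of_nonneg (by positivity)
  intro i
  rw [norm_mul]
  exact mul_le_mul (hC i) (β.norm_coe_le_norm i) (norm_nonneg _) hC0

/-- The map `w ↦ (w ^ (e i))_i` into bounded families is analytic at points of the unit ball. -/
lemma exists_powers {ι : Type} [TopologicalSpace ι] [DiscreteTopology ι] (e : ι → ℕ)
    (c : ℚ_[p]) (hc : ‖c‖ ≤ 1) :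
    ∃ E : ℚ_[p] → (ι →ᵇ ℚ_[p]), AnalyticAt ℚ_[p] E c ∧
      ∀ᶠ w in 𝓝 c, ∀ i, E w i = w ^ e i := by
  have hb : ∀ l : ℕ, ∀ i, ‖((e i).choose l : ℚ_[p]) * c ^ (e i - l)‖ ≤ 1 := by
    intro l i
    rw [norm_mul, norm_pow]
    exact mul_le_one₀ (by simpa using Padic.norm_int_le_one (p := p) ((e i).choose l : ℤ))
      (by positivity) (pow_le_one₀ (norm_nonneg _) hc)
  let q : ℕ → (ι →ᵇ ℚ_[p]) := fun l =>
    BoundedContinuousFunction.ofNormedAddCommGroupDiscrete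
      (fun i => ((e i).choose l : ℚ_[p]) * c ^ (e i - l)) 1 (hb l)
  have hq : ∀ l, ‖q l‖ ≤ 1 := fun l =>
    (BoundedContinuousFunction.norm_le zero_le_one).2 (hb l)
  let P : FormalMultilinearSeries ℚ_[p] ℚ_[p] (ι →ᵇ ℚ_[p]) := fun l =>
    ContinuousMultilinearMap.mkPiRing ℚ_[p] (Fin l) (q l)
  have hrad : (1 : ℝ≥0∞) ≤ P.radius := by
    have := P.le_radius_of_bound (r := 1) 1 (by
      intro n
      simp only [P, ContinuousMultilinearMap.norm_mkPiRing]
      simpa using hq n)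
    simpa using this
  have hP := P.hasFPowerSeriesOnBall (lt_of_lt_of_le one_pos hrad)
  refine ⟨fun w => P.sum (w - c), ?_, ?_⟩
  · have h0 : AnalyticAt ℚ_[p] P.sum ((fun w : ℚ_[p] => w - c) c) := by
      simpa using hP.analyticAt
    exact h0.comp (f := fun w : ℚ_[p] => w - c) (by fun_prop)
  · have hball : ∀ᶠ w in 𝓝 c, ‖w - c‖ < 1 := by
      have : Tendsto (fun w : ℚ_[p] => ‖w - c‖) (𝓝 c) (𝓝 0) := by
        have : ContinuousAt (fun w : ℚ_[p] => ‖w - c‖) c := by fun_prop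
        simpa [ContinuousAt] using this
      exact this.eventually (gt_mem_nhds one_pos)
    filter_upwards [hball] with w hw i
    have hmem : w - c ∈ Metric.eball (0 : ℚ_[p]) P.radius := by
      refine Metric.eball_subset_eball hrad ?_
      have hw' : ‖w - c‖₊ < 1 := by exact_mod_cast hw
      simpa [edist_zero_right, enorm_eq_nnnorm] using hw'
    have hs := hP.hasSum hmem
    rw [zero_add] at hs
    have hs2 := (BoundedContinuousFunction.evalCLM ℚ_[p] i).hasSum hs
    simp only [BoundedContinuousFunction.evalCLM_apply] at hs2
    have hs3 : HasSum (fun l : ℕ => (w - c) ^ l * (((e i).choose l : ℚ_[p]) * c ^ (e i - l)))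
        (P.sum (w - c) i) := by
      convert hs2 using 2 with l
      simp [P, q]
    refine hs3.unique ?_
    have : w ^ e i = ∑ l ∈ Finset.range (e i + 1),
        (w - c) ^ l * (((e i).choose l : ℚ_[p]) * c ^ (e i - l)) := by
      conv_lhs => rw [← sub_add_cancel w c, add_pow]
      exact Finset.sum_congr rfl fun l _ => by ring
    rw [this]
    apply hasSum_sum_of_ne_finset_zero
    intro l hl
    have : e i < l := by simpa using hl
    simp [Nat.choose_eq_zero_of_lt this]

lemma norm_le_one_clopen (c : ℚ_[p]) : ∀ᶠ w in 𝓝 c, (‖w‖ ≤ 1 ↔ ‖c‖ ≤ 1) := by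
  have h : IsClopen {w : ℚ_[p] | ‖w‖ ≤ 1} := by
    have := IsUltrametricDist.isClopen_closedBall (0 : ℚ_[p]) (r := 1) one_ne_zero
    simpa [Metric.closedBall, dist_zero_right] using this
  by_cases hc : ‖c‖ ≤ 1
  · filter_upwards [h.isOpen.mem_nhds hc] with w hw
    exact ⟨fun _ => hc, fun _ => hw⟩
  · filter_upwards [h.compl.isOpen.mem_nhds hc] with w hw
    exact ⟨fun h => absurd h hw, fun h => absurd h hc⟩

lemma analyticAt_ranalFn {m : ℕ} (a : (Fin m → ℕ) → ℚ_[p]) (ha : IsRestrictedCoeffs p a)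
    (c : Fin m → ℚ_[p]) : AnalyticAt ℚ_[p] (ranalFn p a) c := by
  have hclo : ∀ᶠ x in 𝓝 c, ∀ j, (‖x j‖ ≤ 1 ↔ ‖c j‖ ≤ 1) := by
    rw [eventually_all]
    intro j
    exact (continuous_apply j).continuousAt.eventually (norm_le_one_clopen (c j))
  by_cases hc : ∀ j, ‖c j‖ ≤ 1
  · obtain ⟨L, hL⟩ := exists_pairing a ha
    choose E hE1 hE2 using fun j : Fin m => exists_powers (fun i : Fin m → ℕ => i j) (c j) (hc j)
    have han : AnalyticAt ℚ_[p] (fun x : Fin m → ℚ_[p] => L (∏ j, E j (x j))) c := by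
      refine (L.analyticAt _).comp (f := fun x : Fin m → ℚ_[p] => ∏ j, E j (x j)) ?_
      apply Finset.analyticAt_fun_prod
      intro j _
      exact (hE1 j).comp (f := fun x : Fin m → ℚ_[p] => x j)
        ((ContinuousLinearMap.proj (R := ℚ_[p]) (φ := fun _ : Fin m => ℚ_[p]) j).analyticAt c)
    refine han.congr ?_
    have hev : ∀ᶠ x in 𝓝 c, ∀ j, ∀ i : Fin m → ℕ, E j (x j) i = x j ^ i j := by
      rw [eventually_all]
      intro j
      exact (continuous_apply j).continuousAt.eventually (hE2 j)
    filter_upwards [hclo, hev] with x hx1 hx2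
    rw [ranalFn, if_pos (fun j => (hx1 j).2 (hc j)), hL]
    refine tsum_congr fun i => ?_
    congr 1
    rw [BoundedContinuousFunction.coe_prod, Finset.prod_apply]
    exact Finset.prod_congr rfl fun j _ => hx2 j i
  · refine (analyticAt_const (v := (0 : ℚ_[p]))).congr ?_
    filter_upwards [hclo] with x hx
    rw [ranalFn, if_neg]
    intro h
    exact hc fun j => (hx j).1 (h j)

end PadicSub

end

section

open scoped Topology

namespace PadicSub

variable {p : ℕ} [Fact p.Prime]

/-! ### Germs of analytic functions of two variables: coefficients -/

/-- The sum of a double power series. -/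
noncomputable def cfun (a : ℕ × ℕ → ℚ_[p]) (ζ : ℚ_[p] × ℚ_[p]) : ℚ_[p] :=
  ∑' n : ℕ × ℕ, a n * (ζ.1 ^ n.1 * ζ.2 ^ n.2)

/-- Convergence on the bidisc of radius `‖δ‖`. -/
def Conv (a : ℕ × ℕ → ℚ_[p]) (δ : ℚ_[p]) : Prop :=
  δ ≠ 0 ∧ Tendsto (fun n : ℕ × ℕ => a n * δ ^ (n.1 + n.2)) cofinite (𝓝 0)

lemma Conv.analyticAt {a : ℕ × ℕ → ℚ_[p]} {δ : ℚ_[p]} (h : Conv a δ) :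
    AnalyticAt ℚ_[p] (cfun a) 0 := by
  obtain ⟨hδ, ht⟩ := h
  set b : (Fin 2 → ℕ) → ℚ_[p] := fun i => a (i 0, i 1) * δ ^ (i 0 + i 1) with hb
  have hbt : IsRestrictedCoeffs p b := by
    have := ht.comp (finTwoArrowEquiv ℕ).injective.tendsto_cofinite
    exact this
  have hA := analyticAt_ranalFn b hbt (fun _ => 0)
  have hlin : AnalyticAt ℚ_[p] (fun ζ : ℚ_[p] × ℚ_[p] => (![ζ.1 / δ, ζ.2 / δ] : Fin 2 → ℚ_[p])) 0 := by
    rw [analyticAt_pi_iff]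
    intro i
    fin_cases i
    · simp only [div_eq_mul_inv]
      exact analyticAt_fst.mul analyticAt_const
    · simp only [div_eq_mul_inv]
      exact analyticAt_snd.mul analyticAt_const
  have h0 : (![(0 : ℚ_[p] × ℚ_[p]).1 / δ, (0 : ℚ_[p] × ℚ_[p]).2 / δ] : Fin 2 → ℚ_[p])
      = fun _ => 0 := by
    ext i; fin_cases i <;> simp
  rw [← h0] at hA
  refine (hA.comp (f := fun ζ : ℚ_[p] × ℚ_[p] => (![ζ.1 / δ, ζ.2 / δ] : Fin 2 → ℚ_[p])) hlin).congr ?_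
  have hball : ∀ᶠ ζ : ℚ_[p] × ℚ_[p] in 𝓝 0, ‖ζ‖ < ‖δ‖ := by
    have : Metric.ball (0 : ℚ_[p] × ℚ_[p]) ‖δ‖ ∈ 𝓝 0 := Metric.ball_mem_nhds _ (norm_pos_iff.2 hδ)
    filter_upwards [this] with ζ hζ
    simpa using hζ
  filter_upwards [hball] with ζ hζ
  have h1 : ‖ζ.1‖ ≤ ‖δ‖ := (norm_fst_le ζ).trans hζ.le
  have h2 : ‖ζ.2‖ ≤ ‖δ‖ := (norm_snd_le ζ).trans hζ.le
  have hp : 0 < ‖δ‖ := norm_pos_iff.2 hδ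
  simp only [Function.comp_apply]
  rw [ranalFn, if_pos, cfun, ← (finTwoArrowEquiv ℕ).tsum_eq]
  · refine tsum_congr fun i => ?_
    have hi : finTwoArrowEquiv ℕ i = (i 0, i 1) := rfl
    simp only [hb, Fin.prod_univ_two, hi]
    simp only [Matrix.cons_val_zero, Matrix.cons_val_one, div_pow, pow_add]
    field_simp
  · intro j
    fin_cases j
    · simpa using (div_le_one hp).2 h1
    · simpa using (div_le_one hp).2 h2

lemma Conv.swap {a : ℕ × ℕ → ℚ_[p]} {δ : ℚ_[p]} (h : Conv a δ) : Conv (a ∘ Prod.swap) δ := by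
  refine ⟨h.1, ?_⟩
  have := h.2.comp (Prod.swap_injective (α := ℕ) (β := ℕ)).tendsto_cofinite
  refine this.congr fun n => ?_
  simp [add_comm]

lemma cfun_swap (a : ℕ × ℕ → ℚ_[p]) (ζ : ℚ_[p] × ℚ_[p]) :
    cfun (a ∘ Prod.swap) ζ = cfun a ζ.swap := by
  rw [cfun, cfun, ← (Equiv.prodComm ℕ ℕ).tsum_eq]
  refine tsum_congr fun n => ?_
  simp [mul_comm]

/-- Shift of coefficients in the second variable. -/
def sh2 (a : ℕ × ℕ → ℚ_[p]) (n : ℕ × ℕ) : ℚ_[p] := a (n.1, n.2 + 1)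
/-- Shift of coefficients in the first variable. -/
def sh1 (a : ℕ × ℕ → ℚ_[p]) (n : ℕ × ℕ) : ℚ_[p] := a (n.1 + 1, n.2)

lemma Conv.sh2 {a : ℕ × ℕ → ℚ_[p]} {δ : ℚ_[p]} (h : Conv a δ) : Conv (sh2 a) δ := by
  refine ⟨h.1, ?_⟩
  have hinj : Function.Injective (fun n : ℕ × ℕ => (n.1, n.2 + 1)) := by
    rintro ⟨a, b⟩ ⟨c, d⟩ h
    simpa using h
  have := (h.2.comp hinj.tendsto_cofinite).mul_const δ⁻¹
  rw [zero_mul] at this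
  refine this.congr fun n => ?_
  have := h.1
  simp only [Function.comp_apply, PadicSub.sh2, ← add_assoc, pow_succ]
  field_simp

lemma sh1_eq (a : ℕ × ℕ → ℚ_[p]) : sh1 a = (sh2 (a ∘ Prod.swap)) ∘ Prod.swap := rfl

lemma Conv.sh1 {a : ℕ × ℕ → ℚ_[p]} {δ : ℚ_[p]} (h : Conv a δ) : Conv (sh1 a) δ := by
  rw [sh1_eq]; exact h.swap.sh2.swap

lemma Conv.summable {a : ℕ × ℕ → ℚ_[p]} {δ : ℚ_[p]} (h : Conv a δ) {ζ : ℚ_[p] × ℚ_[p]}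
    (h1 : ‖ζ.1‖ ≤ ‖δ‖) (h2 : ‖ζ.2‖ ≤ ‖δ‖) :
    Summable (fun n : ℕ × ℕ => a n * (ζ.1 ^ n.1 * ζ.2 ^ n.2)) := by
  apply NonarchimedeanAddGroup.summable_of_tendsto_cofinite_zero
  apply squeeze_zero_norm (a := fun n : ℕ × ℕ => ‖a n * δ ^ (n.1 + n.2)‖) _ (by simpa using h.2.norm)
  intro n
  simp only [norm_mul, norm_pow, pow_add]
  gcongr

lemma Conv.split2 {a : ℕ × ℕ → ℚ_[p]} {δ : ℚ_[p]} (h : Conv a δ) {ζ : ℚ_[p] × ℚ_[p]}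
    (h1 : ‖ζ.1‖ ≤ ‖δ‖) (h2 : ‖ζ.2‖ ≤ ‖δ‖) :
    cfun a ζ = cfun a (ζ.1, 0) + ζ.2 * cfun (PadicSub.sh2 a) ζ := by
  have hs := h.summable h1 h2
  have hs0 : Summable (fun n : ℕ × ℕ => a n * (ζ.1 ^ n.1 * (0:ℚ_[p]) ^ n.2)) :=
    h.summable (ζ := (ζ.1, 0)) h1 (by simp)
  have hs' := h.sh2.summable h1 h2
  have e1 : cfun a ζ = ∑' i : ℕ, ∑' j : ℕ, a (i, j) * (ζ.1 ^ i * ζ.2 ^ j) := hs.tsum_prod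
  have e2 : cfun a (ζ.1, 0) = ∑' i : ℕ, ∑' j : ℕ, a (i, j) * (ζ.1 ^ i * (0:ℚ_[p]) ^ j) := hs0.tsum_prod
  have e3 : cfun (PadicSub.sh2 a) ζ = ∑' i : ℕ, ∑' j : ℕ, a (i, j+1) * (ζ.1 ^ i * ζ.2 ^ j) := hs'.tsum_prod
  have k0 : ∀ i : ℕ, ∑' j : ℕ, a (i, j) * (ζ.1 ^ i * (0:ℚ_[p]) ^ j) = a (i,0) * ζ.1 ^ i := by
    intro i
    rw [tsum_eq_single 0]
    · simp
    · intro j hj; simp [hj]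
  have k1 : ∀ i : ℕ, ∑' j : ℕ, a (i, j) * (ζ.1 ^ i * ζ.2 ^ j) =
      a (i, 0) * ζ.1 ^ i + ζ.2 * ∑' j : ℕ, a (i, j+1) * (ζ.1 ^ i * ζ.2 ^ j) := by
    intro i
    rw [(hs.prod_factor i).tsum_eq_zero_add, ← tsum_mul_left]
    congr 1
    · simp
    · exact tsum_congr fun j => by ring
  rw [e1, e2, e3, ← tsum_mul_left, ← Summable.tsum_add]
  · exact tsum_congr fun i => by rw [k1, k0]
  · have := hs0.prod
    exact this
  · exact (hs'.prod).mul_left _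

lemma Conv.split1 {a : ℕ × ℕ → ℚ_[p]} {δ : ℚ_[p]} (h : Conv a δ) {ζ : ℚ_[p] × ℚ_[p]}
    (h1 : ‖ζ.1‖ ≤ ‖δ‖) (h2 : ‖ζ.2‖ ≤ ‖δ‖) :
    cfun a ζ = cfun a (0, ζ.2) + ζ.1 * cfun (PadicSub.sh1 a) ζ := by
  have := h.swap.split2 (ζ := ζ.swap) h2 h1
  rw [cfun_swap, cfun_swap] at this
  rw [sh1_eq, cfun_swap]
  simpa using this

lemma tsum_antidiag (g : ℕ × ℕ → ℚ_[p]) (hg : Summable g) :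
    ∑' n, g n = ∑' n, ∑ c ∈ Finset.HasAntidiagonal.antidiagonal n, g c := by
  have h1 : Summable (fun x : Σ n : ℕ, Finset.HasAntidiagonal.antidiagonal n => g x.2) :=
    (Finset.HasAntidiagonal.sigmaAntidiagonalEquivProd (A := ℕ)).summable_iff.2 hg
  have h2 : ∑' x : Σ n : ℕ, Finset.HasAntidiagonal.antidiagonal n, g x.2 = ∑' n, g n :=
    (Finset.HasAntidiagonal.sigmaAntidiagonalEquivProd (A := ℕ)).tsum_eq g
  rw [← h2, h1.tsum_sigma' (fun n => (hasSum_fintype _).summable)]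
  refine tsum_congr fun n => ?_
  rw [tsum_fintype]
  exact Finset.sum_coe_sort (Finset.HasAntidiagonal.antidiagonal n) g

lemma exists_coeffs {F : ℚ_[p] × ℚ_[p] → ℚ_[p]} (hF : AnalyticAt ℚ_[p] F 0) :
    ∃ a δ, Conv a δ ∧ ∀ᶠ ζ in 𝓝 0, F ζ = cfun a ζ := by
  obtain ⟨P, r, hP⟩ := hF
  -- choose δ
  obtain ⟨r', hr'0, hr'⟩ := ENNReal.lt_iff_exists_nnreal_btwn.1 hP.r_pos
  have hr'0 : 0 < r' := by exact_mod_cast hr'0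
  obtain ⟨δ, hδ0, hδr⟩ := NormedField.exists_norm_lt ℚ_[p] (r := (r' : ℝ)) (by exact_mod_cast hr'0)
  have hδ : δ ≠ 0 := norm_pos_iff.1 hδ0
  obtain ⟨C, hC0, hC⟩ := P.norm_mul_pow_le_of_lt_radius (r := r') (hr'.trans_le hP.r_le)
  let e1 : ℚ_[p] × ℚ_[p] := (1, 0)
  let e2 : ℚ_[p] × ℚ_[p] := (0, 1)
  let a : ℕ × ℕ → ℚ_[p] := fun n =>
    ∑ s ∈ Finset.powersetCard n.1 (Finset.univ : Finset (Fin (n.1 + n.2))),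
      P (n.1 + n.2) (s.piecewise (fun _ => e1) (fun _ => e2))
  have hPle : ∀ (n : ℕ) (s : Finset (Fin n)), ‖P n (s.piecewise (fun _ => e1) (fun _ => e2))‖ ≤ ‖P n‖ := by
    intro n s
    have := (P n).le_opNorm (s.piecewise (fun _ => e1) (fun _ => e2))
    refine this.trans (mul_le_of_le_one_right (norm_nonneg _) ?_)
    apply Finset.prod_le_one
    · intros; positivity
    · intro i _
      by_cases hi : i ∈ s <;> simp [hi, e1, e2, Prod.norm_def]
  have ha : ∀ n, ‖a n‖ ≤ ‖P (n.1 + n.2)‖ := by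
    intro n
    exact IsUltrametricDist.norm_sum_le_of_forall_le_of_nonneg (norm_nonneg _) fun s _ => hPle _ s
  have hconv : Conv a δ := by
    refine ⟨hδ, ?_⟩
    have hρ : ‖δ‖ / r' < 1 := by rw [div_lt_one]; exact hδr; exact_mod_cast hr'0
    have hb : ∀ n : ℕ × ℕ, ‖a n * δ ^ (n.1 + n.2)‖ ≤ C * ((‖δ‖ / r') ^ n.1 * (‖δ‖ / r') ^ n.2) := by
      intro n
      rw [norm_mul, norm_pow, ← pow_add, div_pow]
      have h1 := hC (n.1 + n.2)
      have h2 : (0:ℝ) < r' ^ (n.1 + n.2) := by have : (0:ℝ) < r' := by exact_mod_cast hr'0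
                                               positivity
      rw [← mul_div_assoc, le_div_iff₀ h2]
      calc ‖a n‖ * ‖δ‖ ^ (n.1 + n.2) * r' ^ (n.1 + n.2)
          ≤ ‖P (n.1 + n.2)‖ * ‖δ‖ ^ (n.1 + n.2) * r' ^ (n.1 + n.2) := by gcongr; exact ha n
        _ = (‖P (n.1 + n.2)‖ * r' ^ (n.1 + n.2)) * ‖δ‖ ^ (n.1 + n.2) := by ring
        _ ≤ _ := by gcongr
    refine squeeze_zero_norm hb ?_
    have hg := summable_geometric_of_lt_one (by positivity) hρ
    have hsum : Summable (fun n : ℕ × ℕ => (‖δ‖ / r') ^ n.1 * (‖δ‖ / r') ^ n.2) :=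
      hg.mul_of_nonneg hg (fun _ => by positivity) (fun _ => by positivity)
    simpa using (hsum.mul_left C).tendsto_cofinite_zero
  refine ⟨a, δ, hconv, ?_⟩
  have hball : ∀ᶠ ζ : ℚ_[p] × ℚ_[p] in 𝓝 0, ‖ζ‖ < ‖δ‖ := by
    have : Metric.ball (0 : ℚ_[p] × ℚ_[p]) ‖δ‖ ∈ 𝓝 0 := Metric.ball_mem_nhds _ hδ0
    filter_upwards [this] with ζ hζ
    simpa using hζ
  have hballr : ∀ᶠ ζ : ℚ_[p] × ℚ_[p] in 𝓝 0, ζ ∈ Metric.eball (0 : ℚ_[p] × ℚ_[p]) r :=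
    Metric.eball_mem_nhds _ hP.r_pos
  filter_upwards [hball, hballr] with ζ hζ hζr
  have h1 : ‖ζ.1‖ ≤ ‖δ‖ := (norm_fst_le ζ).trans hζ.le
  have h2 : ‖ζ.2‖ ≤ ‖δ‖ := (norm_snd_le ζ).trans hζ.le
  have hs := hP.hasSum hζr
  rw [zero_add] at hs
  have hsum := hconv.summable h1 h2
  rw [cfun, tsum_antidiag _ hsum]
  rw [← hs.tsum_eq]
  refine tsum_congr fun n => ?_
  have hζe : (fun _ : Fin n => ζ) = (fun _ : Fin n => ζ.1 • e1) + (fun _ : Fin n => ζ.2 • e2) := by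
    ext i <;> simp [e1, e2]
  rw [hζe, ContinuousMultilinearMap.map_add_univ]
  have hterm : ∀ s : Finset (Fin n), P n (s.piecewise (fun _ => ζ.1 • e1) (fun _ => ζ.2 • e2)) =
      ζ.1 ^ s.card * ζ.2 ^ (n - s.card) * P n (s.piecewise (fun _ => e1) (fun _ => e2)) := by
    intro s
    have : (s.piecewise (fun _ => ζ.1 • e1) (fun _ => ζ.2 • e2)) =
        fun i => (s.piecewise (fun _ => ζ.1) (fun _ => ζ.2) : Fin n → ℚ_[p]) i •
          (s.piecewise (fun _ => e1) (fun _ => e2) : Fin n → ℚ_[p] × ℚ_[p]) i := by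
      ext i <;> by_cases hi : i ∈ s <;> simp [hi]
    rw [this, ContinuousMultilinearMap.map_smul_univ, smul_eq_mul]
    congr 1
    rw [Finset.prod_piecewise]
    simp [Finset.card_sdiff]
  rw [Finset.sum_congr rfl (fun s _ => hterm s)]
  rw [show (Finset.univ : Finset (Finset (Fin n))) = Finset.univ.powerset from Finset.powerset_univ.symm,
    Finset.sum_powerset]
  simp only [Finset.card_univ, Fintype.card_fin]
  rw [Finset.Nat.sum_antidiagonal_eq_sum_range_succ_mk]
  refine Finset.sum_congr rfl fun k hk => ?_
  have hk' : k ≤ n := by simpa [Nat.lt_succ_iff] using hk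
  obtain ⟨l, rfl⟩ := Nat.exists_eq_add_of_le hk'
  simp only [Nat.add_sub_cancel_left, a]
  rw [Finset.sum_mul]
  refine Finset.sum_congr rfl fun s hs => ?_
  rw [(Finset.mem_powersetCard.1 hs).2, Nat.add_sub_cancel_left]
  ring

end PadicSub

end

section

open scoped Topology

namespace PadicSub

variable {p : ℕ} [Fact p.Prime]

lemma eventually_small {δ : ℚ_[p]} (hδ : δ ≠ 0) :
    ∀ᶠ ζ : ℚ_[p] × ℚ_[p] in 𝓝 0, ‖ζ.1‖ ≤ ‖δ‖ ∧ ‖ζ.2‖ ≤ ‖δ‖ := by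
  have : Metric.ball (0 : ℚ_[p] × ℚ_[p]) ‖δ‖ ∈ 𝓝 0 :=
    Metric.ball_mem_nhds _ (norm_pos_iff.2 hδ)
  filter_upwards [this] with ζ hζ
  have hζ : ‖ζ‖ < ‖δ‖ := by simpa using hζ
  exact ⟨(norm_fst_le ζ).trans hζ.le, (norm_snd_le ζ).trans hζ.le⟩

lemma tendsto_axis1 : Tendsto (fun ζ : ℚ_[p] × ℚ_[p] => (ζ.1, (0 : ℚ_[p]))) (𝓝 0) (𝓝 0) := by
  have : Continuous (fun ζ : ℚ_[p] × ℚ_[p] => (ζ.1, (0 : ℚ_[p]))) := by fun_prop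
  exact this.tendsto' _ _ rfl

lemma tendsto_axis2 : Tendsto (fun ζ : ℚ_[p] × ℚ_[p] => ((0 : ℚ_[p]), ζ.2)) (𝓝 0) (𝓝 0) := by
  have : Continuous (fun ζ : ℚ_[p] × ℚ_[p] => ((0 : ℚ_[p]), ζ.2)) := by fun_prop
  exact this.tendsto' _ _ rfl

lemma tendsto_inl : Tendsto (fun x : ℚ_[p] => (x, (0 : ℚ_[p]))) (𝓝 0) (𝓝 0) := by
  have : Continuous (fun x : ℚ_[p] => (x, (0 : ℚ_[p]))) := by fun_prop
  exact this.tendsto' _ _ rfl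

lemma tendsto_inr : Tendsto (fun x : ℚ_[p] => ((0 : ℚ_[p]), x)) (𝓝 0) (𝓝 0) := by
  have : Continuous (fun x : ℚ_[p] => ((0 : ℚ_[p]), x)) := by fun_prop
  exact this.tendsto' _ _ rfl

lemma exists_div2 {F : ℚ_[p] × ℚ_[p] → ℚ_[p]} (hF : AnalyticAt ℚ_[p] F 0) :
    ∃ B : ℚ_[p] × ℚ_[p] → ℚ_[p], AnalyticAt ℚ_[p] B 0 ∧
      ∀ᶠ ζ in 𝓝 (0 : ℚ_[p] × ℚ_[p]), F ζ = F (ζ.1, 0) + ζ.2 * B ζ := by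
  obtain ⟨a, δ, ha, hFa⟩ := exists_coeffs hF
  refine ⟨cfun (sh2 a), ha.sh2.analyticAt, ?_⟩
  filter_upwards [hFa, tendsto_axis1.eventually hFa, eventually_small ha.1] with ζ h1 h2 h3
  rw [h1, h2, ha.split2 h3.1 h3.2]

lemma exists_div1 {F : ℚ_[p] × ℚ_[p] → ℚ_[p]} (hF : AnalyticAt ℚ_[p] F 0) :
    ∃ B : ℚ_[p] × ℚ_[p] → ℚ_[p], AnalyticAt ℚ_[p] B 0 ∧
      ∀ᶠ ζ in 𝓝 (0 : ℚ_[p] × ℚ_[p]), F ζ = F (0, ζ.2) + ζ.1 * B ζ := by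
  obtain ⟨a, δ, ha, hFa⟩ := exists_coeffs hF
  refine ⟨cfun (sh1 a), ha.sh1.analyticAt, ?_⟩
  filter_upwards [hFa, tendsto_axis2.eventually hFa, eventually_small ha.1] with ζ h1 h2 h3
  rw [h1, h2, ha.split1 h3.1 h3.2]

lemma cancel_aux {G H : ℚ_[p] × ℚ_[p] → ℚ_[p]} (c : ℚ_[p] × ℚ_[p] → ℚ_[p])
    (v : ℚ_[p] × ℚ_[p])
    (hc : ∀ ζ (t : ℚ_[p]), t ≠ 0 → c ζ = 0 → c (ζ + t • v) ≠ 0) (hG : AnalyticAt ℚ_[p] G 0)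
    (hH : AnalyticAt ℚ_[p] H 0) (h : ∀ᶠ ζ in 𝓝 0, c ζ * G ζ = c ζ * H ζ) :
    ∀ᶠ ζ in 𝓝 0, G ζ = H ζ := by
  filter_upwards [h.eventually_nhds, hG.eventually_analyticAt, hH.eventually_analyticAt]
    with ζ h1 h2 h3
  by_cases h0 : c ζ = 0
  · have hpath : Tendsto (fun t : ℚ_[p] => ζ + t • v) (𝓝[≠] 0) (𝓝 ζ) := by
      have : Continuous (fun t : ℚ_[p] => ζ + t • v) := by fun_prop
      have := (this.tendsto 0).mono_left (nhdsWithin_le_nhds (s := {0}ᶜ))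
      simpa using this
    have hG' := h2.continuousAt.tendsto.comp hpath
    have hH' := h3.continuousAt.tendsto.comp hpath
    refine tendsto_nhds_unique_of_eventuallyEq hG' hH' ?_
    filter_upwards [hpath.eventually h1, self_mem_nhdsWithin] with t ht htne
    exact mul_left_cancel₀ (hc ζ t htne h0) ht
  · exact mul_left_cancel₀ h0 h1.self_of_nhds

lemma cancel1 {G H : ℚ_[p] × ℚ_[p] → ℚ_[p]} (hG : AnalyticAt ℚ_[p] G 0)
    (hH : AnalyticAt ℚ_[p] H 0) (h : ∀ᶠ ζ in 𝓝 (0 : ℚ_[p] × ℚ_[p]), ζ.1 * G ζ = ζ.1 * H ζ) :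
    ∀ᶠ ζ in 𝓝 0, G ζ = H ζ := by
  refine cancel_aux (fun ζ => ζ.1) (1, 0) ?_ hG hH h
  intro ζ t ht h0
  simp [h0, ht]

lemma cancel2 {G H : ℚ_[p] × ℚ_[p] → ℚ_[p]} (hG : AnalyticAt ℚ_[p] G 0)
    (hH : AnalyticAt ℚ_[p] H 0) (h : ∀ᶠ ζ in 𝓝 (0 : ℚ_[p] × ℚ_[p]), ζ.2 * G ζ = ζ.2 * H ζ) :
    ∀ᶠ ζ in 𝓝 0, G ζ = H ζ := by
  refine cancel_aux (fun ζ => ζ.2) (0, 1) ?_ hG hH h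
  intro ζ t ht h0
  simp [h0, ht]

lemma cfun_zero (a : ℕ × ℕ → ℚ_[p]) : cfun a 0 = a (0, 0) := by
  rw [cfun, tsum_eq_single (0, 0)]
  · simp
  · rintro ⟨i, j⟩ h
    by_cases hi : i = 0
    · have : j ≠ 0 := by rintro rfl; exact h (by rw [hi])
      simp [this]
    · simp [hi]

lemma analyticAt_inr {F : ℚ_[p] × ℚ_[p] → ℚ_[p]} (hF : AnalyticAt ℚ_[p] F 0) :
    AnalyticAt ℚ_[p] (fun y : ℚ_[p] => F (0, y)) 0 :=
  AnalyticAt.comp (g := F) (f := fun y : ℚ_[p] => ((0 : ℚ_[p]), y)) hF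
    (analyticAt_const.prod analyticAt_id)

lemma analyticAt_inl {F : ℚ_[p] × ℚ_[p] → ℚ_[p]} (hF : AnalyticAt ℚ_[p] F 0) :
    AnalyticAt ℚ_[p] (fun y : ℚ_[p] => F (y, 0)) 0 :=
  AnalyticAt.comp (g := F) (f := fun y : ℚ_[p] => (y, (0 : ℚ_[p]))) hF
    (analyticAt_id.prod analyticAt_const)

lemma cfun_axis_ne {δ : ℚ_[p]} (j : ℕ) : ∀ (a : ℕ × ℕ → ℚ_[p]), Conv a δ → a (0, j) ≠ 0 →
    ¬ ∀ᶠ y in 𝓝 (0 : ℚ_[p]), cfun a (0, y) = 0 := by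
  induction j with
  | zero =>
    intro a ha h0 h
    have := h.self_of_nhds
    rw [← Prod.zero_eq_mk, cfun_zero] at this
    exact h0 this
  | succ j ih =>
    intro a ha h0 h
    refine ih (sh2 a) ha.sh2 h0 ?_
    have hc : ContinuousAt (fun y : ℚ_[p] => cfun (sh2 a) (0, y)) 0 :=
      (analyticAt_inr ha.sh2.analyticAt).continuousAt
    have hne : ∀ᶠ y in 𝓝[≠] (0 : ℚ_[p]), cfun (sh2 a) (0, y) = 0 := by
      filter_upwards [nhdsWithin_le_nhds h,
        nhdsWithin_le_nhds (tendsto_inr.eventually (eventually_small ha.1)),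
        self_mem_nhdsWithin] with y hy hy2 hy3
      have := ha.split2 (ζ := (0, y)) hy2.1 hy2.2
      simp only [hy, h.self_of_nhds, zero_add] at this
      exact (mul_eq_zero.1 this.symm).resolve_left hy3
    have h0' : cfun (sh2 a) (0, 0) = 0 :=
      tendsto_nhds_unique_of_eventuallyEq (hc.tendsto.mono_left nhdsWithin_le_nhds)
        tendsto_const_nhds hne
    rw [eventually_nhdsWithin_iff] at hne
    filter_upwards [hne] with y hy
    by_cases hy0 : y = 0
    · rw [hy0, h0']
    · exact hy hy0

lemma cfun_eq_pow {δ : ℚ_[p]} (k : ℕ) : ∀ (a : ℕ × ℕ → ℚ_[p]), Conv a δ →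
    (∀ i < k, ∀ j, a (i, j) = 0) → Conv (fun n => a (n.1 + k, n.2)) δ ∧
      ∀ᶠ ζ in 𝓝 (0 : ℚ_[p] × ℚ_[p]), cfun a ζ = ζ.1 ^ k * cfun (fun n => a (n.1 + k, n.2)) ζ := by
  induction k with
  | zero => intro a ha _; exact ⟨ha, by simp⟩
  | succ k ih =>
    intro a ha h0
    obtain ⟨h1, h2⟩ := ih (sh1 a) ha.sh1 (fun i hi j => h0 (i + 1) (by omega) j)
    refine ⟨h1, ?_⟩
    filter_upwards [h2, eventually_small ha.1] with ζ h3 h4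
    rw [ha.split1 h4.1 h4.2, h3, pow_succ']
    have : cfun a (0, ζ.2) = 0 := by
      rw [cfun]
      refine (tsum_congr fun n => ?_).trans tsum_zero
      rcases Nat.eq_zero_or_pos n.1 with hn | hn
      · rw [show n = (0, n.2) from Prod.ext hn rfl, h0 0 (by omega), zero_mul]
      · rw [zero_pow hn.ne', zero_mul, mul_zero]
    rw [this, zero_add, mul_assoc]
    rfl

/-- Normal form of a germ. -/
lemma exists_normal {F : ℚ_[p] × ℚ_[p] → ℚ_[p]} (hF : AnalyticAt ℚ_[p] F 0) :
    (∀ᶠ ζ in 𝓝 0, F ζ = 0) ∨ ∃ (k : ℕ) (F' : ℚ_[p] × ℚ_[p] → ℚ_[p]), AnalyticAt ℚ_[p] F' 0 ∧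
      (∀ᶠ ζ in 𝓝 (0 : ℚ_[p] × ℚ_[p]), F ζ = ζ.1 ^ k * F' ζ) ∧
      ¬ ∀ᶠ y in 𝓝 (0 : ℚ_[p]), F' (0, y) = 0 := by
  obtain ⟨a, δ, ha, hFa⟩ := exists_coeffs hF
  by_cases h : ∃ i j, a (i, j) ≠ 0
  · right
    classical
    obtain ⟨j, hj⟩ := Nat.find_spec h
    have hmin : ∀ i < Nat.find h, ∀ j, a (i, j) = 0 := by
      intro i hi j
      have := Nat.find_min h hi
      push Not at this
      exact this j
    obtain ⟨h1, h2⟩ := cfun_eq_pow _ a ha hmin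
    refine ⟨Nat.find h, _, h1.analyticAt, ?_, cfun_axis_ne j _ h1 (by simpa using hj)⟩
    filter_upwards [hFa, h2] with ζ h3 h4
    rw [h3, h4]
  · left
    push Not at h
    filter_upwards [hFa] with ζ h3
    rw [h3, cfun]
    exact (tsum_congr fun n => by rw [show a n = 0 from h n.1 n.2, zero_mul]).trans tsum_zero

end PadicSub

end

section

open scoped Topology

namespace PadicSub

variable {p : ℕ} [Fact p.Prime]

lemma iteratedDeriv_taylor {f ψ : ℚ_[p] → ℚ_[p]} (m : ℕ) (c : ℕ → ℚ_[p])
    (hψ : AnalyticAt ℚ_[p] ψ 0)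
    (h : ∀ᶠ y in 𝓝 0, f y = ∑ k ∈ Finset.range m, c k * y ^ k + y ^ m * ψ y) :
    iteratedDeriv m f 0 = m.factorial * ψ 0 := by
  have hp : ∀ k : ℕ, ContDiffAt ℚ_[p] m (fun y : ℚ_[p] => y ^ k) 0 := fun k => by fun_prop
  rw [Filter.EventuallyEq.iteratedDeriv_eq m h]
  rw [iteratedDeriv_fun_add (ContDiffAt.sum fun k _ => contDiffAt_const.mul (hp k))
    ((hp m).mul hψ.contDiffAt)]
  rw [iteratedDeriv_fun_sum (fun k _ => contDiffAt_const.mul (hp k))]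
  have h1 : ∑ k ∈ Finset.range m, iteratedDeriv m (fun y : ℚ_[p] => c k * y ^ k) 0 = 0 := by
    refine Finset.sum_eq_zero fun k hk => ?_
    rw [iteratedDeriv_const_mul _ (hp k), iteratedDeriv_fun_pow_zero, if_neg, Nat.cast_zero, mul_zero]
    simp at hk; omega
  rw [h1, zero_add]
  have h2 := iteratedDeriv_mul (hp m) (hψ.contDiffAt (n := m))
  refine h2.trans ?_
  rw [Finset.sum_eq_single m]
  · rw [iteratedDeriv_fun_pow_zero, if_pos rfl]; simp
  · intro i _ hi
    rw [iteratedDeriv_fun_pow_zero, if_neg hi]; simp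
  · simp

lemma taylor2 {F : ℚ_[p] × ℚ_[p] → ℚ_[p]} (hF : AnalyticAt ℚ_[p] F 0) :
    ∃ (b : ℕ → ℚ_[p] → ℚ_[p]) (B : ℕ → ℚ_[p] × ℚ_[p] → ℚ_[p]),
      (∀ k, AnalyticAt ℚ_[p] (b k) 0) ∧ (∀ k, AnalyticAt ℚ_[p] (B k) 0) ∧
      (∀ k x, b k x = B k (x, 0)) ∧
      ∀ m, ∀ᶠ ζ in 𝓝 (0 : ℚ_[p] × ℚ_[p]),
        F ζ = ∑ k ∈ Finset.range m, b k ζ.1 * ζ.2 ^ k + ζ.2 ^ m * B m ζ := by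
  choose! D hD1 hD2 using fun (G : ℚ_[p] × ℚ_[p] → ℚ_[p]) (hG : AnalyticAt ℚ_[p] G 0) =>
    exists_div2 hG
  have hB : ∀ k, AnalyticAt ℚ_[p] (D^[k] F) 0 := by
    intro k
    induction k with
    | zero => exact hF
    | succ k ih => rw [Function.iterate_succ_apply']; exact hD1 _ ih
  refine ⟨fun k x => (D^[k] F) (x, 0), fun k => D^[k] F, fun k => analyticAt_inl (hB k), hB,
    fun _ _ => rfl, fun m => ?_⟩
  induction m with
  | zero => simp
  | succ m ih =>
    filter_upwards [ih, hD2 _ (hB m)] with ζ h1 h2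
    rw [h1, Finset.sum_range_succ, h2, Function.iterate_succ_apply']
    ring

/-- Partial derivative with respect to the second variable. -/
noncomputable def d2 (F : ℚ_[p] × ℚ_[p] → ℚ_[p]) (z : ℚ_[p] × ℚ_[p]) : ℚ_[p] :=
  fderiv ℚ_[p] F z (0, 1)

lemma analyticAt_d2 {F : ℚ_[p] × ℚ_[p] → ℚ_[p]} {z : ℚ_[p] × ℚ_[p]}
    (hF : AnalyticAt ℚ_[p] F z) : AnalyticAt ℚ_[p] (d2 F) z := by
  exact ((ContinuousLinearMap.apply ℚ_[p] ℚ_[p] ((0, 1) : ℚ_[p] × ℚ_[p])).analyticAt _).comp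
    hF.fderiv

lemma analyticAt_d2_iter {F : ℚ_[p] × ℚ_[p] → ℚ_[p]} {z : ℚ_[p] × ℚ_[p]}
    (hF : AnalyticAt ℚ_[p] F z) (k : ℕ) : AnalyticAt ℚ_[p] (d2^[k] F) z := by
  induction k with
  | zero => exact hF
  | succ k ih => rw [Function.iterate_succ_apply']; exact analyticAt_d2 ih

lemma deriv_eq_d2 {F : ℚ_[p] × ℚ_[p] → ℚ_[p]} {z : ℚ_[p] × ℚ_[p]}
    (hF : AnalyticAt ℚ_[p] F z) : deriv (fun y => F (z.1, y)) z.2 = d2 F z := by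
  have h1 : HasDerivAt (fun y : ℚ_[p] => (z.1, y)) (0, 1) z.2 :=
    (hasDerivAt_const z.2 z.1).prodMk (hasDerivAt_id z.2)
  have h2 : HasFDerivAt F (fderiv ℚ_[p] F z) (z.1, z.2) := hF.differentiableAt.hasFDerivAt
  exact (h2.comp_hasDerivAt z.2 h1).deriv

lemma iteratedDeriv_eq_d2 {F : ℚ_[p] × ℚ_[p] → ℚ_[p]} (hF : AnalyticAt ℚ_[p] F 0) (k : ℕ) :
    ∀ᶠ z in 𝓝 (0 : ℚ_[p] × ℚ_[p]), iteratedDeriv k (fun y => F (z.1, y)) z.2 = (d2^[k] F) z := by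
  induction k with
  | zero => simp
  | succ k ih =>
    filter_upwards [ih.eventually_nhds, (analyticAt_d2_iter hF k).eventually_analyticAt]
      with z h1 h2
    have hc : Tendsto (fun y : ℚ_[p] => (z.1, y)) (𝓝 z.2) (𝓝 z) := by
      have : Continuous (fun y : ℚ_[p] => (z.1, y)) := by fun_prop
      exact this.tendsto' _ _ rfl
    have h3 : iteratedDeriv k (fun y => F (z.1, y)) =ᶠ[𝓝 z.2] fun y => (d2^[k] F) (z.1, y) :=
      hc.eventually h1
    rw [iteratedDeriv_succ, h3.deriv_eq, Function.iterate_succ_apply', deriv_eq_d2 h2]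

lemma implicit {D : ℚ_[p] × ℚ_[p] → ℚ_[p]} (hD : AnalyticAt ℚ_[p] D 0) (h0 : D 0 = 0)
    (h2 : d2 D 0 ≠ 0) :
    ∃ g : ℚ_[p] → ℚ_[p], AnalyticAt ℚ_[p] g 0 ∧ g 0 = 0 ∧ ∀ᶠ x in 𝓝 0, D (x, g x) = 0 := by
  set L := fderiv ℚ_[p] D 0 with hL
  set α := L (1, 0) with hα
  set β := L (0, 1) with hβ
  have hβ0 : β ≠ 0 := h2
  have hLe : ∀ u : ℚ_[p] × ℚ_[p], L u = α * u.1 + β * u.2 := by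
    intro u
    have : u = u.1 • ((1, 0) : ℚ_[p] × ℚ_[p]) + u.2 • ((0, 1) : ℚ_[p] × ℚ_[p]) := by
      ext <;> simp
    conv_lhs => rw [this, map_add, map_smul, map_smul]
    simp only [smul_eq_mul, ← hα, ← hβ]; ring
  let i : (ℚ_[p] × ℚ_[p]) ≃L[ℚ_[p]] (ℚ_[p] × ℚ_[p]) :=
    ContinuousLinearEquiv.equivOfInverse
      ((ContinuousLinearMap.fst ℚ_[p] ℚ_[p] ℚ_[p]).prod L)
      ((ContinuousLinearMap.fst ℚ_[p] ℚ_[p] ℚ_[p]).prod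
        (β⁻¹ • (ContinuousLinearMap.snd ℚ_[p] ℚ_[p] ℚ_[p] -
          α • ContinuousLinearMap.fst ℚ_[p] ℚ_[p] ℚ_[p])))
      (by
        intro u
        ext
        · simp
        · simp [hLe]; field_simp)
      (by
        intro u
        ext
        · simp
        · simp [hLe]; field_simp; ring)
  let Θ : ℚ_[p] × ℚ_[p] → ℚ_[p] × ℚ_[p] := fun z => (z.1, D z)
  have hΘa : AnalyticAt ℚ_[p] Θ 0 := analyticAt_fst.prod hD
  have hΘf : HasStrictFDerivAt Θ (i : (ℚ_[p] × ℚ_[p]) →L[ℚ_[p]] (ℚ_[p] × ℚ_[p])) 0 :=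
    (hasStrictFDerivAt_fst).prodMk hD.hasStrictFDerivAt
  let R := hΘf.toOpenPartialHomeomorph Θ
  have hR0 : (0 : ℚ_[p] × ℚ_[p]) ∈ R.source :=
    HasStrictFDerivAt.mem_toOpenPartialHomeomorph_source _
  have hΘ0 : Θ 0 = 0 := by simp [Θ, h0]
  have hRs : AnalyticAt ℚ_[p] R.symm 0 := by
    have := R.analyticAt_symm' (i := i) hR0 hΘa hΘf.hasFDerivAt.fderiv
    have e : R 0 = 0 := hΘ0
    rwa [e] at this
  have hsymm0 : R.symm 0 = 0 := by
    have := R.left_inv hR0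
    have e : R 0 = 0 := hΘ0
    rwa [e] at this
  have hright : ∀ᶠ w in 𝓝 (0 : ℚ_[p] × ℚ_[p]), Θ (R.symm w) = w := by
    have ht : (0 : ℚ_[p] × ℚ_[p]) ∈ R.target := by
      have := R.map_source hR0
      have e : R 0 = 0 := hΘ0
      rwa [e] at this
    filter_upwards [R.open_target.mem_nhds ht] with w hw
    exact R.right_inv hw
  refine ⟨fun x => (R.symm (x, 0)).2, ?_, ?_, ?_⟩
  · have : AnalyticAt ℚ_[p] (fun w : ℚ_[p] × ℚ_[p] => (R.symm w).2) 0 :=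
      (analyticAt_snd).comp hRs
    exact analyticAt_inl this
  · show (R.symm 0).2 = 0
    rw [hsymm0]; rfl
  · filter_upwards [tendsto_inl.eventually hright] with x hx
    have hx1 : (R.symm (x, 0)).1 = x := congrArg Prod.fst hx
    have hx2 : D (R.symm (x, 0)) = 0 := congrArg Prod.snd hx
    have : (x, (R.symm (x, 0)).2) = R.symm (x, 0) := Prod.ext hx1.symm rfl
    rw [this, hx2]

/-- Tschirnhausen transformation. -/
lemma tsch {F : ℚ_[p] × ℚ_[p] → ℚ_[p]} (hF : AnalyticAt ℚ_[p] F 0) (m : ℕ)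
    (hm : analyticOrderAt (fun y => F (0, y)) 0 = (m + 1 : ℕ)) :
    ∃ g : ℚ_[p] → ℚ_[p], AnalyticAt ℚ_[p] g 0 ∧ g 0 = 0 ∧
      ∃ (b : ℕ → ℚ_[p] → ℚ_[p]) (B : ℚ_[p] × ℚ_[p] → ℚ_[p]),
        (∀ k, AnalyticAt ℚ_[p] (b k) 0) ∧ AnalyticAt ℚ_[p] B 0 ∧ B 0 ≠ 0 ∧
        ∀ᶠ ζ in 𝓝 (0 : ℚ_[p] × ℚ_[p]), F (ζ.1, ζ.2 + g ζ.1) =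
          ∑ k ∈ Finset.range m, b k ζ.1 * ζ.2 ^ k + ζ.2 ^ (m + 1) * B ζ := by
  have hord := (analyticOrderAt_eq_nat_iff_iteratedDeriv_eq_zero (analyticAt_inr hF)).1 hm
  have hD0 : (d2^[m] F) 0 = 0 := by
    rw [← (iteratedDeriv_eq_d2 hF m).self_of_nhds]
    exact hord.1 m (by omega)
  have hD1 : d2 (d2^[m] F) 0 ≠ 0 := by
    rw [← Function.iterate_succ_apply' d2, ← (iteratedDeriv_eq_d2 hF (m + 1)).self_of_nhds]
    exact hord.2
  obtain ⟨g, hg, hg0, hgD⟩ := implicit (analyticAt_d2_iter hF m) hD0 hD1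
  refine ⟨g, hg, hg0, ?_⟩
  have hsh : AnalyticAt ℚ_[p] (fun ζ : ℚ_[p] × ℚ_[p] => (ζ.1, ζ.2 + g ζ.1)) 0 :=
    analyticAt_fst.prod (analyticAt_snd.add (AnalyticAt.comp (g := g) hg analyticAt_fst))
  have hG : AnalyticAt ℚ_[p] (fun ζ : ℚ_[p] × ℚ_[p] => F (ζ.1, ζ.2 + g ζ.1)) 0 := by
    refine AnalyticAt.comp (g := F) ?_ hsh
    have e : ((0 : ℚ_[p] × ℚ_[p]).1, (0 : ℚ_[p] × ℚ_[p]).2 + g (0 : ℚ_[p] × ℚ_[p]).1) = 0 := by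
      simp [hg0]
    rw [e]; exact hF
  obtain ⟨b, B, hb, hB, hbB, hT⟩ := taylor2 hG
  have key : ∀ n, ∀ᶠ x in 𝓝 (0 : ℚ_[p]),
      iteratedDeriv n (fun y => F (x, y)) (g x) = n.factorial * B n (x, 0) := by
    intro n
    have h1 := tendsto_inl.eventually (hT n).eventually_nhds
    have h2 := tendsto_inl.eventually (hB n).eventually_analyticAt
    filter_upwards [h1, h2] with x h1 h2
    have hc : Tendsto (fun y : ℚ_[p] => (x, y)) (𝓝 0) (𝓝 (x, 0)) := by
      have : Continuous (fun y : ℚ_[p] => (x, y)) := by fun_prop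
      exact this.tendsto' _ _ rfl
    have hψ : AnalyticAt ℚ_[p] (fun y : ℚ_[p] => B n (x, y)) 0 :=
      AnalyticAt.comp (g := B n) (f := fun y : ℚ_[p] => (x, y)) h2
        (analyticAt_const.prod analyticAt_id)
    have := iteratedDeriv_taylor n (fun k => b k x) hψ (hc.eventually h1)
    rw [← this]
    have e := congrFun (iteratedDeriv_comp_add_const n (fun y => F (x, y)) (g x)) 0
    simp only [zero_add] at e
    exact e.symm
  have hbm : ∀ᶠ x in 𝓝 (0 : ℚ_[p]), b m x = 0 := by
    have hcur : Tendsto (fun x : ℚ_[p] => (x, g x)) (𝓝 0) (𝓝 0) := by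
      have : ContinuousAt (fun x : ℚ_[p] => (x, g x)) 0 := continuousAt_id.prodMk hg.continuousAt
      have e : ((0 : ℚ_[p]), g 0) = 0 := by rw [hg0]; rfl
      rw [ContinuousAt, e] at this
      exact this
    filter_upwards [key m, hgD, hcur.eventually (iteratedDeriv_eq_d2 hF m)] with x h1 h2 h3
    rw [h3, h2, ← hbB] at h1
    have : (m.factorial : ℚ_[p]) ≠ 0 := by exact_mod_cast m.factorial_ne_zero
    simpa [this] using h1.symm
  refine ⟨b, B (m + 1), hb, hB _, ?_, ?_⟩
  · intro hz
    have h1 := (key (m + 1)).self_of_nhds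
    rw [hg0, ← Prod.zero_eq_mk, hz, mul_zero] at h1
    exact hord.2 h1
  · filter_upwards [hT (m + 1), (continuous_fst.tendsto (0 : ℚ_[p] × ℚ_[p])).eventually hbm]
      with ζ h1 h2
    rw [h1, Finset.sum_range_succ, h2, zero_mul, add_zero]

end PadicSub

end

section

open scoped Topology

namespace PadicSub

variable {p : ℕ} [Fact p.Prime]

/-- A germ which is a monomial times a unit. -/
def Mono (F : ℚ_[p] × ℚ_[p] → ℚ_[p]) : Prop :=
  ∃ (a b : ℕ) (u : ℚ_[p] × ℚ_[p] → ℚ_[p]), AnalyticAt ℚ_[p] u 0 ∧ u 0 ≠ 0 ∧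
    ∀ᶠ ζ in 𝓝 (0 : ℚ_[p] × ℚ_[p]), F ζ = ζ.1 ^ a * ζ.2 ^ b * u ζ

lemma onevar {f : ℚ_[p] → ℚ_[p]} (hf : AnalyticAt ℚ_[p] f 0) (h : ¬ ∀ᶠ x in 𝓝 0, f x = 0) :
    ∃ (n : ℕ) (u : ℚ_[p] → ℚ_[p]), AnalyticAt ℚ_[p] u 0 ∧ u 0 ≠ 0 ∧
      ∀ᶠ x in 𝓝 0, f x = x ^ n * u x := by
  obtain ⟨n, g, hg, hg0, h⟩ := (hf.exists_eventuallyEq_pow_smul_nonzero_iff).2 h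
  exact ⟨n, g, hg, hg0, by simpa using h⟩

lemma onevar_prod {f g : ℚ_[p] → ℚ_[p]} (hf : AnalyticAt ℚ_[p] f 0) (hg : AnalyticAt ℚ_[p] g 0)
    (h : ∀ᶠ x in 𝓝 0, f x * g x = 0) : (∀ᶠ x in 𝓝 0, f x = 0) ∨ (∀ᶠ x in 𝓝 0, g x = 0) := by
  rcases hf.eventually_eq_zero_or_eventually_ne_zero with h1 | h1
  · exact Or.inl h1
  rcases hg.eventually_eq_zero_or_eventually_ne_zero with h2 | h2
  · exact Or.inr h2
  exfalso
  obtain ⟨x, hx1, hx2, hx3⟩ := (h1.and (h2.and (nhdsWithin_le_nhds (s := {0}ᶜ) h))).exists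
  exact (mul_ne_zero hx1 hx2) hx3

lemma mono_of_mul2 {F G u : ℚ_[p] × ℚ_[p] → ℚ_[p]} (b : ℕ) (hF : AnalyticAt ℚ_[p] F 0)
    (hG : AnalyticAt ℚ_[p] G 0) (hu : AnalyticAt ℚ_[p] u 0) (hu0 : u 0 ≠ 0)
    (h : ∀ᶠ ζ in 𝓝 (0 : ℚ_[p] × ℚ_[p]), F ζ * G ζ = ζ.2 ^ b * u ζ) : Mono F := by
  induction b generalizing F G with
  | zero =>
    refine ⟨0, 0, F, hF, ?_, by simp⟩
    intro h0
    have := h.self_of_nhds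
    simp [h0] at this
    exact hu0 this.symm
  | succ b ih =>
    have hz : ∀ᶠ x in 𝓝 (0 : ℚ_[p]), F (x, 0) * G (x, 0) = 0 := by
      filter_upwards [tendsto_inl.eventually h] with x hx
      simpa using hx
    have hR : AnalyticAt ℚ_[p] (fun ζ : ℚ_[p] × ℚ_[p] => ζ.2 ^ b * u ζ) 0 :=
      (analyticAt_snd.pow b).mul hu
    rcases onevar_prod (analyticAt_inl hF) (analyticAt_inl hG) hz with h1 | h1
    · obtain ⟨B, hB, hFB⟩ := exists_div2 hF
      have hB' : Mono B := by
        refine ih hB hG (cancel2 (hB.mul hG) hR ?_)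
        filter_upwards [h, hFB, (continuous_fst.tendsto (0 : ℚ_[p] × ℚ_[p])).eventually h1]
          with ζ e1 e2 e3
        rw [e3, zero_add] at e2
        rw [← mul_assoc, ← e2, e1, pow_succ']; ring
      obtain ⟨a', b', u', hu', hu0', e⟩ := hB'
      refine ⟨a', b' + 1, u', hu', hu0', ?_⟩
      filter_upwards [e, hFB, (continuous_fst.tendsto (0 : ℚ_[p] × ℚ_[p])).eventually h1]
          with ζ e1 e2 e3
      rw [e2, e3, e1]; ring
    · obtain ⟨B, hB, hFB⟩ := exists_div2 hG
      refine ih hF hB (cancel2 (hF.mul hB) hR ?_)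
      filter_upwards [h, hFB, (continuous_fst.tendsto (0 : ℚ_[p] × ℚ_[p])).eventually h1]
        with ζ e1 e2 e3
      rw [e3, zero_add] at e2
      rw [mul_left_comm, ← e2, e1, pow_succ']; ring

lemma mono_of_mul {F G u : ℚ_[p] × ℚ_[p] → ℚ_[p]} (a b : ℕ) (hF : AnalyticAt ℚ_[p] F 0)
    (hG : AnalyticAt ℚ_[p] G 0) (hu : AnalyticAt ℚ_[p] u 0) (hu0 : u 0 ≠ 0)
    (h : ∀ᶠ ζ in 𝓝 (0 : ℚ_[p] × ℚ_[p]), F ζ * G ζ = ζ.1 ^ a * ζ.2 ^ b * u ζ) : Mono F := by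
  induction a generalizing F G with
  | zero => exact mono_of_mul2 b hF hG hu hu0 (by simpa using h)
  | succ a ih =>
    have hz : ∀ᶠ x in 𝓝 (0 : ℚ_[p]), F (0, x) * G (0, x) = 0 := by
      filter_upwards [tendsto_inr.eventually h] with x hx
      simpa using hx
    have hR : AnalyticAt ℚ_[p] (fun ζ : ℚ_[p] × ℚ_[p] => ζ.1 ^ a * ζ.2 ^ b * u ζ) 0 :=
      ((analyticAt_fst.pow a).mul (analyticAt_snd.pow b)).mul hu
    rcases onevar_prod (analyticAt_inr hF) (analyticAt_inr hG) hz with h1 | h1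
    · obtain ⟨B, hB, hFB⟩ := exists_div1 hF
      have hB' : Mono B := by
        refine ih hB hG (cancel1 (hB.mul hG) hR ?_)
        filter_upwards [h, hFB, (continuous_snd.tendsto (0 : ℚ_[p] × ℚ_[p])).eventually h1]
          with ζ e1 e2 e3
        rw [e3, zero_add] at e2
        rw [← mul_assoc, ← e2, e1, pow_succ']; ring
      obtain ⟨a', b', u', hu', hu0', e⟩ := hB'
      refine ⟨a' + 1, b', u', hu', hu0', ?_⟩
      filter_upwards [e, hFB, (continuous_snd.tendsto (0 : ℚ_[p] × ℚ_[p])).eventually h1]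
          with ζ e1 e2 e3
      rw [e2, e3, e1]; ring
    · obtain ⟨B, hB, hFB⟩ := exists_div1 hG
      refine ih hF hB (cancel1 (hF.mul hB) hR ?_)
      filter_upwards [h, hFB, (continuous_snd.tendsto (0 : ℚ_[p] × ℚ_[p])).eventually h1]
        with ζ e1 e2 e3
      rw [e3, zero_add] at e2
      rw [mul_left_comm, ← e2, e1, pow_succ']; ring

lemma sum_pow_order {c : ℚ_[p]} (hc : c ≠ 0) (n : ℕ) : ∀ (S : Finset ℕ) (A : ℕ → ℚ_[p]),
    S.card = n + 1 → (∀ k ∈ S, A k ≠ 0) →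
    ∃ m : ℕ, m ≤ n ∧ analyticOrderAt (fun w => ∑ k ∈ S, A k * (w + c) ^ k) 0 = m := by
  induction n with
  | zero =>
    intro S A hS hA
    obtain ⟨k, rfl⟩ := Finset.card_eq_one.1 hS
    refine ⟨0, le_rfl, ?_⟩
    have han : AnalyticAt ℚ_[p] (fun w => ∑ k ∈ ({k} : Finset ℕ), A k * (w + c) ^ k) 0 := by
      simp only [Finset.sum_singleton]; fun_prop
    simp only [Nat.cast_zero]
    rw [han.analyticOrderAt_eq_zero]
    simp [hc, hA k (by simp)]
  | succ n ih =>
    intro S A hS hA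
    have hne : S.Nonempty := Finset.card_pos.1 (by omega)
    set e := S.min' hne with he
    have hemem : e ∈ S := S.min'_mem hne
    have hele : ∀ k ∈ S, e ≤ k := fun k hk => S.min'_le k hk
    let h : ℚ_[p] → ℚ_[p] := fun w => ∑ k ∈ S, A k * (w + c) ^ (k - e)
    have hfac : (fun w => ∑ k ∈ S, A k * (w + c) ^ k) = (fun w => (w + c) ^ e) * h := by
      funext w
      simp only [Pi.mul_apply, h, Finset.mul_sum]
      refine Finset.sum_congr rfl fun k hk => ?_
      have : (w + c) ^ k = (w + c) ^ (k - e) * (w + c) ^ e := by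
        rw [← pow_add, Nat.sub_add_cancel (hele k hk)]
      rw [this]; ring
    have hhan : AnalyticAt ℚ_[p] h 0 := by
      apply Finset.analyticAt_fun_sum
      intro k _
      fun_prop
    have hpan : AnalyticAt ℚ_[p] (fun w : ℚ_[p] => (w + c) ^ e) 0 := by fun_prop
    have hp0 : analyticOrderAt (fun w : ℚ_[p] => (w + c) ^ e) 0 = 0 := by
      rw [hpan.analyticOrderAt_eq_zero]; simp [hc]
    rw [hfac, analyticOrderAt_mul hpan hhan, hp0, zero_add]
    by_cases h0 : h 0 = 0
    · let φ : ℕ → ℕ := fun k => k - e - 1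
      have hlt : ∀ k ∈ S.erase e, e + 1 ≤ k := by
        intro k hk
        have h1 := Finset.ne_of_mem_erase hk
        have h2 := hele k (Finset.mem_of_mem_erase hk)
        omega
      have hinj : Set.InjOn φ (S.erase e) := by
        intro k hk l hl hkl
        have h1 := hlt k hk
        have h2 := hlt l hl
        simp only [φ] at hkl
        omega
      obtain ⟨m, hm, hord⟩ := ih ((S.erase e).image φ)
        (fun j => A (j + e + 1) * ((j + 1 : ℕ) : ℚ_[p]))
        (by rw [Finset.card_image_of_injOn hinj, Finset.card_erase_of_mem hemem]; omega)
        (by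
          intro j hj
          obtain ⟨k, hk, rfl⟩ := Finset.mem_image.1 hj
          have h1 := hlt k hk
          have : φ k + e + 1 = k := by simp only [φ]; omega
          rw [this]
          exact mul_ne_zero (hA k (Finset.mem_of_mem_erase hk)) (Nat.cast_ne_zero.2 (by omega)))
      have hder : deriv h = fun w => ∑ j ∈ (S.erase e).image φ,
          A (j + e + 1) * ((j + 1 : ℕ) : ℚ_[p]) * (w + c) ^ j := by
        funext w
        rw [Finset.sum_image hinj]
        have hd : HasDerivAt h (∑ k ∈ S, A k * (((k - e : ℕ) : ℚ_[p]) * (w + c) ^ (k - e - 1))) w := by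
          apply HasDerivAt.fun_sum
          intro k _
          apply HasDerivAt.const_mul
          have := (((hasDerivAt_id' w).add_const c).fun_pow (k - e))
          simpa using this
        rw [hd.deriv, ← Finset.add_sum_erase _ _ hemem]
        simp only [Nat.sub_self, Nat.cast_zero, zero_mul, mul_zero, zero_add]
        refine Finset.sum_congr rfl fun k hk => ?_
        have h1 := hlt k hk
        have e1 : φ k + e + 1 = k := by simp only [φ]; omega
        have e2 : φ k + 1 = k - e := by simp only [φ]; omega
        rw [e1, e2, mul_assoc]
      refine ⟨m + 1, by omega, ?_⟩
      rw [← hder] at hord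
      rw [Nat.cast_add_one]
      exact (analyticOrderAt_deriv_eq_iff hhan h0).2 hord
    · refine ⟨0, by omega, ?_⟩
      rw [Nat.cast_zero, hhan.analyticOrderAt_eq_zero]
      exact h0

end PadicSub

end

section

open scoped Topology

namespace PadicSub

variable {p : ℕ} [Fact p.Prime]

/-- The filter of neighbourhoods of the graph of `f` along `U`. -/
noncomputable def FF (U : Ultrafilter ℚ_[p]) (f : ℚ_[p] → ℚ_[p]) : Filter (ℚ_[p] × ℚ_[p]) :=
  Filter.bind (U : Filter ℚ_[p]) (fun x => (𝓝 (f x)).map (Prod.mk x))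

lemma ev_FF {U : Ultrafilter ℚ_[p]} {f : ℚ_[p] → ℚ_[p]} {P : ℚ_[p] × ℚ_[p] → Prop} :
    (∀ᶠ ω in FF U f, P ω) ↔ ∀ᶠ x in (U : Filter ℚ_[p]), ∀ᶠ y in 𝓝 (f x), P (x, y) := by
  rw [FF, Filter.eventually_bind]; rfl

lemma ev_graph {U : Ultrafilter ℚ_[p]} {f : ℚ_[p] → ℚ_[p]} {P : ℚ_[p] × ℚ_[p] → Prop}
    (h : ∀ᶠ ω in FF U f, P ω) : ∀ᶠ x in (U : Filter ℚ_[p]), P (x, f x) := by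
  filter_upwards [ev_FF.1 h] with x hx using hx.self_of_nhds

/-- Charts along an ultrafilter. -/
structure Chart (U : Ultrafilter ℚ_[p]) (f : ℚ_[p] → ℚ_[p])
    (z : ℚ_[p] × ℚ_[p] → ℚ_[p] × ℚ_[p]) : Prop where
  cont : ∀ᶠ x in (U : Filter ℚ_[p]), ContinuousAt (fun y => z (x, y)) (f x)
  lim : Tendsto (fun x => z (x, f x)) (U : Filter ℚ_[p]) (𝓝 0)
  nocurve : ¬ ∃ (s : ℚ_[p] → ℚ_[p]) (Ψ : ℚ_[p] → ℚ_[p] × ℚ_[p]),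
    Tendsto s (U : Filter ℚ_[p]) (𝓝 0) ∧ AnalyticAt ℚ_[p] Ψ 0 ∧ Ψ 0 = 0 ∧
      ∀ᶠ x in (U : Filter ℚ_[p]), z (x, f x) = Ψ (s x)

/-- `z` factors analytically through `z'`. -/
def Ref (U : Ultrafilter ℚ_[p]) (f : ℚ_[p] → ℚ_[p])
    (z z' : ℚ_[p] × ℚ_[p] → ℚ_[p] × ℚ_[p]) : Prop :=
  ∃ Φ : ℚ_[p] × ℚ_[p] → ℚ_[p] × ℚ_[p], AnalyticAt ℚ_[p] Φ 0 ∧ Φ 0 = 0 ∧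
    ∀ᶠ ω in FF U f, z ω = Φ (z' ω)

variable {U : Ultrafilter ℚ_[p]} {f : ℚ_[p] → ℚ_[p]}
  {z z' z'' : ℚ_[p] × ℚ_[p] → ℚ_[p] × ℚ_[p]}

lemma ev_of_cont {P : ℚ_[p] × ℚ_[p] → Prop} {S : Set (ℚ_[p] × ℚ_[p])}
    (hS : IsOpen S) (hP : ∀ s ∈ S, P s)
    (hc : ∀ᶠ x in (U : Filter ℚ_[p]), ContinuousAt (fun y => z (x, y)) (f x))
    (hg : ∀ᶠ x in (U : Filter ℚ_[p]), z (x, f x) ∈ S) : ∀ᶠ ω in FF U f, P (z ω) := by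
  rw [ev_FF]
  filter_upwards [hc, hg] with x h1 h2
  filter_upwards [h1.preimage_mem_nhds (hS.mem_nhds h2)] with y hy using hP _ hy

lemma Chart.tendsto (hz : Chart U f z) : Tendsto z (FF U f) (𝓝 0) := by
  rw [tendsto_def]
  intro S hS
  obtain ⟨T, hTS, hT, h0⟩ := mem_nhds_iff.1 hS
  exact ev_of_cont (P := fun w => w ∈ S) hT hTS hz.cont (hz.lim (hT.mem_nhds h0))

lemma Ref.refl : Ref U f z z := ⟨id, analyticAt_id, rfl, by simp⟩

lemma Ref.trans (h : Ref U f z z') (h' : Ref U f z' z'') : Ref U f z z'' := by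
  obtain ⟨Φ, h1, h2, h3⟩ := h
  obtain ⟨Φ', h1', h2', h3'⟩ := h'
  refine ⟨Φ ∘ Φ', AnalyticAt.comp (by rwa [h2']) h1', by simp [h2, h2'], ?_⟩
  filter_upwards [h3, h3'] with ω e e'
  rw [e, e']; rfl

lemma Chart.of_ref (hz : Chart U f z) (h : Ref U f z z')
    (hc : ∀ᶠ x in (U : Filter ℚ_[p]), ContinuousAt (fun y => z' (x, y)) (f x))
    (hl : Tendsto (fun x => z' (x, f x)) (U : Filter ℚ_[p]) (𝓝 0)) : Chart U f z' := by
  refine ⟨hc, hl, ?_⟩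
  rintro ⟨s, Ψ, h1, h2, h3, h4⟩
  obtain ⟨Φ, k1, k2, k3⟩ := h
  refine hz.nocurve ⟨s, Φ ∘ Ψ, h1, AnalyticAt.comp (by rwa [h3]) h2, by simp [h3, k2], ?_⟩
  filter_upwards [h4, ev_graph k3] with x e1 e2
  rw [e2, e1]; rfl

lemma Chart.gne1 (hz : Chart U f z) : ∀ᶠ x in (U : Filter ℚ_[p]), (z (x, f x)).1 ≠ 0 := by
  refine Ultrafilter.eventually_not.2 fun h => ?_
  refine hz.nocurve ⟨fun x => (z (x, f x)).2, fun s => (0, s),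
    (continuous_snd.tendsto _).comp hz.lim, by fun_prop, rfl, ?_⟩
  filter_upwards [h] with x hx
  exact Prod.ext hx rfl

lemma Chart.gne2 (hz : Chart U f z) : ∀ᶠ x in (U : Filter ℚ_[p]), (z (x, f x)).2 ≠ 0 := by
  refine Ultrafilter.eventually_not.2 fun h => ?_
  refine hz.nocurve ⟨fun x => (z (x, f x)).1, fun s => (s, 0),
    (continuous_fst.tendsto _).comp hz.lim, by fun_prop, rfl, ?_⟩
  filter_upwards [h] with x hx
  exact Prod.ext rfl hx

lemma Chart.ne1 (hz : Chart U f z) : ∀ᶠ ω in FF U f, (z ω).1 ≠ 0 :=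
  ev_of_cont (P := fun w => w.1 ≠ 0) (S := {w | w.1 ≠ 0})
    (isOpen_ne_fun continuous_fst continuous_const) (fun _ h => h) hz.cont hz.gne1

lemma Chart.ne2 (hz : Chart U f z) : ∀ᶠ ω in FF U f, (z ω).2 ≠ 0 :=
  ev_of_cont (P := fun w => w.2 ≠ 0) (S := {w | w.2 ≠ 0})
    (isOpen_ne_fun continuous_snd continuous_const) (fun _ h => h) hz.cont hz.gne2

lemma Chart.shift (hz : Chart U f z) {g : ℚ_[p] → ℚ_[p]} (hg : AnalyticAt ℚ_[p] g 0)
    (hg0 : g 0 = 0) : Chart U f (fun ω => ((z ω).1, (z ω).2 - g (z ω).1)) := by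
  refine hz.of_ref ⟨fun ζ => (ζ.1, ζ.2 + g ζ.1), ?_, by simp [hg0], by simp⟩ ?_ ?_
  · have : AnalyticAt ℚ_[p] (fun ζ : ℚ_[p] × ℚ_[p] => g ζ.1) 0 :=
      AnalyticAt.comp (g := g) (f := Prod.fst) hg analyticAt_fst
    exact analyticAt_fst.prod (analyticAt_snd.add this)
  · have h1 : Tendsto (fun x => (z (x, f x)).1) (U : Filter ℚ_[p]) (𝓝 0) :=
      (continuous_fst.tendsto (0 : ℚ_[p] × ℚ_[p])).comp hz.lim
    filter_upwards [hz.cont, h1.eventually hg.eventually_analyticAt] with x hc hx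
    refine ContinuousAt.prodMk hc.fst (hc.snd.sub ?_)
    exact ContinuousAt.comp (g := g) hx.continuousAt hc.fst
  · have h1 : Tendsto (fun x => (z (x, f x)).1) (U : Filter ℚ_[p]) (𝓝 0) :=
      (continuous_fst.tendsto (0 : ℚ_[p] × ℚ_[p])).comp hz.lim
    have h2 : Tendsto (fun x => (z (x, f x)).2) (U : Filter ℚ_[p]) (𝓝 0) :=
      (continuous_snd.tendsto (0 : ℚ_[p] × ℚ_[p])).comp hz.lim
    have h3 := hg.continuousAt.tendsto.comp h1
    have := h1.prodMk_nhds (h2.sub h3)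
    simpa [hg0] using! this

/-- Limits in the projective line along an ultrafilter. -/
lemma ultra_lim {α : Type*} (V : Ultrafilter α) (h : α → ℚ_[p]) :
    (∃ c, Tendsto h (V : Filter α) (𝓝 c)) ∨ (Tendsto (fun x => (h x)⁻¹) (V : Filter α) (𝓝 0) ∧
      ∀ᶠ x in (V : Filter α), h x ≠ 0) := by
  by_cases hb : ∃ R : ℝ, ∀ᶠ x in (V : Filter α), ‖h x‖ ≤ R
  · left
    obtain ⟨R, hR⟩ := hb
    have hK : IsCompact (Metric.closedBall (0 : ℚ_[p]) R) := isCompact_closedBall _ _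
    obtain ⟨c, _, hc⟩ := hK.ultrafilter_le_nhds (V.map h) (by
      rw [le_principal_iff]
      refine mem_map.2 ?_
      filter_upwards [hR] with x hx
      simpa using hx)
    exact ⟨c, hc⟩
  · right
    push Not at hb
    have hb' : ∀ R : ℝ, ∀ᶠ x in (V : Filter α), R < ‖h x‖ := by
      intro R
      exact hb R
    have ht : Tendsto (fun x => ‖h x‖) (V : Filter α) atTop := by
      rw [tendsto_atTop]
      intro R
      filter_upwards [hb' R] with x hx using hx.le
    constructor
    · rw [tendsto_zero_iff_norm_tendsto_zero]
      simpa using! ht.inv_tendsto_atTop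
    · filter_upwards [hb' 0] with x hx
      exact norm_pos_iff.1 hx

lemma Chart.blowup (hz : Chart U f z) :
    (∃ c z', Chart U f z' ∧ ∀ᶠ ω in FF U f, z ω = ((z' ω).1, (z' ω).1 * ((z' ω).2 + c))) ∨
    (∃ z', Chart U f z' ∧ ∀ᶠ ω in FF U f, z ω = ((z' ω).1 * (z' ω).2, (z' ω).2)) := by
  have h1 : Tendsto (fun x => (z (x, f x)).1) (U : Filter ℚ_[p]) (𝓝 0) :=
      (continuous_fst.tendsto (0 : ℚ_[p] × ℚ_[p])).comp hz.lim
  have h2 : Tendsto (fun x => (z (x, f x)).2) (U : Filter ℚ_[p]) (𝓝 0) :=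
      (continuous_snd.tendsto (0 : ℚ_[p] × ℚ_[p])).comp hz.lim
  rcases ultra_lim U (fun x => (z (x, f x)).2 / (z (x, f x)).1) with ⟨c, hc⟩ | ⟨hc, _⟩
  · left
    have he : ∀ᶠ ω in FF U f, z ω = ((z ω).1, (z ω).1 * ((z ω).2 / (z ω).1 - c + c)) := by
      filter_upwards [hz.ne1] with ω hω
      refine Prod.ext rfl ?_
      simp only
      field_simp
      ring
    refine ⟨c, fun ω => ((z ω).1, (z ω).2 / (z ω).1 - c), ?_, he⟩
    refine hz.of_ref ⟨fun ζ => (ζ.1, ζ.1 * (ζ.2 + c)),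
      analyticAt_fst.prod (analyticAt_fst.mul (analyticAt_snd.add analyticAt_const)), by simp, he⟩ ?_ ?_
    · filter_upwards [hz.cont, hz.gne1] with x hx hx1
      exact ContinuousAt.prodMk hx.fst ((hx.snd.div hx.fst hx1).sub continuousAt_const)
    · have := h1.prodMk_nhds (hc.sub (tendsto_const_nhds (x := c)))
      simpa using! this
  · right
    have he : ∀ᶠ ω in FF U f, z ω = ((z ω).1 / (z ω).2 * (z ω).2, (z ω).2) := by
      filter_upwards [hz.ne2] with ω hω
      refine Prod.ext ?_ rfl
      simp only
      field_simp
    refine ⟨fun ω => ((z ω).1 / (z ω).2, (z ω).2), ?_, he⟩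
    refine hz.of_ref ⟨fun ζ => (ζ.1 * ζ.2, ζ.2),
      (analyticAt_fst.mul analyticAt_snd).prod analyticAt_snd, by simp, he⟩ ?_ ?_
    · filter_upwards [hz.cont, hz.gne2] with x hx hx1
      exact ContinuousAt.prodMk (hx.fst.div hx.snd hx1) hx.snd
    · have hc' : Tendsto (fun x => (z (x, f x)).1 / (z (x, f x)).2) (U : Filter ℚ_[p]) (𝓝 0) := by
        simpa [inv_div] using hc
      exact hc'.prodMk_nhds h2

end PadicSub

end

section

open scoped Topology

namespace PadicSub

variable {p : ℕ} [Fact p.Prime]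

/-- Toric substitution. -/
def TI (U : Ultrafilter ℚ_[p]) (f : ℚ_[p] → ℚ_[p])
    (z z' : ℚ_[p] × ℚ_[p] → ℚ_[p] × ℚ_[p]) (α β γ δ : ℕ) : Prop :=
  α * δ ≠ β * γ ∧ ∀ᶠ ω in FF U f,
    z ω = ((z' ω).1 ^ α * (z' ω).2 ^ β, (z' ω).1 ^ γ * (z' ω).2 ^ δ)

/-- Toric substitution followed by a translation. -/
def TII (U : Ultrafilter ℚ_[p]) (f : ℚ_[p] → ℚ_[p])
    (z z' : ℚ_[p] × ℚ_[p] → ℚ_[p] × ℚ_[p]) (α β γ δ : ℕ) (c : ℚ_[p]) : Prop :=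
  α * δ ≠ β * γ ∧ 0 < α ∧ 0 < γ ∧ c ≠ 0 ∧ ∀ᶠ ω in FF U f,
    z ω = ((z' ω).1 ^ α * ((z' ω).2 + c) ^ β, (z' ω).1 ^ γ * ((z' ω).2 + c) ^ δ)

variable {U : Ultrafilter ℚ_[p]} {f : ℚ_[p] → ℚ_[p]}
  {z z' z'' : ℚ_[p] × ℚ_[p] → ℚ_[p] × ℚ_[p]}

lemma det_aux {α β γ δ α' β' γ' δ' : ℕ} (h : α * δ ≠ β * γ) (h' : α' * δ' ≠ β' * γ') :
    (α' * α + γ' * β) * (β' * γ + δ' * δ) ≠ (β' * α + δ' * β) * (α' * γ + γ' * δ) := by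
  intro e
  have e' : ((α * δ : ℤ) - β * γ) * (α' * δ' - β' * γ') = 0 := by
    have : (((α' * α + γ' * β) * (β' * γ + δ' * δ) : ℕ) : ℤ) =
      (((β' * α + δ' * β) * (α' * γ + γ' * δ) : ℕ) : ℤ) := by rw [e]
    push_cast at this
    linear_combination this
  rcases mul_eq_zero.1 e' with h1 | h1
  · exact h (by exact_mod_cast sub_eq_zero.1 h1)
  · exact h' (by exact_mod_cast sub_eq_zero.1 h1)

lemma TI.comp {α β γ δ α' β' γ' δ' : ℕ} (h : TI U f z z' α β γ δ)
    (h' : TI U f z' z'' α' β' γ' δ') :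
    TI U f z z'' (α' * α + γ' * β) (β' * α + δ' * β) (α' * γ + γ' * δ) (β' * γ + δ' * δ) := by
  refine ⟨det_aux h.1 h'.1, ?_⟩
  filter_upwards [h.2, h'.2] with ω e e'
  rw [e, e']
  simp only [Prod.mk.injEq]
  constructor <;> ring

lemma TI.comp2 {α β γ δ α' β' γ' δ' : ℕ} {c : ℚ_[p]} (h : TI U f z z' α β γ δ)
    (h' : TII U f z' z'' α' β' γ' δ' c) :
    TII U f z z'' (α' * α + γ' * β) (β' * α + δ' * β) (α' * γ + γ' * δ) (β' * γ + δ' * δ) c := by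
  obtain ⟨h0, h1⟩ := h
  obtain ⟨k0, k1, k2, k3, k4⟩ := h'
  refine ⟨det_aux h0 k0, ?_, ?_, k3, ?_⟩
  · rcases Nat.eq_zero_or_pos α with rfl | ha
    · rcases Nat.eq_zero_or_pos β with rfl | hb
      · simp at h0
      · positivity
    · positivity
  · rcases Nat.eq_zero_or_pos γ with rfl | ha
    · rcases Nat.eq_zero_or_pos δ with rfl | hb
      · simp at h0
      · positivity
    · positivity
  filter_upwards [h1, k4] with ω e e'
  rw [e, e']
  simp only [Prod.mk.injEq]
  constructor <;> ring

lemma TI.refl : TI U f z z 1 0 0 1 := ⟨by simp, by simp⟩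

lemma TI.analytic {α β γ δ : ℕ} : AnalyticAt ℚ_[p] (fun ζ : ℚ_[p] × ℚ_[p] =>
    (ζ.1 ^ α * ζ.2 ^ β, ζ.1 ^ γ * ζ.2 ^ δ)) 0 :=
  ((analyticAt_fst.pow _).mul (analyticAt_snd.pow _)).prod
    ((analyticAt_fst.pow _).mul (analyticAt_snd.pow _))

lemma TII.analytic {α β γ δ : ℕ} {c : ℚ_[p]} : AnalyticAt ℚ_[p] (fun ζ : ℚ_[p] × ℚ_[p] =>
    (ζ.1 ^ α * (ζ.2 + c) ^ β, ζ.1 ^ γ * (ζ.2 + c) ^ δ)) 0 :=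
  ((analyticAt_fst.pow _).mul ((analyticAt_snd.add analyticAt_const).pow _)).prod
    ((analyticAt_fst.pow _).mul ((analyticAt_snd.add analyticAt_const).pow _))

lemma TI.zero {α β γ δ : ℕ} (h0 : α * δ ≠ β * γ) : (fun ζ : ℚ_[p] × ℚ_[p] =>
    (ζ.1 ^ α * ζ.2 ^ β, ζ.1 ^ γ * ζ.2 ^ δ)) 0 = 0 := by
  have h1 : α ≠ 0 ∨ β ≠ 0 := by
    by_contra! h; simp [h.1, h.2] at h0
  have h2 : γ ≠ 0 ∨ δ ≠ 0 := by
    by_contra! h; simp [h.1, h.2] at h0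
  refine Prod.ext ?_ ?_
  · rcases h1 with h1 | h1 <;> simp [h1]
  · rcases h2 with h1 | h1 <;> simp [h1]

lemma TI.ref {α β γ δ : ℕ} (h : TI U f z z' α β γ δ) : Ref U f z z' :=
  ⟨_, TI.analytic, TI.zero h.1, h.2⟩

lemma TII.ref {α β γ δ : ℕ} {c : ℚ_[p]} (h : TII U f z z' α β γ δ c) : Ref U f z z' :=
  ⟨_, TII.analytic, Prod.ext (by simp [h.2.1.ne']) (by simp [h.2.2.1.ne']), h.2.2.2.2⟩

lemma Chart.pair (n : ℕ) : ∀ (z : ℚ_[p] × ℚ_[p] → ℚ_[p] × ℚ_[p]) (_ : Chart U f z)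
    (u v : ℕ × ℕ) (_ : ((u.1 ≤ v.1 ∧ u.2 ≤ v.2) ∨ (v.1 ≤ u.1 ∧ v.2 ≤ u.2)) ∨ (u.1 - v.1) + (v.1 - u.1) + (u.2 - v.2) + (v.2 - u.2) ≤ n),
    ∃ z', Chart U f z' ∧ ∃ α β γ δ : ℕ,
      (TI U f z z' α β γ δ ∧
        ((α * u.1 + γ * u.2 ≤ α * v.1 + γ * v.2 ∧ β * u.1 + δ * u.2 ≤ β * v.1 + δ * v.2) ∨
         (α * v.1 + γ * v.2 ≤ α * u.1 + γ * u.2 ∧ β * v.1 + δ * v.2 ≤ β * u.1 + δ * u.2))) ∨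
      ∃ c, TII U f z z' α β γ δ c := by
  induction n with
  | zero =>
    intro z hz u v h
    exact ⟨z, hz, 1, 0, 0, 1, Or.inl ⟨TI.refl, by omega⟩⟩
  | succ n ih =>
    intro z hz u v h
    by_cases hcmp : (u.1 ≤ v.1 ∧ u.2 ≤ v.2) ∨ (v.1 ≤ u.1 ∧ v.2 ≤ u.2)
    · refine ⟨z, hz, 1, 0, 0, 1, Or.inl ⟨TI.refl, ?_⟩⟩
      simpa using hcmp
    rcases hz.blowup with ⟨c, z', hz', he⟩ | ⟨z', hz', he⟩
    · by_cases hc : c = 0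
      · subst hc
        have hT : TI U f z z' 1 0 1 1 := by
          refine ⟨by simp, ?_⟩
          filter_upwards [he] with ω e
          rw [e]; simp
        obtain ⟨z'', hz'', α, β, γ, δ, h1⟩ := ih z' hz' (u.1 + u.2, u.2) (v.1 + v.2, v.2) (by
          simp only; omega)
        refine ⟨z'', hz'', α * 1 + γ * 0, β * 1 + δ * 0, α * 1 + γ * 1, β * 1 + δ * 1, ?_⟩
        rcases h1 with ⟨h1, h2⟩ | ⟨c, h1⟩
        · refine Or.inl ⟨hT.comp h1, ?_⟩
          simp only at h2
          rcases h2 with h2 | h2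
          · left; constructor
            · linarith [h2.1]
            · linarith [h2.2]
          · right; constructor
            · linarith [h2.1]
            · linarith [h2.2]
        · exact Or.inr ⟨c, hT.comp2 h1⟩
      · refine ⟨z', hz', 1, 0, 1, 1, Or.inr ⟨c, by simp, by simp, by simp, hc, ?_⟩⟩
        filter_upwards [he] with ω e
        rw [e]; simp
    · have hT : TI U f z z' 1 1 0 1 := by
        refine ⟨by simp, ?_⟩
        filter_upwards [he] with ω e
        rw [e]; simp
      obtain ⟨z'', hz'', α, β, γ, δ, h1⟩ := ih z' hz' (u.1, u.1 + u.2) (v.1, v.1 + v.2) (by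
        simp only; omega)
      refine ⟨z'', hz'', α * 1 + γ * 1, β * 1 + δ * 1, α * 0 + γ * 1, β * 0 + δ * 1, ?_⟩
      rcases h1 with ⟨h1, h2⟩ | ⟨c, h1⟩
      · refine Or.inl ⟨hT.comp h1, ?_⟩
        simp only at h2
        rcases h2 with h2 | h2
        · left; constructor
          · linarith [h2.1]
          · linarith [h2.2]
        · right; constructor
          · linarith [h2.1]
          · linarith [h2.2]
      · exact Or.inr ⟨c, hT.comp2 h1⟩

lemma Chart.toric (hz : Chart U f z) (T : Finset (ℕ × ℕ)) (hT : T.Nonempty) :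
    ∃ z', Chart U f z' ∧ ∃ α β γ δ : ℕ,
      (TI U f z z' α β γ δ ∧ ∃ t ∈ T, ∀ v ∈ T,
        (α * t.1 + γ * t.2 ≤ α * v.1 + γ * v.2 ∧ β * t.1 + δ * t.2 ≤ β * v.1 + δ * v.2)) ∨
      ∃ c, TII U f z z' α β γ δ c := by
  induction hT using Finset.Nonempty.cons_induction with
  | singleton a => exact ⟨z, hz, 1, 0, 0, 1, Or.inl ⟨TI.refl, a, by simp, by simp⟩⟩
  | cons a s ha hs ih =>
    obtain ⟨z', hz', α, β, γ, δ, ⟨h1, t, ht, htm⟩ | ⟨c, h1⟩⟩ := ih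
    · obtain ⟨z'', hz'', α', β', γ', δ', ⟨h2, h3⟩ | ⟨c, h2⟩⟩ := Chart.pair _ z' hz'
        (α * t.1 + γ * t.2, β * t.1 + δ * t.2) (α * a.1 + γ * a.2, β * a.1 + δ * a.2) (Or.inr le_rfl)
      · refine ⟨z'', hz'', _, _, _, _, Or.inl ⟨h1.comp h2, ?_⟩⟩
        have key : ∀ v ∈ s, (α' * (α * t.1 + γ * t.2) + γ' * (β * t.1 + δ * t.2) ≤
            α' * (α * v.1 + γ * v.2) + γ' * (β * v.1 + δ * v.2) ∧
            β' * (α * t.1 + γ * t.2) + δ' * (β * t.1 + δ * t.2) ≤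
            β' * (α * v.1 + γ * v.2) + δ' * (β * v.1 + δ * v.2)) := by
          intro v hv
          obtain ⟨e1, e2⟩ := htm v hv
          exact ⟨by gcongr, by gcongr⟩
        simp only at h3
        rcases h3 with h3 | h3
        · refine ⟨t, by simp [ht], fun v hv => ?_⟩
          rcases Finset.mem_cons.1 hv with rfl | hv
          · exact ⟨by linarith [h3.1], by linarith [h3.2]⟩
          · exact ⟨by linarith [(key v hv).1], by linarith [(key v hv).2]⟩
        · refine ⟨a, by simp, fun v hv => ?_⟩
          rcases Finset.mem_cons.1 hv with rfl | hv
          · exact ⟨le_rfl, le_rfl⟩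
          · exact ⟨by linarith [(key v hv).1, h3.1], by linarith [(key v hv).2, h3.2]⟩
      · exact ⟨z'', hz'', _, _, _, _, Or.inr ⟨c, h1.comp2 h2⟩⟩
    · exact ⟨z', hz', α, β, γ, δ, Or.inr ⟨c, h1⟩⟩

end PadicSub

end

section

open scoped Topology

namespace PadicSub

variable {p : ℕ} [Fact p.Prime]

lemma Mono.mul {F G : ℚ_[p] × ℚ_[p] → ℚ_[p]} (hF : Mono F) (hG : Mono G) :
    Mono (fun ζ => F ζ * G ζ) := by
  obtain ⟨a, b, u, h1, h2, h3⟩ := hF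
  obtain ⟨a', b', u', h1', h2', h3'⟩ := hG
  refine ⟨a + a', b + b', fun ζ => u ζ * u' ζ, h1.mul h1', mul_ne_zero h2 h2', ?_⟩
  filter_upwards [h3, h3'] with ζ e e'
  rw [e, e']; ring

lemma Mono.unit {u : ℚ_[p] × ℚ_[p] → ℚ_[p]} (h : AnalyticAt ℚ_[p] u 0) (h0 : u 0 ≠ 0) :
    Mono u := ⟨0, 0, u, h, h0, by simp⟩

lemma Mono.pow {F : ℚ_[p] × ℚ_[p] → ℚ_[p]} (hF : Mono F) (n : ℕ) :
    Mono (fun ζ => F ζ ^ n) := by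
  induction n with
  | zero => simpa using Mono.unit (u := fun _ : ℚ_[p] × ℚ_[p] => (1 : ℚ_[p])) analyticAt_const (by simp)
  | succ n ih => simpa [pow_succ] using ih.mul hF

lemma Mono.congr {F G : ℚ_[p] × ℚ_[p] → ℚ_[p]} (hF : Mono F)
    (h : ∀ᶠ ζ in 𝓝 (0 : ℚ_[p] × ℚ_[p]), G ζ = F ζ) : Mono G := by
  obtain ⟨a, b, u, h1, h2, h3⟩ := hF
  refine ⟨a, b, u, h1, h2, ?_⟩
  filter_upwards [h, h3] with ζ e e'
  rw [e, e']

lemma tendsto0 {Φ : ℚ_[p] × ℚ_[p] → ℚ_[p] × ℚ_[p]} (h : AnalyticAt ℚ_[p] Φ 0) (h0 : Φ 0 = 0) :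
    Tendsto Φ (𝓝 0) (𝓝 0) := by
  have := h.continuousAt.tendsto
  rwa [h0] at this

/-- `F` becomes a monomial times a unit in some finer chart. -/
def MonoRef (U : Ultrafilter ℚ_[p]) (f : ℚ_[p] → ℚ_[p])
    (z : ℚ_[p] × ℚ_[p] → ℚ_[p] × ℚ_[p]) (F : ℚ_[p] × ℚ_[p] → ℚ_[p]) : Prop :=
  ∃ z' Φ, Chart U f z' ∧ AnalyticAt ℚ_[p] Φ 0 ∧ Φ 0 = 0 ∧ (∀ᶠ ω in FF U f, z ω = Φ (z' ω)) ∧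
    Mono (fun ζ => (Φ ζ).1) ∧ Mono (fun ζ => F (Φ ζ))

variable {U : Ultrafilter ℚ_[p]} {f : ℚ_[p] → ℚ_[p]}
  {z z' z'' : ℚ_[p] × ℚ_[p] → ℚ_[p] × ℚ_[p]}

lemma MonoRef.pull {Φ : ℚ_[p] × ℚ_[p] → ℚ_[p] × ℚ_[p]} {F H v : ℚ_[p] × ℚ_[p] → ℚ_[p]} (A E : ℕ)
    (hΦ : AnalyticAt ℚ_[p] Φ 0) (h0 : Φ 0 = 0)
    (he : ∀ᶠ ω in FF U f, z ω = Φ (z' ω)) (hv : AnalyticAt ℚ_[p] v 0) (hv0 : v 0 ≠ 0)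
    (hA : ∀ᶠ ζ in 𝓝 (0 : ℚ_[p] × ℚ_[p]), (Φ ζ).1 = ζ.1 ^ A * v ζ)
    (hE : ∀ᶠ ζ in 𝓝 (0 : ℚ_[p] × ℚ_[p]), F (Φ ζ) = ζ.1 ^ E * H ζ)
    (h : MonoRef U f z' H) : MonoRef U f z F := by
  obtain ⟨z'', Φ', h1, h2, h3, h4, h5, h6⟩ := h
  have ht := tendsto0 h2 h3
  refine ⟨z'', fun ζ => Φ (Φ' ζ), h1, AnalyticAt.comp (g := Φ) (by rwa [h3]) h2,
    by simp [h3, h0], ?_, ?_, ?_⟩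
  · filter_upwards [he, h4] with ω e e'
    rw [e, e']
  · refine ((h5.pow A).mul (Mono.unit (u := fun ζ => v (Φ' ζ))
      (AnalyticAt.comp (g := v) (by rwa [h3]) h2) (by simpa [h3] using hv0))).congr ?_
    exact ht.eventually hA
  · refine ((h5.pow E).mul h6).congr ?_
    exact ht.eventually hE

lemma MonoRef.step (m : ℕ) (ih : ∀ m' ≤ m, ∀ (z : ℚ_[p] × ℚ_[p] → ℚ_[p] × ℚ_[p])
      (F : ℚ_[p] × ℚ_[p] → ℚ_[p]), Chart U f z → AnalyticAt ℚ_[p] F 0 →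
      analyticOrderAt (fun y => F (0, y)) 0 = m' → MonoRef U f z F)
    (hz : Chart U f z) (F : ℚ_[p] × ℚ_[p] → ℚ_[p]) (S : Finset ℕ) (hS : S.Nonempty)
    (hcard : S.card ≤ m + 1) (n : ℕ → ℕ) (w : ℕ → ℚ_[p] × ℚ_[p] → ℚ_[p])
    (hw : ∀ k ∈ S, AnalyticAt ℚ_[p] (w k) 0) (hw0 : ∀ k ∈ S, w k 0 ≠ 0)
    (hF : ∀ᶠ ζ in 𝓝 (0 : ℚ_[p] × ℚ_[p]), F ζ = ∑ k ∈ S, ζ.1 ^ n k * ζ.2 ^ k * w k ζ) :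
    MonoRef U f z F := by
  obtain ⟨z', hz', α, β, γ, δ, ⟨h1, t, ht, htm⟩ | ⟨c, h1⟩⟩ := hz.toric
    (S.image fun k => (n k, k)) (hS.image _)
  · obtain ⟨k0, hk0, rfl⟩ := Finset.mem_image.1 ht
    have htm' : ∀ k ∈ S, α * n k0 + γ * k0 ≤ α * n k + γ * k ∧
        β * n k0 + δ * k0 ≤ β * n k + δ * k := fun k hk =>
      htm (n k, k) (Finset.mem_image_of_mem _ hk)
    let Φ : ℚ_[p] × ℚ_[p] → ℚ_[p] × ℚ_[p] :=
      fun ζ => (ζ.1 ^ α * ζ.2 ^ β, ζ.1 ^ γ * ζ.2 ^ δ)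
    have hΦ : AnalyticAt ℚ_[p] Φ 0 := TI.analytic
    have hΦ0 : Φ 0 = 0 := TI.zero h1.1
    refine ⟨z', Φ, hz', hΦ, hΦ0, h1.2, ⟨α, β, fun _ => 1, analyticAt_const, by simp, by simp [Φ]⟩,
      ⟨α * n k0 + γ * k0, β * n k0 + δ * k0, fun ζ => ∑ k ∈ S,
        ζ.1 ^ ((α * n k + γ * k) - (α * n k0 + γ * k0)) *
        ζ.2 ^ ((β * n k + δ * k) - (β * n k0 + δ * k0)) * w k (Φ ζ), ?_, ?_, ?_⟩⟩
    · apply Finset.analyticAt_fun_sum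
      intro k hk
      exact ((analyticAt_fst.pow _).mul (analyticAt_snd.pow _)).mul
        (AnalyticAt.comp (g := w k) (by rw [hΦ0]; exact hw k hk) hΦ)
    · beta_reduce
      rw [Finset.sum_eq_single_of_mem k0 hk0]
      · simpa [hΦ0] using hw0 k0 hk0
      · intro k hk hne
        obtain ⟨e1, e2⟩ := htm' k hk
        by_cases h3 : (α * n k + γ * k) - (α * n k0 + γ * k0) = 0
        · by_cases h4 : (β * n k + δ * k) - (β * n k0 + δ * k0) = 0
          · exfalso
            have f1 : α * n k + γ * k = α * n k0 + γ * k0 := by omega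
            have f2 : β * n k + δ * k = β * n k0 + δ * k0 := by omega
            zify at f1 f2
            have : ((α : ℤ) * δ - β * γ) * (k - k0) = 0 := by
              linear_combination (α : ℤ) * f2 - (β : ℤ) * f1
            rcases mul_eq_zero.1 this with h | h
            · exact h1.1 (by exact_mod_cast sub_eq_zero.1 h)
            · exact hne (by exact_mod_cast sub_eq_zero.1 h)
          · simp [h4]
        · simp [h3]
    · filter_upwards [(tendsto0 hΦ hΦ0).eventually hF] with ζ e
      rw [e, Finset.mul_sum]
      refine Finset.sum_congr rfl fun k hk => ?_
      obtain ⟨e1, e2⟩ := htm' k hk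
      have g1 : ζ.1 ^ (α * n k + γ * k) = ζ.1 ^ ((α * n k + γ * k) - (α * n k0 + γ * k0)) *
        ζ.1 ^ (α * n k0 + γ * k0) := by rw [← pow_add, Nat.sub_add_cancel e1]
      have g2 : ζ.2 ^ (β * n k + δ * k) = ζ.2 ^ ((β * n k + δ * k) - (β * n k0 + δ * k0)) *
        ζ.2 ^ (β * n k0 + δ * k0) := by rw [← pow_add, Nat.sub_add_cancel e2]
      calc (Φ ζ).1 ^ n k * (Φ ζ).2 ^ k * w k (Φ ζ)
          = ζ.1 ^ (α * n k + γ * k) * ζ.2 ^ (β * n k + δ * k) * w k (Φ ζ) := by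
            simp only [Φ]; ring
        _ = _ := by rw [g1, g2]; ring
  · let Φ : ℚ_[p] × ℚ_[p] → ℚ_[p] × ℚ_[p] :=
      fun ζ => (ζ.1 ^ α * (ζ.2 + c) ^ β, ζ.1 ^ γ * (ζ.2 + c) ^ δ)
    have hΦ : AnalyticAt ℚ_[p] Φ 0 := TII.analytic
    obtain ⟨hdet, hα, hγ, hc, he⟩ := h1
    have hΦ0' : ∀ y, Φ (0, y) = 0 := fun y => Prod.ext (by simp [Φ, hα.ne']) (by simp [Φ, hγ.ne'])
    have hΦ0 : Φ 0 = 0 := hΦ0' 0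
    obtain ⟨k0, hk0, hmin⟩ := S.exists_min_image (fun k => α * n k + γ * k) hS
    let E := α * n k0 + γ * k0
    let H : ℚ_[p] × ℚ_[p] → ℚ_[p] := fun ζ => ∑ k ∈ S, ζ.1 ^ ((α * n k + γ * k) - E) *
        (ζ.2 + c) ^ (β * n k + δ * k) * w k (Φ ζ)
    have hH : AnalyticAt ℚ_[p] H 0 := by
      apply Finset.analyticAt_fun_sum
      intro k hk
      exact ((analyticAt_fst.pow _).mul ((analyticAt_snd.add analyticAt_const).pow _)).mul
        (AnalyticAt.comp (g := w k) (by rw [hΦ0]; exact hw k hk) hΦ)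
    let S' := S.filter fun k => α * n k + γ * k = E
    let ψ : ℕ → ℕ := fun k => β * n k + δ * k
    have hinj : Set.InjOn ψ S' := by
      intro k hk l hl hkl
      have f1 : α * n k + γ * k = α * n l + γ * l :=
        (Finset.mem_filter.1 hk).2.trans (Finset.mem_filter.1 hl).2.symm
      have f2 : β * n k + δ * k = β * n l + δ * l := hkl
      zify at f1 f2
      have : ((α : ℤ) * δ - β * γ) * (k - l) = 0 := by
        linear_combination (α : ℤ) * f2 - (β : ℤ) * f1
      rcases mul_eq_zero.1 this with h | h
      · exact absurd (by exact_mod_cast sub_eq_zero.1 h) hdet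
      · exact_mod_cast sub_eq_zero.1 h
    have hk0' : k0 ∈ S' := Finset.mem_filter.2 ⟨hk0, rfl⟩
    obtain ⟨r, hr⟩ : ∃ r, S'.card = r + 1 :=
      ⟨S'.card - 1, by have := Finset.card_pos.2 ⟨k0, hk0'⟩; omega⟩
    have hrm : r ≤ m := by
      have : S'.card ≤ S.card := Finset.card_filter_le _ _
      omega
    let inv := Function.invFunOn ψ S'
    have hinv : ∀ k ∈ S', inv (ψ k) = k := fun k hk => hinj.leftInvOn_invFunOn hk
    obtain ⟨m', hm', hord⟩ := sum_pow_order hc r (S'.image ψ) (fun j => w (inv j) 0)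
      (by rw [Finset.card_image_of_injOn hinj, hr]) (by
        intro j hj
        obtain ⟨k, hk, rfl⟩ := Finset.mem_image.1 hj
        rw [hinv k hk]
        exact hw0 k (Finset.mem_filter.1 hk).1)
    have hHy : (fun y => H (0, y)) = fun y => ∑ j ∈ S'.image ψ, w (inv j) 0 * (y + c) ^ j := by
      funext y
      rw [Finset.sum_image hinj]
      simp only [H, S', Finset.sum_filter]
      refine Finset.sum_congr rfl fun k hk => ?_
      have hle : E ≤ α * n k + γ * k := hmin k hk
      rw [hΦ0']
      split_ifs with h
      · rw [hinv k (Finset.mem_filter.2 ⟨hk, h⟩), h]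
        simp [ψ, mul_comm]
      · rw [zero_pow (by omega)]; simp
    have hmr := ih m' (hm'.trans hrm) z' H hz' hH (by rw [hHy]; exact hord)
    refine MonoRef.pull (Φ := Φ) (v := fun ζ => (ζ.2 + c) ^ β) α E hΦ hΦ0 he
      ((analyticAt_snd.add analyticAt_const).pow _) (by simp [hc]) (by simp [Φ]) ?_ hmr
    filter_upwards [(tendsto0 hΦ hΦ0).eventually hF] with ζ e
    rw [e, Finset.mul_sum]
    refine Finset.sum_congr rfl fun k hk => ?_
    have hle : E ≤ α * n k + γ * k := hmin k hk
    have g1 : ζ.1 ^ (α * n k + γ * k) = ζ.1 ^ ((α * n k + γ * k) - E) * ζ.1 ^ E := by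
      rw [← pow_add, Nat.sub_add_cancel hle]
    calc (Φ ζ).1 ^ n k * (Φ ζ).2 ^ k * w k (Φ ζ)
        = ζ.1 ^ (α * n k + γ * k) * (ζ.2 + c) ^ (β * n k + δ * k) * w k (Φ ζ) := by
          simp only [Φ]; ring
      _ = _ := by rw [g1]; ring

lemma Chart.monoRef (m : ℕ) : ∀ (z : ℚ_[p] × ℚ_[p] → ℚ_[p] × ℚ_[p])
      (F : ℚ_[p] × ℚ_[p] → ℚ_[p]), Chart U f z → AnalyticAt ℚ_[p] F 0 →
      analyticOrderAt (fun y => F (0, y)) 0 = m → MonoRef U f z F := by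
  induction m using Nat.strong_induction_on with
  | _ m ih =>
    intro z F hz hF hord
    rcases m with _ | m
    · have h0 : F (0, 0) ≠ 0 := by
        have := (analyticAt_inr hF).analyticOrderAt_eq_zero.1 (by simpa using hord)
        exact this
      exact ⟨z, id, hz, analyticAt_id, rfl, by simp,
        ⟨1, 0, fun _ => 1, analyticAt_const, by simp, by simp⟩, Mono.unit hF h0⟩
    · classical
      obtain ⟨g, hg, hg0, b, B, hb, hB, hB0, he⟩ := tsch hF m hord
      let Φ : ℚ_[p] × ℚ_[p] → ℚ_[p] × ℚ_[p] := fun ζ => (ζ.1, ζ.2 + g ζ.1)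
      have hΦ : AnalyticAt ℚ_[p] Φ 0 := analyticAt_fst.prod (analyticAt_snd.add
        (AnalyticAt.comp (g := g) (f := Prod.fst) hg analyticAt_fst))
      let S := (Finset.range m).filter fun k => ¬ ∀ᶠ x in 𝓝 0, b k x = 0
      have hbk : ∀ k, ∃ (n : ℕ) (u : ℚ_[p] → ℚ_[p]), k ∈ S → AnalyticAt ℚ_[p] u 0 ∧ u 0 ≠ 0 ∧
          ∀ᶠ x in 𝓝 0, b k x = x ^ n * u x := by
        intro k
        by_cases hk : k ∈ S
        · obtain ⟨n, u, h⟩ := onevar (hb k) (Finset.mem_filter.1 hk).2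
          exact ⟨n, u, fun _ => h⟩
        · exact ⟨0, 0, fun h => absurd h hk⟩
      choose n u hu using hbk
      have hmS : m + 1 ∉ S := by
        intro h
        have := Finset.mem_range.1 (Finset.mem_filter.1 h).1
        omega
      have hSne : ∀ k ∈ S, k ≠ m + 1 := fun k hk h => hmS (h ▸ hk)
      have hmr : MonoRef U f (fun ω => ((z ω).1, (z ω).2 - g (z ω).1)) (fun ζ => F (Φ ζ)) := by
        refine MonoRef.step m (fun m' hm' => ih m' (by omega)) (hz.shift hg hg0) _
          (insert (m + 1) S) (by simp) ?_ (fun k => if k = m + 1 then 0 else n k)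
          (fun k => if k = m + 1 then B else fun ζ => u k ζ.1) ?_ ?_ ?_
        · rw [Finset.card_insert_of_notMem hmS]
          have : S.card ≤ (Finset.range m).card := Finset.card_filter_le _ _
          simp at this
          omega
        · intro k hk
          rcases Finset.mem_insert.1 hk with rfl | hk
          · simpa using hB
          · simp only [hSne k hk, if_false]
            exact AnalyticAt.comp (g := u k) (f := Prod.fst) (hu k hk).1 analyticAt_fst
        · intro k hk
          rcases Finset.mem_insert.1 hk with rfl | hk
          · simpa using hB0
          · simp only [hSne k hk, if_false]
            exact (hu k hk).2.1
        · have hSe : ∀ᶠ x in 𝓝 (0 : ℚ_[p]), ∀ k ∈ Finset.range m,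
              b k x = if k ∈ S then x ^ n k * u k x else 0 := by
            rw [Finset.eventually_all]
            intro k hk
            by_cases hkS : k ∈ S
            · simpa [hkS] using (hu k hkS).2.2
            · have : ∀ᶠ x in 𝓝 0, b k x = 0 := by
                by_contra h
                exact hkS (Finset.mem_filter.2 ⟨hk, h⟩)
              simpa [hkS] using this
          filter_upwards [he, (continuous_fst.tendsto (0 : ℚ_[p] × ℚ_[p])).eventually hSe]
            with ζ e1 e2
          rw [Finset.sum_insert hmS]
          simp only [Φ, if_true]
          rw [e1, add_comm]
          congr 1
          · simp
          · have hsub : S ⊆ Finset.range m := Finset.filter_subset _ _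
            rw [← Finset.sum_subset hsub]
            · refine Finset.sum_congr rfl fun k hk => ?_
              rw [e2 k (hsub hk)]
              simp only [hSne k hk, hk, if_true, if_false]
              ring
            · intro k hk hkS
              rw [e2 k hk]; simp [hkS]
      refine MonoRef.pull (Φ := Φ) (v := fun ζ => 1) 1 0 hΦ (by simp [Φ, hg0]) (by simp [Φ])
        analyticAt_const (by simp) (by simp [Φ]) (by simp) hmr

lemma Chart.monomialize (hz : Chart U f z) {F : ℚ_[p] × ℚ_[p] → ℚ_[p]}
    (hF : AnalyticAt ℚ_[p] F 0) :
    (∀ᶠ ζ in 𝓝 (0 : ℚ_[p] × ℚ_[p]), F ζ = 0) ∨ MonoRef U f z F := by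
  rcases exists_normal hF with h | ⟨k, F', hF', he, hne⟩
  · exact Or.inl h
  · right
    have hord : analyticOrderAt (fun y => F' (0, y)) 0 ≠ ⊤ := by
      rw [Ne, analyticOrderAt_eq_top]; exact hne
    obtain ⟨m, hm⟩ := ENat.ne_top_iff_exists.1 hord
    obtain ⟨z', Φ, h1, h2, h3, h4, h5, h6⟩ := Chart.monoRef m z F' hz hF' hm.symm
    refine ⟨z', Φ, h1, h2, h3, h4, h5, ((h5.pow k).mul h6).congr ?_⟩
    exact (tendsto0 h2 h3).eventually he

end PadicSub

end

section

open scoped Topology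

namespace PadicSub

variable {p : ℕ} [Fact p.Prime]

/-- `φ` is analytic in the chart `z`, or the inverse of such. -/
def MM (U : Ultrafilter ℚ_[p]) (f : ℚ_[p] → ℚ_[p])
    (z : ℚ_[p] × ℚ_[p] → ℚ_[p] × ℚ_[p]) (φ : ℚ_[p] × ℚ_[p] → ℚ_[p]) : Prop :=
  ∃ F : ℚ_[p] × ℚ_[p] → ℚ_[p], AnalyticAt ℚ_[p] F 0 ∧
    ((∀ᶠ ω in FF U f, φ ω = F (z ω)) ∨ (∀ᶠ ω in FF U f, φ ω = (F (z ω))⁻¹))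

variable {U : Ultrafilter ℚ_[p]} {f : ℚ_[p] → ℚ_[p]}
  {z z' z'' : ℚ_[p] × ℚ_[p] → ℚ_[p] × ℚ_[p]}

lemma Mono.ne {F : ℚ_[p] × ℚ_[p] → ℚ_[p]} (hz : Chart U f z) (hF : Mono F) :
    ∀ᶠ ω in FF U f, F (z ω) ≠ 0 := by
  obtain ⟨a, b, u, h1, h2, h3⟩ := hF
  filter_upwards [hz.ne1, hz.ne2, hz.tendsto.eventually h3,
    hz.tendsto.eventually (h1.continuousAt.eventually_ne h2)] with ω e1 e2 e3 e4
  rw [e3]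
  exact mul_ne_zero (mul_ne_zero (pow_ne_zero _ e1) (pow_ne_zero _ e2)) e4

lemma MonoRef.ne {F : ℚ_[p] × ℚ_[p] → ℚ_[p]} (hF : MonoRef U f z F) :
    ∀ᶠ ω in FF U f, F (z ω) ≠ 0 := by
  obtain ⟨z', Φ, h1, h2, h3, h4, h5, h6⟩ := hF
  filter_upwards [h4, h6.ne h1] with ω e1 e2
  rwa [e1]

lemma Chart.dich (hz : Chart U f z) {F : ℚ_[p] × ℚ_[p] → ℚ_[p]}
    (hF : AnalyticAt ℚ_[p] F 0) :
    (∀ᶠ ω in FF U f, F (z ω) = 0) ∨ (∀ᶠ ω in FF U f, F (z ω) ≠ 0) := by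
  rcases hz.monomialize hF with h | h
  · exact Or.inl (hz.tendsto.eventually h)
  · exact Or.inr h.ne

lemma MM.ref {φ : ℚ_[p] × ℚ_[p] → ℚ_[p]} (h : MM U f z φ) (hr : Ref U f z z') : MM U f z' φ := by
  obtain ⟨F, hF, h⟩ := h
  obtain ⟨Φ, h1, h2, h3⟩ := hr
  refine ⟨fun ζ => F (Φ ζ), AnalyticAt.comp (g := F) (by rwa [h2]) h1, ?_⟩
  rcases h with h | h
  · left
    filter_upwards [h, h3] with ω e1 e2
    rw [e1, e2]
  · right
    filter_upwards [h, h3] with ω e1 e2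
    rw [e1, e2]

lemma MM.const (c : ℚ_[p]) : MM U f z (fun _ => c) := ⟨fun _ => c, analyticAt_const, by simp⟩

lemma MM.congr {φ ψ : ℚ_[p] × ℚ_[p] → ℚ_[p]} (h : MM U f z φ) (e : ∀ᶠ ω in FF U f, ψ ω = φ ω) :
    MM U f z ψ := by
  obtain ⟨F, hF, h⟩ := h
  refine ⟨F, hF, ?_⟩
  rcases h with h | h
  · left
    filter_upwards [h, e] with ω e1 e2
    rw [e2, e1]
  · right
    filter_upwards [h, e] with ω e1 e2
    rw [e2, e1]

lemma MM.inv {φ : ℚ_[p] × ℚ_[p] → ℚ_[p]} (h : MM U f z φ) : MM U f z (fun ω => (φ ω)⁻¹) := by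
  obtain ⟨F, hF, h⟩ := h
  refine ⟨F, hF, ?_⟩
  rcases h with h | h
  · right
    filter_upwards [h] with ω e1
    rw [e1]
  · left
    filter_upwards [h] with ω e1
    rw [e1, inv_inv]

lemma unit_div {u v : ℚ_[p] × ℚ_[p] → ℚ_[p]} (hu : AnalyticAt ℚ_[p] u 0)
    (hv : AnalyticAt ℚ_[p] v 0) (hv0 : v 0 ≠ 0) : AnalyticAt ℚ_[p] (fun ζ => u ζ / v ζ) 0 :=
  hu.div hv hv0

/-- Monomials with comparable exponents have quotient in `MM`. -/
lemma Chart.quot_le (hz : Chart U f z) {u v : ℚ_[p] × ℚ_[p] → ℚ_[p]} {a b a' b' : ℕ}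
    (hu : AnalyticAt ℚ_[p] u 0) (hv : AnalyticAt ℚ_[p] v 0) (hv0 : v 0 ≠ 0)
    (h1 : a' ≤ a) (h2 : b' ≤ b) :
    MM U f z (fun ω => ((z ω).1 ^ a * (z ω).2 ^ b * u (z ω)) /
      ((z ω).1 ^ a' * (z ω).2 ^ b' * v (z ω))) := by
  refine ⟨fun ζ => ζ.1 ^ (a - a') * ζ.2 ^ (b - b') * (u ζ / v ζ),
    ((analyticAt_fst.pow _).mul (analyticAt_snd.pow _)).mul (hu.div hv hv0), Or.inl ?_⟩
  filter_upwards [hz.ne1, hz.ne2, hz.tendsto.eventually (hv.continuousAt.eventually_ne hv0)]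
    with ω e1 e2 e3
  have g1 : (z ω).1 ^ a = (z ω).1 ^ (a - a') * (z ω).1 ^ a' := by
    rw [← pow_add, Nat.sub_add_cancel h1]
  have g2 : (z ω).2 ^ b = (z ω).2 ^ (b - b') * (z ω).2 ^ b' := by
    rw [← pow_add, Nat.sub_add_cancel h2]
  rw [g1, g2]
  field_simp

lemma Chart.quot_mono (hz : Chart U f z) {F G : ℚ_[p] × ℚ_[p] → ℚ_[p]} (hF : Mono F)
    (hG : Mono G) : ∃ z', Chart U f z' ∧ Ref U f z z' ∧ MM U f z' (fun ω => F (z ω) / G (z ω)) := by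
  obtain ⟨a, b, u, hu, hu0, hF⟩ := hF
  obtain ⟨a', b', v, hv, hv0, hG⟩ := hG
  obtain ⟨z', hz', α, β, γ, δ, ⟨h1, h2⟩ | ⟨c, h1⟩⟩ := Chart.pair _ z hz (a, b) (a', b')
    (Or.inr le_rfl)
  · refine ⟨z', hz', h1.ref, ?_⟩
    let Φ : ℚ_[p] × ℚ_[p] → ℚ_[p] × ℚ_[p] := fun ζ => (ζ.1 ^ α * ζ.2 ^ β, ζ.1 ^ γ * ζ.2 ^ δ)
    have hΦ : AnalyticAt ℚ_[p] Φ 0 := TI.analytic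
    have hΦ0 : Φ 0 = 0 := TI.zero h1.1
    have hu' : AnalyticAt ℚ_[p] (fun ζ => u (Φ ζ)) 0 := AnalyticAt.comp (g := u) (by rwa [hΦ0]) hΦ
    have hv' : AnalyticAt ℚ_[p] (fun ζ => v (Φ ζ)) 0 := AnalyticAt.comp (g := v) (by rwa [hΦ0]) hΦ
    have hu0' : u (Φ 0) ≠ 0 := by rwa [hΦ0]
    have hv0' : v (Φ 0) ≠ 0 := by rwa [hΦ0]
    have key : ∀ᶠ ω in FF U f, F (z ω) / G (z ω) =
        ((z' ω).1 ^ (α * a + γ * b) * (z' ω).2 ^ (β * a + δ * b) * u (Φ (z' ω))) /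
        ((z' ω).1 ^ (α * a' + γ * b') * (z' ω).2 ^ (β * a' + δ * b') * v (Φ (z' ω))) := by
      filter_upwards [hz.tendsto.eventually hF, hz.tendsto.eventually hG, h1.2] with ω e1 e2 e3
      rw [e1, e2, e3]
      simp only [Φ]
      congr 1 <;> ring
    rcases h2 with h2 | h2
    · refine ((hz'.quot_le hv' hu' hu0' h2.1 h2.2).inv).congr ?_
      filter_upwards [key] with ω e
      rw [e, inv_div]
    · exact (hz'.quot_le hu' hv' hv0' h2.1 h2.2).congr key
  · refine ⟨z', hz', h1.ref, ?_⟩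
    obtain ⟨hdet, hα, hγ, hc, he⟩ := h1
    let Φ : ℚ_[p] × ℚ_[p] → ℚ_[p] × ℚ_[p] :=
      fun ζ => (ζ.1 ^ α * (ζ.2 + c) ^ β, ζ.1 ^ γ * (ζ.2 + c) ^ δ)
    have hΦ : AnalyticAt ℚ_[p] Φ 0 := TII.analytic
    have hΦ0 : Φ 0 = 0 := Prod.ext (by simp [Φ, hα.ne']) (by simp [Φ, hγ.ne'])
    have hu' : AnalyticAt ℚ_[p] (fun ζ => (ζ.2 + c) ^ (β * a + δ * b) * u (Φ ζ)) 0 :=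
      ((analyticAt_snd.add analyticAt_const).pow _).mul
        (AnalyticAt.comp (g := u) (by rwa [hΦ0]) hΦ)
    have hv' : AnalyticAt ℚ_[p] (fun ζ => (ζ.2 + c) ^ (β * a' + δ * b') * v (Φ ζ)) 0 :=
      ((analyticAt_snd.add analyticAt_const).pow _).mul
        (AnalyticAt.comp (g := v) (by rwa [hΦ0]) hΦ)
    have hu0' : ((0 : ℚ_[p] × ℚ_[p]).2 + c) ^ (β * a + δ * b) * u (Φ 0) ≠ 0 := by
      rw [hΦ0]; simp [hc, hu0]
    have hv0' : ((0 : ℚ_[p] × ℚ_[p]).2 + c) ^ (β * a' + δ * b') * v (Φ 0) ≠ 0 := by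
      rw [hΦ0]; simp [hc, hv0]
    have key : ∀ᶠ ω in FF U f, F (z ω) / G (z ω) =
        ((z' ω).1 ^ (α * a + γ * b) * (z' ω).2 ^ 0 *
          (((z' ω).2 + c) ^ (β * a + δ * b) * u (Φ (z' ω)))) /
        ((z' ω).1 ^ (α * a' + γ * b') * (z' ω).2 ^ 0 *
          (((z' ω).2 + c) ^ (β * a' + δ * b') * v (Φ (z' ω)))) := by
      filter_upwards [hz.tendsto.eventually hF, hz.tendsto.eventually hG, he] with ω e1 e2 e3
      rw [e1, e2, e3]
      simp only [Φ]
      congr 1 <;> ring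
    rcases le_total (α * a + γ * b) (α * a' + γ * b') with h2 | h2
    · refine ((hz'.quot_le hv' hu' hu0' h2 (le_refl 0)).inv).congr ?_
      filter_upwards [key] with ω e
      rw [e, inv_div]
    · exact (hz'.quot_le hu' hv' hv0' h2 (le_refl 0)).congr key

lemma Chart.quot (hz : Chart U f z) {F G : ℚ_[p] × ℚ_[p] → ℚ_[p]} (hF : AnalyticAt ℚ_[p] F 0)
    (hG : AnalyticAt ℚ_[p] G 0) :
    ∃ z', Chart U f z' ∧ Ref U f z z' ∧ MM U f z' (fun ω => F (z ω) / G (z ω)) := by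
  rcases hz.dich hF with h1 | h1
  · refine ⟨z, hz, Ref.refl, (MM.const 0).congr ?_⟩
    filter_upwards [h1] with ω e; simp [e]
  rcases hz.dich hG with h2 | h2
  · refine ⟨z, hz, Ref.refl, (MM.const 0).congr ?_⟩
    filter_upwards [h2] with ω e; simp [e]
  by_cases hne : (FF U f).NeBot
  swap
  · rw [not_neBot] at hne
    refine ⟨z, hz, Ref.refl, (MM.const 0).congr ?_⟩
    rw [hne]; exact eventually_bot
  rcases hz.monomialize (hF.mul hG) with h3 | h3
  · exfalso
    obtain ⟨ω, e1, e2, e3⟩ := (h1.and (h2.and (hz.tendsto.eventually h3))).exists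
    exact mul_ne_zero e1 e2 e3
  · obtain ⟨z', Φ, k1, k2, k3, k4, k5, ⟨a, b, u, hu, hu0, he⟩⟩ := h3
    have hF' : AnalyticAt ℚ_[p] (fun ζ => F (Φ ζ)) 0 := AnalyticAt.comp (g := F) (by rwa [k3]) k2
    have hG' : AnalyticAt ℚ_[p] (fun ζ => G (Φ ζ)) 0 := AnalyticAt.comp (g := G) (by rwa [k3]) k2
    have mF : Mono (fun ζ => F (Φ ζ)) := mono_of_mul a b hF' hG' hu hu0 (by
      filter_upwards [he] with ζ e; exact e)
    have mG : Mono (fun ζ => G (Φ ζ)) := mono_of_mul a b hG' hF' hu hu0 (by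
      filter_upwards [he] with ζ e
      rw [mul_comm]; exact e)
    obtain ⟨z'', c1, c2, c3⟩ := k1.quot_mono mF mG
    refine ⟨z'', c1, Ref.trans ⟨Φ, k2, k3, k4⟩ c2, c3.congr ?_⟩
    filter_upwards [k4] with ω e
    rw [e]

lemma MM.frac (hz : Chart U f z) {φ : ℚ_[p] × ℚ_[p] → ℚ_[p]} (h : MM U f z φ) :
    ∃ F D : ℚ_[p] × ℚ_[p] → ℚ_[p], AnalyticAt ℚ_[p] F 0 ∧ AnalyticAt ℚ_[p] D 0 ∧
      ∀ᶠ ω in FF U f, D (z ω) ≠ 0 ∧ φ ω = F (z ω) / D (z ω) := by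
  obtain ⟨F, hF, h | h⟩ := h
  · refine ⟨F, fun _ => 1, hF, analyticAt_const, ?_⟩
    filter_upwards [h] with ω e
    simp [e]
  · rcases hz.dich hF with h1 | h1
    · refine ⟨fun _ => 0, fun _ => 1, analyticAt_const, analyticAt_const, ?_⟩
      filter_upwards [h, h1] with ω e e'
      simp [e, e']
    · refine ⟨fun _ => 1, F, analyticAt_const, hF, ?_⟩
      filter_upwards [h, h1] with ω e e'
      simp [e, e']

/-- `φ` is in `MM` after refining the chart. -/
def RM (U : Ultrafilter ℚ_[p]) (f : ℚ_[p] → ℚ_[p])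
    (z : ℚ_[p] × ℚ_[p] → ℚ_[p] × ℚ_[p]) (φ : ℚ_[p] × ℚ_[p] → ℚ_[p]) : Prop :=
  ∀ z', Chart U f z' → Ref U f z z' → ∃ z'', Chart U f z'' ∧ Ref U f z' z'' ∧ MM U f z'' φ

lemma RM.of_MM {φ : ℚ_[p] × ℚ_[p] → ℚ_[p]} (h : MM U f z φ) : RM U f z φ :=
  fun z' hz' hr => ⟨z', hz', Ref.refl, h.ref hr⟩

lemma RM.add {φ ψ : ℚ_[p] × ℚ_[p] → ℚ_[p]} (h : RM U f z φ) (h' : RM U f z ψ) :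
    RM U f z (fun ω => φ ω + ψ ω) := by
  intro z1 hz1 hr1
  obtain ⟨z2, hz2, hr2, m1⟩ := h z1 hz1 hr1
  obtain ⟨z3, hz3, hr3, m2⟩ := h' z2 hz2 (hr1.trans hr2)
  obtain ⟨F, D, hF, hD, e⟩ := (m1.ref hr3).frac hz3
  obtain ⟨G, E, hG, hE, e'⟩ := m2.frac hz3
  obtain ⟨z4, hz4, hr4, m4⟩ := hz3.quot ((hF.mul hE).add (hD.mul hG)) (hD.mul hE)
  refine ⟨z4, hz4, (hr2.trans hr3).trans hr4, m4.congr ?_⟩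
  filter_upwards [e, e'] with ω e e'
  rw [e.2, e'.2]
  exact div_add_div _ _ e.1 e'.1

lemma RM.mul {φ ψ : ℚ_[p] × ℚ_[p] → ℚ_[p]} (h : RM U f z φ) (h' : RM U f z ψ) :
    RM U f z (fun ω => φ ω * ψ ω) := by
  intro z1 hz1 hr1
  obtain ⟨z2, hz2, hr2, m1⟩ := h z1 hz1 hr1
  obtain ⟨z3, hz3, hr3, m2⟩ := h' z2 hz2 (hr1.trans hr2)
  obtain ⟨F, D, hF, hD, e⟩ := (m1.ref hr3).frac hz3
  obtain ⟨G, E, hG, hE, e'⟩ := m2.frac hz3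
  obtain ⟨z4, hz4, hr4, m4⟩ := hz3.quot (hF.mul hG) (hD.mul hE)
  refine ⟨z4, hz4, (hr2.trans hr3).trans hr4, m4.congr ?_⟩
  filter_upwards [e, e'] with ω e e'
  rw [e.2, e'.2]
  exact div_mul_div_comm _ _ _ _

lemma RM.inv {φ : ℚ_[p] × ℚ_[p] → ℚ_[p]} (h : RM U f z φ) : RM U f z (fun ω => (φ ω)⁻¹) := by
  intro z1 hz1 hr1
  obtain ⟨z2, hz2, hr2, m1⟩ := h z1 hz1 hr1
  exact ⟨z2, hz2, hr2, m1.inv⟩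

lemma RM.family {n : ℕ} {φ : Fin n → ℚ_[p] × ℚ_[p] → ℚ_[p]} (h : ∀ i, RM U f z (φ i))
    (hz1 : Chart U f z') (hr1 : Ref U f z z') :
    ∃ z'', Chart U f z'' ∧ Ref U f z' z'' ∧ ∀ i, MM U f z'' (φ i) := by
  have : ∀ S : Finset (Fin n), ∃ z'', Chart U f z'' ∧ Ref U f z' z'' ∧ ∀ i ∈ S, MM U f z'' (φ i) := by
    intro S
    induction S using Finset.induction_on with
    | empty => exact ⟨z', hz1, Ref.refl, by simp⟩
    | insert a S _ ih =>
      obtain ⟨z2, hz2, hr2, m2⟩ := ih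
      obtain ⟨z3, hz3, hr3, m3⟩ := h a z2 hz2 (hr1.trans hr2)
      refine ⟨z3, hz3, hr2.trans hr3, fun i hi => ?_⟩
      rcases Finset.mem_insert.1 hi with rfl | hi
      · exact m3
      · exact (m2 i hi).ref hr3
  obtain ⟨z'', h1, h2, h3⟩ := this Finset.univ
  exact ⟨z'', h1, h2, fun i => h3 i (Finset.mem_univ i)⟩

lemma MM.split (hz : Chart U f z) {φ : ℚ_[p] × ℚ_[p] → ℚ_[p]} (h : MM U f z φ) :
    (∃ F, AnalyticAt ℚ_[p] F 0 ∧ ∀ᶠ ω in FF U f, φ ω = F (z ω)) ∨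
      (∀ᶠ ω in FF U f, 1 < ‖φ ω‖) := by
  obtain ⟨F, hF, h | h⟩ := h
  · exact Or.inl ⟨F, hF, h⟩
  · by_cases h0 : F 0 = 0
    · rcases hz.dich hF with h1 | h1
      · left
        refine ⟨fun _ => 0, analyticAt_const, ?_⟩
        filter_upwards [h, h1] with ω e e'
        rw [e, e', inv_zero]
      · right
        have : ∀ᶠ ζ in 𝓝 (0 : ℚ_[p] × ℚ_[p]), ‖F ζ‖ < 1 := by
          have := hF.continuousAt.norm
          rw [ContinuousAt, h0, norm_zero] at this
          exact this.eventually_lt_const one_pos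
        filter_upwards [h, h1, hz.tendsto.eventually this] with ω e e' e''
        rw [e, norm_inv]
        exact (one_lt_inv₀ (norm_pos_iff.2 e')).2 e''
    · left
      exact ⟨fun ζ => (F ζ)⁻¹, hF.inv h0, h⟩

lemma RM.dfun {n : ℕ} {h : (Fin n → ℚ_[p]) → ℚ_[p]} (hh : IsDFunction p h) :
    ∀ {φ : Fin n → ℚ_[p] × ℚ_[p] → ℚ_[p]} (_ : ∀ i, RM U f z (φ i)),
      RM U f z (fun ω => h (fun i => φ i ω)) := by
  induction hh with
  | ranal a ha =>
    intro φ hφ z1 hz1 hr1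
    obtain ⟨z2, hz2, hr2, m2⟩ := RM.family hφ hz1 hr1
    refine ⟨z2, hz2, hr2, ?_⟩
    by_cases hb : ∃ i, ∀ᶠ ω in FF U f, 1 < ‖φ i ω‖
    · obtain ⟨i, hi⟩ := hb
      refine (MM.const 0).congr ?_
      filter_upwards [hi] with ω e
      rw [ranalFn, if_neg]
      intro hall
      exact absurd (hall i) (not_le.2 e)
    · push Not at hb
      have : ∀ i, ∃ F, AnalyticAt ℚ_[p] F 0 ∧ ∀ᶠ ω in FF U f, φ i ω = F (z2 ω) := by
        intro i
        rcases (m2 i).split hz2 with h | h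
        · exact h
        · exact absurd h (by simpa [Filter.not_eventually] using hb i)
      choose G hG he using this
      refine ⟨fun ζ => ranalFn p a (fun i => G i ζ), ?_, Or.inl ?_⟩
      · exact AnalyticAt.comp (g := ranalFn p a) (analyticAt_ranalFn a ha _)
          (analyticAt_pi_iff.2 hG)
      · filter_upwards [eventually_all.2 he] with ω e
        simp only [e]
  | poly q =>
    intro φ hφ
    induction q using MvPolynomial.induction_on with
    | C c => simpa using RM.of_MM (MM.const c)
    | add q1 q2 h1 h2 => simpa using h1.add h2
    | mul_X q i h1 => simpa using h1.mul (hφ i)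
  | inv =>
    intro φ hφ
    exact (hφ 0).inv
  | comp F g _ _ ih1 ih2 =>
    intro φ hφ
    exact ih1 (φ := fun j ω => g j (fun i => φ i ω)) (fun j => ih2 j hφ)

end PadicSub

end

section

open scoped Topology

namespace PadicSub

variable {p : ℕ} [Fact p.Prime]

lemma isOpen_Pset {n : ℕ} (hn : 0 < n) : IsOpen (Pset p n) := by
  rw [isOpen_iff_mem_nhds]
  rintro x ⟨y, hy, rfl⟩
  have hd : HasStrictDerivAt (fun t : ℚ_[p] => t ^ n) ((n : ℚ_[p]) * y ^ (n - 1)) y :=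
    hasStrictDerivAt_pow n y
  have hne : (n : ℚ_[p]) * y ^ (n - 1) ≠ 0 :=
    mul_ne_zero (Nat.cast_ne_zero.2 hn.ne') (pow_ne_zero _ hy)
  have := hd.map_nhds_eq hne
  rw [← this]
  refine mem_map.2 ?_
  filter_upwards [isOpen_ne.mem_nhds hy] with t ht
  exact ⟨t, ht, rfl⟩

lemma Pset_ne {n : ℕ} {x : ℚ_[p]} (h : x ∈ Pset p n) : x ≠ 0 := by
  obtain ⟨y, hy, rfl⟩ := h
  exact pow_ne_zero _ hy

/-- The point of `ℚ_p^2` associated to a pair. -/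
def pt (ω : ℚ_[p] × ℚ_[p]) : Fin 2 → ℚ_[p] := ![ω.1, ω.2]

variable {U : Ultrafilter ℚ_[p]} {f : ℚ_[p] → ℚ_[p]}
  {z z' z'' : ℚ_[p] × ℚ_[p] → ℚ_[p] × ℚ_[p]}

lemma dfun_dich (hz : Chart U f z) (h1 : RM U f z (fun ω => ω.1)) (h2 : RM U f z (fun ω => ω.2))
    {h : (Fin 2 → ℚ_[p]) → ℚ_[p]} (hh : IsDFunction p h) :
    (∀ᶠ ω in FF U f, h (pt ω) = 0) ∨
      ∀ᶠ x in (U : Filter ℚ_[p]), h (pt (x, f x)) ≠ 0 ∧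
        ContinuousAt (fun y => h (pt (x, y))) (f x) := by
  have hR : RM U f z (fun ω => h (pt ω)) := by
    refine RM.dfun hh (φ := fun i ω => pt ω i) (fun i => ?_)
    fin_cases i
    · exact h1
    · exact h2
  obtain ⟨z', hz', -, F, hF, hφ⟩ := hR z hz Ref.refl
  rcases hz'.dich hF with h0 | h0
  · left
    rcases hφ with hφ | hφ
    · filter_upwards [hφ, h0] with ω e e'
      rw [e, e']
    · filter_upwards [hφ, h0] with ω e e'
      rw [e, e', inv_zero]
  · right
    have hFc : ∀ᶠ x in (U : Filter ℚ_[p]), ContinuousAt (fun y => F (z' (x, y))) (f x) := by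
      filter_upwards [hz'.cont, hz'.lim.eventually hF.eventually_analyticAt] with x hx hx'
      exact ContinuousAt.comp (g := F) hx'.continuousAt hx
    rcases hφ with hφ | hφ
    · filter_upwards [ev_graph hφ, ev_graph h0, ev_FF.1 hφ, hFc] with x e e' e'' hc
      exact ⟨by rw [e]; exact e', hc.congr (by filter_upwards [e''] with y hy; exact hy.symm)⟩
    · filter_upwards [ev_graph hφ, ev_graph h0, ev_FF.1 hφ, hFc] with x e e' e'' hc
      exact ⟨by rw [e]; exact inv_ne_zero e',
        (hc.inv₀ e').congr (by filter_upwards [e''] with y hy; exact hy.symm)⟩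

lemma no_chart (hf : IsSubanalyticFnOn1 p {x | ‖x‖ ≤ 1} f)
    (hU : ∀ᶠ x in (U : Filter ℚ_[p]), ‖x‖ ≤ 1)
    (hz : Chart U f z) (h1 : RM U f z (fun ω => ω.1)) (h2 : RM U f z (fun ω => ω.2)) : False := by
  obtain ⟨r, s, F, hF, hX⟩ := hf
  have hmem : ∀ x y, pt (x, y) ∈ (⋃ i, ⋂ j, F i j) ↔ (‖x‖ ≤ 1 ∧ f x = y) := by
    intro x y
    rw [← hX]; simp [pt]
  have hex : ∃ i, ∀ᶠ x in (U : Filter ℚ_[p]), pt (x, f x) ∈ ⋂ j, F i j := by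
    have : ∀ᶠ x in (U : Filter ℚ_[p]), ∃ i, pt (x, f x) ∈ ⋂ j, F i j := by
      filter_upwards [hU] with x hx
      exact Set.mem_iUnion.1 ((hmem x (f x)).2 ⟨hx, rfl⟩)
    by_contra hcon
    push Not at hcon
    have h3 : ∀ i, ∀ᶠ x in (U : Filter ℚ_[p]), pt (x, f x) ∉ ⋂ j, F i j := by
      intro i
      exact hcon i
    obtain ⟨x, hx1, i, hx2⟩ := ((eventually_all.2 h3).and this).exists
    exact hx1 i hx2
  obtain ⟨i, hi⟩ := hex
  have hj : ∀ j, ∀ᶠ x in (U : Filter ℚ_[p]), ∀ᶠ y in 𝓝 (f x), pt (x, y) ∈ F i j := by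
    intro j
    have hij : ∀ᶠ x in (U : Filter ℚ_[p]), pt (x, f x) ∈ F i j := by
      filter_upwards [hi] with x hx using Set.mem_iInter.1 hx j
    rcases hF i j with ⟨h, hh, he⟩ | ⟨h, n, hh, hn, he⟩
    · rw [he] at hij ⊢
      rcases dfun_dich hz h1 h2 hh with hd | hd
      · exact ev_FF.1 hd
      · obtain ⟨x, e1, e2⟩ := (hij.and hd).exists
        exact absurd e1 e2.1
    · rw [he] at hij ⊢
      rcases dfun_dich hz h1 h2 hh with hd | hd
      · obtain ⟨x, e1, e2⟩ := (hij.and (ev_graph hd)).exists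
        exact absurd e2 (Pset_ne e1)
      · filter_upwards [hij, hd] with x e1 e2
        exact e2.2.preimage_mem_nhds ((isOpen_Pset hn).mem_nhds e1)
  obtain ⟨x, hx⟩ := (eventually_all.2 hj).exists
  have hx' := eventually_all.2 hx
  have : ∀ᶠ y in 𝓝 (f x), f x = y := by
    filter_upwards [hx'] with y hy
    exact ((hmem x y).1 (Set.mem_iUnion.2 ⟨i, Set.mem_iInter.2 hy⟩)).2
  have h3 : ∀ᶠ y in 𝓝[≠] (f x), f x = y := nhdsWithin_le_nhds this
  obtain ⟨y, hy1, hy2⟩ := (h3.and self_mem_nhdsWithin).exists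
  exact hy2 hy1.symm

lemma param (hf : IsSubanalyticFnOn1 p {x | ‖x‖ ≤ 1} f) {x0 : ℚ_[p]}
    (hU : ∀ᶠ x in (U : Filter ℚ_[p]), ‖x‖ ≤ 1) (hx0 : (U : Filter ℚ_[p]) ≤ 𝓝[≠] x0) :
    ∃ s X G : ℚ_[p] → ℚ_[p], Tendsto s (U : Filter ℚ_[p]) (𝓝 0) ∧ AnalyticAt ℚ_[p] X 0 ∧
      X 0 = 0 ∧ MeromorphicAt G 0 ∧
      ∀ᶠ x in (U : Filter ℚ_[p]), s x ≠ 0 ∧ x = x0 + X (s x) ∧ f x = G (s x) := by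
  have hlim : Tendsto (fun x => x - x0) (U : Filter ℚ_[p]) (𝓝 0) := by
    have : Tendsto (fun x : ℚ_[p] => x - x0) (𝓝 x0) (𝓝 0) :=
      (continuous_id.sub continuous_const).tendsto' _ _ (by simp)
    exact this.mono_left (hx0.trans nhdsWithin_le_nhds)
  have hne : ∀ᶠ x in (U : Filter ℚ_[p]), x ≠ x0 := hx0 self_mem_nhdsWithin
  have hs0 : ∀ (s X : ℚ_[p] → ℚ_[p]), X 0 = 0 →
      (∀ᶠ x in (U : Filter ℚ_[p]), x - x0 = X (s x)) → ∀ᶠ x in (U : Filter ℚ_[p]), s x ≠ 0 := by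
    intro s X h0 h
    filter_upwards [hne, h] with x h1 h2 h3
    rw [h3, h0] at h2
    exact h1 (sub_eq_zero.1 h2)
  have hfst : ∀ z2 : ℚ_[p] × ℚ_[p] → ℚ_[p],
      MM U f (fun ω => (ω.1 - x0, z2 ω)) (fun ω => ω.1) := fun z2 =>
    ⟨fun ζ => ζ.1 + x0, analyticAt_fst.add analyticAt_const, Or.inl (by simp)⟩
  rcases ultra_lim U f with ⟨c, hc⟩ | ⟨hc, hfne⟩
  · by_contra hcon
    refine no_chart hf hU (z := fun ω => (ω.1 - x0, ω.2 - c)) ⟨?_, ?_, ?_⟩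
      (RM.of_MM (hfst _)) (RM.of_MM ⟨fun ζ => ζ.2 + c, analyticAt_snd.add analyticAt_const,
        Or.inl (by simp)⟩)
    · exact Eventually.of_forall fun x => by fun_prop
    · have := hlim.prodMk_nhds (hc.sub (tendsto_const_nhds (x := c)))
      simpa using! this
    · rintro ⟨s, Ψ, e1, e2, e3, e4⟩
      have e4' : ∀ᶠ x in (U : Filter ℚ_[p]), x - x0 = (Ψ (s x)).1 := by
        filter_upwards [e4] with x hx using congrArg Prod.fst hx
      have a1 : AnalyticAt ℚ_[p] (fun t => (Ψ t).1) 0 :=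
        AnalyticAt.comp (g := Prod.fst) analyticAt_fst e2
      have a2 : AnalyticAt ℚ_[p] (fun t => (Ψ t).2) 0 :=
        AnalyticAt.comp (g := Prod.snd) analyticAt_snd e2
      refine hcon ⟨s, fun t => (Ψ t).1, fun t => (Ψ t).2 + c, e1, a1, by simp [e3],
        (a2.add analyticAt_const).meromorphicAt, ?_⟩
      filter_upwards [e4, hs0 s (fun t => (Ψ t).1) (by simp [e3]) e4'] with x h1 h2
      refine ⟨h2, ?_, ?_⟩
      · simp [← h1]
      · simp [← h1]
  · by_contra hcon
    refine no_chart hf hU (z := fun ω => (ω.1 - x0, ω.2⁻¹)) ⟨?_, ?_, ?_⟩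
      (RM.of_MM (hfst _)) (RM.of_MM ⟨fun ζ => ζ.2, analyticAt_snd, Or.inr (by simp)⟩)
    · filter_upwards [hfne] with x hx
      exact ContinuousAt.prodMk continuousAt_const (continuousAt_inv₀ hx)
    · exact hlim.prodMk_nhds hc
    · rintro ⟨s, Ψ, e1, e2, e3, e4⟩
      have e4' : ∀ᶠ x in (U : Filter ℚ_[p]), x - x0 = (Ψ (s x)).1 := by
        filter_upwards [e4] with x hx using congrArg Prod.fst hx
      have a1 : AnalyticAt ℚ_[p] (fun t => (Ψ t).1) 0 :=
        AnalyticAt.comp (g := Prod.fst) analyticAt_fst e2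
      have a2 : AnalyticAt ℚ_[p] (fun t => (Ψ t).2) 0 :=
        AnalyticAt.comp (g := Prod.snd) analyticAt_snd e2
      refine hcon ⟨s, fun t => (Ψ t).1, fun t => ((Ψ t).2)⁻¹, e1, a1, by simp [e3],
        a2.meromorphicAt.inv, ?_⟩
      filter_upwards [e4, hs0 s (fun t => (Ψ t).1) (by simp [e3]) e4'] with x h1 h2
      refine ⟨h2, ?_, ?_⟩
      · simp [← h1]
      · simp [← h1]

end PadicSub

end

section

open scoped Topology

namespace PadicSub

variable {p : ℕ} [Fact p.Prime]

lemma exists_inverse {τ : ℚ_[p] → ℚ_[p]} {a : ℚ_[p]} (hτ : AnalyticAt ℚ_[p] τ a)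
    (hd : deriv τ a ≠ 0) : ∃ σ : ℚ_[p] → ℚ_[p], AnalyticAt ℚ_[p] σ (τ a) ∧ σ (τ a) = a ∧
      (∀ᶠ t in 𝓝 a, σ (τ t) = t) ∧ ∀ᶠ z in 𝓝 (τ a), τ (σ z) = z := by
  refine ⟨hτ.hasStrictDerivAt.localInverse _ _ _ hd, hτ.analyticAt_localInverse hd, ?_, ?_, ?_⟩
  · exact HasStrictFDerivAt.localInverse_apply_image ..
  · exact HasStrictDerivAt.eventually_left_inverse ..
  · exact HasStrictDerivAt.eventually_right_inverse ..

lemma exists_root {n : ℕ} (hn : 0 < n) : ∃ φ : ℚ_[p] → ℚ_[p], AnalyticAt ℚ_[p] φ 1 ∧ φ 1 = 1 ∧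
    ∀ᶠ z in 𝓝 (1 : ℚ_[p]), φ z ^ n = z := by
  have h1 : AnalyticAt ℚ_[p] (fun y : ℚ_[p] => y ^ n) 1 := by fun_prop
  have h2 : deriv (fun y : ℚ_[p] => y ^ n) 1 ≠ 0 := by
    simp [hn.ne']
  obtain ⟨σ, e1, e2, _, e4⟩ := exists_inverse h1 h2
  simp only [one_pow] at e1 e2 e4
  exact ⟨σ, e1, e2, e4⟩

variable {f : ℚ_[p] → ℚ_[p]} {U : Ultrafilter ℚ_[p]}

lemma param2 (hf : IsSubanalyticFnOn1 p {x | ‖x‖ ≤ 1} f) {x0 : ℚ_[p]}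
    (hU : ∀ᶠ x in (U : Filter ℚ_[p]), ‖x‖ ≤ 1) (hx0 : (U : Filter ℚ_[p]) ≤ 𝓝[≠] x0) :
    ∃ (n : ℕ) (l : ℚ_[p]) (g : ℚ_[p] → ℚ_[p]), 0 < n ∧ l ≠ 0 ∧ MeromorphicAt g 0 ∧
      ∀ᶠ x in (U : Filter ℚ_[p]), ∃ t, t ≠ 0 ∧ x = x0 + l * t ^ n ∧ f x = g t := by
  obtain ⟨s, X, G, hs, hX, hX0, hG, hev⟩ := param hf hU hx0
  have hne : ∀ᶠ x in (U : Filter ℚ_[p]), x ≠ x0 := hx0 self_mem_nhdsWithin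
  have hXn : ¬ ∀ᶠ t in 𝓝 0, X t = 0 := by
    intro h
    obtain ⟨x, ⟨h1, h2, h3⟩, h4, h5⟩ := (hev.and ((hs.eventually h).and hne)).exists
    apply h5
    rw [h2, h4, add_zero]
  obtain ⟨n, v, hv, hv0, hXv⟩ := onevar hX hXn
  have hn : 0 < n := by
    rcases Nat.eq_zero_or_pos n with rfl | h
    · have := hXv.self_of_nhds
      rw [hX0] at this
      simp at this
      exact absurd this.symm hv0
    · exact h
  obtain ⟨φ, hφ, hφ1, hφn⟩ := exists_root (p := p) hn
  set q : ℚ_[p] → ℚ_[p] := fun t => v t / v 0 with hq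
  have hqa : AnalyticAt ℚ_[p] q 0 := hv.div analyticAt_const hv0
  have hq0 : q 0 = 1 := div_self hv0
  set ρ : ℚ_[p] → ℚ_[p] := fun t => φ (q t) with hρ
  have hρa : AnalyticAt ℚ_[p] ρ 0 := AnalyticAt.comp (g := φ) (f := q) (by rw [hq0]; exact hφ) hqa
  have hρ0 : ρ 0 = 1 := by simp [hρ, hq0, hφ1]
  set τ : ℚ_[p] → ℚ_[p] := fun t => t * ρ t with hτ
  have hτa : AnalyticAt ℚ_[p] τ 0 := analyticAt_id.mul hρa
  have hτ0 : τ 0 = 0 := by simp [hτ]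
  have hτd : deriv τ 0 ≠ 0 := by
    have := (hasDerivAt_id (0 : ℚ_[p])).mul hρa.differentiableAt.hasDerivAt
    have h2 : HasDerivAt τ 1 0 := by simpa [hρ0] using! this
    rw [h2.deriv]
    exact one_ne_zero
  obtain ⟨σ, hσ, hσ0, hl, hr⟩ := exists_inverse hτa hτd
  rw [hτ0] at hσ hσ0 hr
  have hXt : ∀ᶠ t in 𝓝 0, X t = v 0 * τ t ^ n := by
    have h1 : Tendsto q (𝓝 0) (𝓝 1) := by
      have := hqa.continuousAt.tendsto
      rwa [hq0] at this
    filter_upwards [hXv, h1.eventually hφn] with t h2 h3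
    rw [h2, hτ]
    simp only [mul_pow, hρ]
    rw [h3, hq]
    field_simp
  refine ⟨n, v 0, fun z => G (σ z), hn, hv0, ?_, ?_⟩
  · exact MeromorphicAt.comp_analyticAt (f := G) (g := σ) (by rw [hσ0]; exact hG) hσ
  · filter_upwards [hev, hs.eventually hXt, hs.eventually hl, hne] with x h1 h2 h3 h4
    refine ⟨τ (s x), ?_, ?_, ?_⟩
    · intro h5
      rw [h5, zero_pow hn.ne', mul_zero] at h2
      apply h4
      rw [h1.2.1, h2, add_zero]
    · rw [← h2]; exact h1.2.1
    · rw [h3]; exact h1.2.2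

end PadicSub

end

section

open scoped Topology

namespace PadicSub

variable {p : ℕ} [Fact p.Prime]

lemma mero_dfun {m : ℕ} {h : (Fin m → ℚ_[p]) → ℚ_[p]} (hh : IsDFunction p h) :
    ∀ {φ : Fin m → ℚ_[p] → ℚ_[p]}, (∀ i, MeromorphicAt (φ i) 0) →
      MeromorphicAt (fun t => h (fun i => φ i t)) 0 := by
  induction hh with
  | @ranal m a ha =>
    intro φ hφ
    by_cases hneg : ∀ i, 0 ≤ meromorphicOrderAt (φ i) 0
    · have := fun i => ((hφ i).meromorphicOrderAt_nonneg_iff).1 (hneg i)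
      choose g hg hge using this
      have h1 : AnalyticAt ℚ_[p] (fun t => ranalFn p a (fun i => g i t)) 0 :=
        AnalyticAt.comp (g := ranalFn p a) (f := fun t i => g i t)
          (analyticAt_ranalFn a ha _) (AnalyticAt.pi hg)
      refine h1.meromorphicAt.congr ?_
      have := eventually_all.2 hge
      filter_upwards [this] with t ht
      congr 1
      funext i
      exact (ht i).symm
    · push Not at hneg
      obtain ⟨i, hi⟩ := hneg
      have h1 := tendsto_cobounded_of_meromorphicOrderAt_neg hi
      rw [← tendsto_norm_atTop_iff_cobounded] at h1
      refine (MeromorphicAt.const (0 : ℚ_[p]) 0).congr ?_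
      filter_upwards [h1.eventually_gt_atTop 1] with t ht
      have : ¬ ∀ j, ‖φ j t‖ ≤ 1 := fun hj => absurd (hj i) (not_le.2 ht)
      simp only [ranalFn]
      rw [if_neg this]
  | @poly m q =>
    intro φ hφ
    induction q using MvPolynomial.induction_on with
    | C a => simp
    | add P Q h1 h2 => simpa using! h1.add h2
    | mul_X P i h1 => simpa using! h1.mul (hφ i)
  | inv =>
    intro φ hφ
    exact (hφ 0).inv
  | comp f g hf hg ihf ihg =>
    intro φ hφ
    exact ihf (φ := fun i t => g i (fun j => φ j t)) (fun i => ihg i hφ)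

lemma mero_form {k : ℚ_[p] → ℚ_[p]} (hk : MeromorphicAt k 0) :
    (∀ᶠ t in 𝓝[≠] 0, k t = 0) ∨ ∃ (e : ℤ) (u : ℚ_[p] → ℚ_[p]), AnalyticAt ℚ_[p] u 0 ∧ u 0 ≠ 0 ∧
      ∀ᶠ t in 𝓝[≠] 0, k t = t ^ e * u t := by
  by_cases h : meromorphicOrderAt k 0 = ⊤
  · exact Or.inl (meromorphicOrderAt_eq_top_iff.1 h)
  · right
    obtain ⟨e, he⟩ := WithTop.ne_top_iff_exists.1 h
    obtain ⟨u, h1, h2, h3⟩ := (meromorphicOrderAt_eq_int_iff hk).1 he.symm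
    exact ⟨e, u, h1, h2, by simpa using h3⟩

lemma ev_eps {Q : ℚ_[p] → Prop} (h : ∀ᶠ t in 𝓝[≠] (0 : ℚ_[p]), Q t) :
    ∃ ε > 0, ∀ t, t ≠ 0 → ‖t‖ < ε → Q t := by
  rw [eventually_nhdsWithin_iff, Metric.eventually_nhds_iff] at h
  obtain ⟨ε, h1, h2⟩ := h
  exact ⟨ε, h1, fun t ht ht' => h2 (by simpa using ht') ht⟩

lemma Pset_one (n : ℕ) : (1 : ℚ_[p]) ∈ Pset p n := ⟨1, one_ne_zero, one_pow n⟩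

lemma Pset_mul {n : ℕ} {x y : ℚ_[p]} (hx : x ∈ Pset p n) (hy : y ∈ Pset p n) :
    x * y ∈ Pset p n := by
  obtain ⟨a, ha, rfl⟩ := hx
  obtain ⟨b, hb, rfl⟩ := hy
  exact ⟨a * b, mul_ne_zero ha hb, mul_pow _ _ _⟩

lemma Pset_inv {n : ℕ} {x : ℚ_[p]} (hx : x ∈ Pset p n) : x⁻¹ ∈ Pset p n := by
  obtain ⟨a, ha, rfl⟩ := hx
  exact ⟨a⁻¹, inv_ne_zero ha, inv_pow _ _⟩

lemma Pset_div {n : ℕ} {x y : ℚ_[p]} (hx : x ∈ Pset p n) (hy : y ∈ Pset p n) :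
    x / y ∈ Pset p n := by
  rw [div_eq_mul_inv]; exact Pset_mul hx (Pset_inv hy)

lemma Pset_mul_iff {n : ℕ} {x y : ℚ_[p]} (hy : y ∈ Pset p n) :
    x ∈ Pset p n ↔ x * y ∈ Pset p n := by
  refine ⟨fun h => Pset_mul h hy, fun h => ?_⟩
  have := Pset_div h hy
  rwa [mul_div_cancel_right₀ _ (Pset_ne hy)] at this

lemma Pset_dvd {m n : ℕ} (h : m ∣ n) : Pset p n ⊆ Pset p m := by
  obtain ⟨k, rfl⟩ := h
  rintro x ⟨a, ha, rfl⟩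
  exact ⟨a ^ k, pow_ne_zero _ ha, by rw [← pow_mul, mul_comm]⟩

/-- Invariance of a property near `0` under multiplication by `M`-th powers. -/
def Inv (M : ℕ) (Q : ℚ_[p] → Prop) : Prop :=
  ∃ ε > 0, ∀ t r, t ≠ 0 → r ≠ 0 → ‖t‖ < ε → ‖t * r ^ M‖ < ε → (Q t ↔ Q (t * r ^ M))

lemma Inv.dvd {M N : ℕ} {Q : ℚ_[p] → Prop} (h : Inv M Q) (hMN : M ∣ N) : Inv N Q := by
  obtain ⟨ε, h1, h2⟩ := h
  obtain ⟨k, rfl⟩ := hMN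
  refine ⟨ε, h1, fun t r ht hr e1 e2 => ?_⟩
  have : r ^ (M * k) = (r ^ k) ^ M := by rw [← pow_mul, mul_comm]
  rw [this] at e2 ⊢
  exact h2 t (r ^ k) ht (pow_ne_zero _ hr) e1 e2

lemma Inv.finite {ι : Type*} [Fintype ι] {Q : ι → ℚ_[p] → Prop}
    (h : ∀ i, ∃ M, 0 < M ∧ Inv M (Q i)) : ∃ M, 0 < M ∧ ∃ ε > 0, ∀ i, ∀ t r, t ≠ 0 → r ≠ 0 →
      ‖t‖ < ε → ‖t * r ^ M‖ < ε → (Q i t ↔ Q i (t * r ^ M)) := by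
  choose M hM hI using h
  have h1 : ∀ i, Inv (∏ i, M i) (Q i) := fun i => (hI i).dvd (Finset.dvd_prod_of_mem _ (by simp))
  choose ε hε hQ using h1
  have h2 : ∀ᶠ δ in 𝓝[>] (0 : ℝ), ∀ i, δ ≤ ε i := by
    rw [eventually_all]
    intro i
    exact nhdsWithin_le_nhds ((eventually_lt_nhds (hε i)).mono fun _ h => h.le)
  obtain ⟨δ, hδ, hδ0⟩ := (h2.and self_mem_nhdsWithin).exists
  exact ⟨_, Finset.prod_pos fun i _ => hM i, δ, hδ0, fun i t r ht hr e1 e2 =>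
    hQ i t r ht hr (e1.trans_le (hδ i)) (e2.trans_le (hδ i))⟩

lemma Inv.zero {k : ℚ_[p] → ℚ_[p]} (hk : MeromorphicAt k 0) :
    ∃ M, 0 < M ∧ Inv M (fun t => k t = 0) := by
  refine ⟨1, one_pos, ?_⟩
  rcases hk.eventually_eq_zero_or_eventually_ne_zero with h | h
  all_goals
    obtain ⟨ε, h1, h2⟩ := ev_eps h
    refine ⟨ε, h1, fun t r ht hr e1 e2 => ?_⟩
    have e3 := h2 t ht e1
    have e4 := h2 _ (mul_ne_zero ht (pow_ne_zero 1 hr)) e2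
    tauto

lemma Inv.pset {k : ℚ_[p] → ℚ_[p]} (hk : MeromorphicAt k 0) {n : ℕ} (hn : 0 < n) :
    ∃ M, 0 < M ∧ Inv M (fun t => k t ∈ Pset p n) := by
  refine ⟨n, hn, ?_⟩
  rcases mero_form hk with h | ⟨e, u, hu, hu0, h⟩
  · obtain ⟨ε, h1, h2⟩ := ev_eps h
    refine ⟨ε, h1, fun t r ht hr e1 e2 => ?_⟩
    have e3 := h2 t ht e1
    have e4 := h2 _ (mul_ne_zero ht (pow_ne_zero n hr)) e2
    simp only [e3, e4]
  · have hq : ∀ᶠ t in 𝓝 0, u t / u 0 ∈ Pset p n := by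
      have h1 : Tendsto (fun t => u t / u 0) (𝓝 0) (𝓝 1) := by
        have := hu.continuousAt.tendsto.div_const (u 0)
        rwa [div_self hu0] at this
      exact h1.eventually ((isOpen_Pset hn).mem_nhds (Pset_one n))
    obtain ⟨ε, h1, h2⟩ := ev_eps (h.and (nhdsWithin_le_nhds hq))
    refine ⟨ε, h1, fun t r ht hr e1 e2 => ?_⟩
    obtain ⟨e3, e3'⟩ := h2 t ht e1
    obtain ⟨e4, e4'⟩ := h2 _ (mul_ne_zero ht (pow_ne_zero n hr)) e2
    have e5 := Pset_mul (x := (r ^ e) ^ n) ⟨r ^ e, zpow_ne_zero _ hr, rfl⟩ (Pset_div e4' e3')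
    have hut : u t ≠ 0 := fun h0 => Pset_ne e3' (by simp [h0])
    have : k (t * r ^ n) = k t * ((r ^ e) ^ n * (u (t * r ^ n) / u 0 / (u t / u 0))) := by
      rw [e3, e4, mul_zpow]
      have : (r ^ n) ^ e = (r ^ e) ^ n := by
        rw [← zpow_natCast, ← zpow_natCast, ← zpow_mul, ← zpow_mul, mul_comm]
      rw [this]
      field_simp
    show k t ∈ Pset p n ↔ k (t * r ^ n) ∈ Pset p n
    rw [this]
    exact Pset_mul_iff e5

lemma Inv.subanalytic {m : ℕ} {X : Set (Fin m → ℚ_[p])} (hX : IsSubanalytic p X)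
    {φ : Fin m → ℚ_[p] → ℚ_[p]} (hφ : ∀ i, MeromorphicAt (φ i) 0) :
    ∃ M, 0 < M ∧ Inv M (fun t => (fun i => φ i t) ∈ X) := by
  obtain ⟨r, s, F, hF, rfl⟩ := hX
  have h : ∀ ij : Fin r × Fin s, ∃ M, 0 < M ∧ Inv M (fun t => (fun i => φ i t) ∈ F ij.1 ij.2) := by
    rintro ⟨i, j⟩
    rcases hF i j with ⟨h, hh, he⟩ | ⟨h, n, hh, hn, he⟩
    · simp only [he]
      exact Inv.zero (mero_dfun hh hφ)
    · simp only [he]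
      exact Inv.pset (mero_dfun hh hφ) hn
  obtain ⟨M, hM, ε, hε, hI⟩ := Inv.finite h
  refine ⟨M, hM, ε, hε, fun t r' ht hr e1 e2 => ?_⟩
  simp only [Set.mem_iUnion, Set.mem_iInter]
  exact exists_congr fun i => forall_congr' fun j => hI (i, j) t r' ht hr e1 e2

end PadicSub

end

section

open scoped Topology

namespace PadicSub

variable {p : ℕ} [Fact p.Prime]

/-- The norm of `f` is given on `A` by a root of the norm of a rational function. -/
def Good (f : ℚ_[p] → ℚ_[p]) (A : Set ℚ_[p]) : Prop :=
  ∃ (P Q : Polynomial ℚ_[p]) (e : ℕ), 0 < e ∧ (∀ x ∈ A, Q.eval x ≠ 0) ∧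
    ∀ x ∈ A, ‖f x‖ = ‖P.eval x / Q.eval x‖ ^ ((e : ℝ)⁻¹)

lemma Good.mono {f : ℚ_[p] → ℚ_[p]} {A B : Set ℚ_[p]} (h : Good f B) (hAB : A ⊆ B) : Good f A := by
  obtain ⟨P, Q, e, h1, h2, h3⟩ := h
  exact ⟨P, Q, e, h1, fun x hx => h2 x (hAB hx), fun x hx => h3 x (hAB hx)⟩

lemma Good.empty {f : ℚ_[p] → ℚ_[p]} : Good f ∅ :=
  ⟨1, 1, 1, one_pos, by simp, by simp⟩

/-- The part of the coset `x0 + μ P_N` close to `x0`. -/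
def cos (x0 μ : ℚ_[p]) (N : ℕ) (ε : ℝ) : Set ℚ_[p] :=
  {x | ‖x - x0‖ < ε ∧ (x - x0) / μ ∈ Pset p N}

lemma cos_mono {x0 μ : ℚ_[p]} {N N' : ℕ} {ε ε' : ℝ} (h : ε ≤ ε') (hN : N' ∣ N) :
    cos x0 μ N ε ⊆ cos x0 μ N' ε' :=
  fun _ hx => ⟨hx.1.trans_le h, Pset_dvd hN hx.2⟩

variable {f : ℚ_[p] → ℚ_[p]}

/-- The predicate defining the ideal of good sets. -/
def PG (f : ℚ_[p] → ℚ_[p]) (x0 : ℚ_[p]) (S : Set ℚ_[p]) : Prop :=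
  ∃ N, 0 < N ∧ ∃ ε > 0, ∀ μ : ℚ_[p], μ ≠ 0 → Good f (cos x0 μ N ε) ∨ Disjoint (cos x0 μ N ε) S

lemma PG_empty {x0 : ℚ_[p]} : PG f x0 ∅ :=
  ⟨1, one_pos, 1, one_pos, fun _ _ => Or.inr (Set.disjoint_empty _)⟩

lemma PG_mono {x0 : ℚ_[p]} {S T : Set ℚ_[p]} (h : PG f x0 T) (hST : S ⊆ T) : PG f x0 S := by
  obtain ⟨N, hN, ε, hε, h⟩ := h
  exact ⟨N, hN, ε, hε, fun μ hμ => (h μ hμ).imp_right fun h => h.mono_right hST⟩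

lemma PG_union {x0 : ℚ_[p]} {S T : Set ℚ_[p]} (h : PG f x0 S) (h' : PG f x0 T) :
    PG f x0 (S ∪ T) := by
  obtain ⟨N, hN, ε, hε, h⟩ := h
  obtain ⟨N', hN', ε', hε', h'⟩ := h'
  refine ⟨N * N', Nat.mul_pos hN hN', min ε ε', lt_min hε hε', fun μ hμ => ?_⟩
  have s1 : cos x0 μ (N * N') (min ε ε') ⊆ cos x0 μ N ε :=
    cos_mono (min_le_left _ _) (Dvd.intro _ rfl)
  have s2 : cos x0 μ (N * N') (min ε ε') ⊆ cos x0 μ N' ε' :=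
    cos_mono (min_le_right _ _) (Dvd.intro_left _ rfl)
  rcases h μ hμ with h1 | h1
  · exact Or.inl (h1.mono s1)
  rcases h' μ hμ with h2 | h2
  · exact Or.inl (h2.mono s2)
  · exact Or.inr (Set.disjoint_union_right.2 ⟨h1.mono_left s1, h2.mono_left s2⟩)

lemma PG_param (hf : IsSubanalyticFnOn1 p {x | ‖x‖ ≤ 1} f) {x0 l : ℚ_[p]} {n : ℕ} (hn : 0 < n)
    (hl : l ≠ 0) {g : ℚ_[p] → ℚ_[p]} (hg : MeromorphicAt g 0) :
    PG f x0 {x | ‖x‖ ≤ 1 ∧ ∃ t, t ≠ 0 ∧ x = x0 + l * t ^ n ∧ f x = g t} := by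
  have hφ : ∀ i : Fin 2, MeromorphicAt ((![fun t => x0 + l * t ^ n, g] : Fin 2 → _) i) 0 := by
    intro i
    fin_cases i
    · have : AnalyticAt ℚ_[p] (fun t : ℚ_[p] => x0 + l * t ^ n) 0 := by fun_prop
      exact this.meromorphicAt
    · exact hg
  obtain ⟨M, hM, ε1, hε1, hI⟩ := Inv.subanalytic hf hφ
  -- near zero `g` is given by a monomial
  have hform : ∃ ε2 > 0, (∀ t, t ≠ 0 → ‖t‖ < ε2 → g t = 0) ∨ ∃ (b : ℤ) (c : ℚ_[p]),
      ∀ t, t ≠ 0 → ‖t‖ < ε2 → ‖g t‖ = ‖t ^ b * c‖ := by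
    rcases mero_form hg with h | ⟨b, u, hu, hu0, h⟩
    · obtain ⟨ε, h1, h2⟩ := ev_eps h
      exact ⟨ε, h1, Or.inl h2⟩
    · have hq : ∀ᶠ t in 𝓝 0, ‖u t‖ = ‖u 0‖ := by
        have h1 : ∀ᶠ t in 𝓝 0, ‖u t - u 0‖ < ‖u 0‖ := by
          have := (hu.continuousAt.tendsto.sub_const (u 0)).norm
          rw [sub_self, norm_zero] at this
          exact this.eventually (gt_mem_nhds (norm_pos_iff.2 hu0))
        filter_upwards [h1] with t ht
        have := Padic.add_eq_max_of_ne (p := p) (q := u t - u 0) (r := u 0) ht.ne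
        rw [sub_add_cancel, max_eq_right ht.le] at this
        exact this
      obtain ⟨ε, h1, h2⟩ := ev_eps (h.and (nhdsWithin_le_nhds hq))
      refine ⟨ε, h1, Or.inr ⟨b, u 0, fun t ht ht' => ?_⟩⟩
      obtain ⟨e1, e2⟩ := h2 t ht ht'
      rw [e1, norm_mul, norm_mul, e2]
  obtain ⟨ε2, hε2, hform⟩ := hform
  set ε0 := min ε1 ε2 with hε0
  have hεpos : 0 < ε0 := lt_min hε1 hε2
  have hlp : 0 < ‖l‖ := norm_pos_iff.2 hl
  refine ⟨n * M, Nat.mul_pos hn hM, ‖l‖ * ε0 ^ n, by positivity, fun μ hμ => ?_⟩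
  by_cases hex : ∃ x1 ∈ cos x0 μ (n * M) (‖l‖ * ε0 ^ n),
      x1 ∈ {x | ‖x‖ ≤ 1 ∧ ∃ t, t ≠ 0 ∧ x = x0 + l * t ^ n ∧ f x = g t}
  swap
  · right
    rw [Set.disjoint_left]
    exact fun x h1 h2 => hex ⟨x, h1, h2⟩
  left
  obtain ⟨x1, ⟨hx1, hx1P⟩, hx1n, t1, ht1, hxt1, hft1⟩ := hex
  have small : ∀ t, ‖l * t ^ n‖ < ‖l‖ * ε0 ^ n → ‖t‖ < ε0 := by
    intro t ht
    rw [norm_mul, norm_pow] at ht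
    exact lt_of_pow_lt_pow_left₀ n hεpos.le (lt_of_mul_lt_mul_left ht hlp.le)
  have hst1 : ‖t1‖ < ε0 := small t1 (by rw [hxt1] at hx1; simpa using hx1)
  have main : ∀ x ∈ cos x0 μ (n * M) (‖l‖ * ε0 ^ n), ∃ t, t ≠ 0 ∧ ‖t‖ < ε0 ∧
      x = x0 + l * t ^ n ∧ f x = g t := by
    rintro x ⟨hx, hxP⟩
    have hq := Pset_div hxP hx1P
    obtain ⟨r, hr, hrx⟩ := hq
    have hne : l * t1 ^ n ≠ 0 := mul_ne_zero hl (pow_ne_zero _ ht1)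
    have hxx : x = x0 + l * (t1 * r ^ M) ^ n := by
      have h1 : x1 - x0 = l * t1 ^ n := by rw [hxt1]; ring
      rw [h1] at hrx
      have : r ^ (n * M) * (l * t1 ^ n) = x - x0 := by
        rw [hrx]; field_simp
      have h2 : (t1 * r ^ M) ^ n = t1 ^ n * r ^ (n * M) := by
        rw [mul_pow, ← pow_mul, mul_comm M n]
      rw [h2]
      linear_combination -this
    have hs : ‖t1 * r ^ M‖ < ε0 := small _ (by rw [hxx] at hx; simpa using hx)
    refine ⟨t1 * r ^ M, mul_ne_zero ht1 (pow_ne_zero _ hr), hs, hxx, ?_⟩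
    have h3 := hI t1 r ht1 hr (hst1.trans_le (min_le_left _ _)) (hs.trans_le (min_le_left _ _))
    have h4 : ‖x0 + l * t1 ^ n‖ ≤ 1 ∧ f (x0 + l * t1 ^ n) = g t1 := by
      rw [← hxt1]; exact ⟨hx1n, hft1⟩
    have h5 := h3.1 h4
    have h6 : ‖x0 + l * (t1 * r ^ M) ^ n‖ ≤ 1 ∧
      f (x0 + l * (t1 * r ^ M) ^ n) = g (t1 * r ^ M) := h5
    rw [hxx]
    exact h6.2
  rcases hform with h0 | ⟨b, c, hb⟩
  · refine ⟨0, 1, 1, one_pos, by simp, fun x hx => ?_⟩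
    obtain ⟨t, e1, e2, e3, e4⟩ := main x hx
    rw [e4, h0 t e1 (e2.trans_le (min_le_right _ _))]
    simp
  · refine ⟨Polynomial.C (c ^ n * l ^ (-b)) * (Polynomial.X - Polynomial.C x0) ^ b.toNat,
      (Polynomial.X - Polynomial.C x0) ^ (-b).toNat, n, hn, fun x hx => ?_, fun x hx => ?_⟩
    · obtain ⟨t, e1, e2, e3, e4⟩ := main x hx
      simp only [Polynomial.eval_pow, Polynomial.eval_sub, Polynomial.eval_X, Polynomial.eval_C]
      refine pow_ne_zero _ ?_
      rw [e3, add_sub_cancel_left]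
      exact mul_ne_zero hl (pow_ne_zero _ e1)
    · obtain ⟨t, e1, e2, e3, e4⟩ := main x hx
      have hd : x - x0 = l * t ^ n := by rw [e3]; ring
      have hd0 : l * t ^ n ≠ 0 := mul_ne_zero hl (pow_ne_zero _ e1)
      simp only [Polynomial.eval_pow, Polynomial.eval_sub, Polynomial.eval_X, Polynomial.eval_C,
        Polynomial.eval_mul]
      rw [e4, hb t e1 (e2.trans_le (min_le_right _ _)), hd]
      have hz : c ^ n * l ^ (-b) * (l * t ^ n) ^ b.toNat / (l * t ^ n) ^ (-b).toNat
          = (t ^ b * c) ^ n := by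
        have h1 : (l * t ^ n) ^ b.toNat / (l * t ^ n) ^ (-b).toNat = (l * t ^ n) ^ b := by
          generalize l * t ^ n = w at hd0
          rw [← zpow_natCast, ← zpow_natCast, ← zpow_sub₀ hd0, Int.toNat_sub_toNat_neg]
        rw [mul_div_assoc, h1, mul_zpow, mul_pow, zpow_neg]
        have h2 : (t ^ n) ^ b = (t ^ b) ^ n := by
          rw [← zpow_natCast, ← zpow_natCast, ← zpow_mul, ← zpow_mul, mul_comm]
        rw [h2]
        have := zpow_ne_zero b hl
        field_simp
      rw [hz, norm_pow, Real.pow_rpow_inv_natCast (norm_nonneg _) hn.ne']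

lemma local_good (hf : IsSubanalyticFnOn1 p {x | ‖x‖ ≤ 1} f) {x0 : ℚ_[p]} (hx0 : ‖x0‖ ≤ 1) :
    ∃ N, 0 < N ∧ ∃ ε > 0, ∀ μ : ℚ_[p], μ ≠ 0 → Good f (cos x0 μ N ε) := by
  have key : ∃ s ∈ 𝓝[≠] x0, PG f x0 s := by
    by_contra hcon
    push Not at hcon
    set L : Filter ℚ_[p] := Filter.comk (PG f x0) PG_empty (fun t ht s hst => PG_mono ht hst)
      (fun s hs t ht => PG_union hs ht) with hL
    have hne : (𝓝[≠] x0 ⊓ L).NeBot := by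
      rw [Filter.inf_neBot_iff]
      intro a ha b hb
      by_contra h
      rw [Set.not_nonempty_iff_eq_empty] at h
      have hb' : PG f x0 bᶜ := Filter.mem_comk.1 hb
      refine hcon a ha (PG_mono hb' fun x hx hxb => ?_)
      have : x ∈ a ∩ b := ⟨hx, hxb⟩
      rw [h] at this
      exact this
    set U := Ultrafilter.of (𝓝[≠] x0 ⊓ L) with hUdef
    have hU : (U : Filter ℚ_[p]) ≤ 𝓝[≠] x0 ⊓ L := Ultrafilter.of_le _
    have hU1 : (U : Filter ℚ_[p]) ≤ 𝓝[≠] x0 := hU.trans inf_le_left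
    have hball : ∀ᶠ x in (U : Filter ℚ_[p]), ‖x‖ ≤ 1 := by
      refine (hU1.trans nhdsWithin_le_nhds) ?_
      filter_upwards [Metric.ball_mem_nhds x0 one_pos] with x hx
      rw [mem_ball_iff_norm] at hx
      have := Padic.nonarchimedean (p := p) (x - x0) x0
      rw [sub_add_cancel] at this
      exact this.trans (max_le hx.le hx0)
    obtain ⟨n, l, g, hn, hl, hg, hev⟩ := param2 hf hball hU1
    have h1 := PG_param hf (x0 := x0) hn hl hg
    have h2 := (hU.trans inf_le_right) (Filter.compl_mem_comk.2 h1)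
    obtain ⟨x, e1, e2, e3⟩ := (hev.and (hball.and h2)).exists
    exact e3 ⟨e2, e1⟩
  obtain ⟨s, hs, N, hN, ε, hε, h⟩ := key
  rw [mem_nhdsWithin_iff_exists_mem_nhds_inter] at hs
  obtain ⟨W, hW, hWs⟩ := hs
  obtain ⟨δ, hδ, hδW⟩ := Metric.mem_nhds_iff.1 hW
  refine ⟨N, hN, min ε δ, lt_min hε hδ, fun μ hμ => ?_⟩
  rcases h μ hμ with h1 | h1
  · exact h1.mono (cos_mono (min_le_left _ _) dvd_rfl)
  · refine Good.empty.mono fun x hx => ?_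
    refine Set.disjoint_left.1 h1 (cos_mono (min_le_left _ _) dvd_rfl hx) (hWs ⟨hδW ?_, ?_⟩)
    · rw [mem_ball_iff_norm]
      exact hx.1.trans_le (min_le_right _ _)
    · intro hxx
      have hxx' : x = x0 := hxx
      exact Pset_ne hx.2 (by simp [hxx'])

end PadicSub

end

section

open scoped Topology

namespace PadicSub

variable {p : ℕ} [Fact p.Prime]

lemma exists_reps (n : ℕ) (hn : 0 < n) : ∃ R : Finset ℚ_[p], (∀ μ ∈ R, μ ≠ 0) ∧
    ∀ x : ℚ_[p], x ≠ 0 → ∃ μ ∈ R, x / μ ∈ Pset p n := by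
  have hp : (p : ℚ_[p]) ≠ 0 := Nat.cast_ne_zero.2 (Fact.out : p.Prime).ne_zero
  have hp1 : (1 : ℝ) < p := by exact_mod_cast (Fact.out : p.Prime).one_lt
  set K : Set ℚ_[p] := Metric.closedBall 0 1 ∩ {x | (p : ℝ) ^ (-(n : ℤ)) ≤ ‖x‖} with hK
  have hKc : IsCompact K := (isCompact_closedBall 0 1).inter_right
    (isClosed_le continuous_const continuous_norm)
  have hK0 : ∀ x ∈ K, x ≠ 0 := by
    rintro x ⟨-, hx⟩ rfl
    have : (0 : ℝ) < (p : ℝ) ^ (-(n : ℤ)) := by positivity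
    simp only [Set.mem_ofPred_eq, norm_zero] at hx
    exact absurd hx (not_le.2 this)
  obtain ⟨t, ht, hcov⟩ := hKc.elim_nhds_subcover (fun x => {y | y / x ∈ Pset p n}) (by
    intro x hx
    have h1 : Tendsto (fun y : ℚ_[p] => y / x) (𝓝 x) (𝓝 1) := by
      have := (tendsto_id (α := ℚ_[p]) (x := 𝓝 x)).div_const x
      simpa [div_self (hK0 x hx)] using this
    exact h1.eventually ((isOpen_Pset hn).mem_nhds (Pset_one n)))
  refine ⟨t, fun μ hμ => hK0 μ (ht μ hμ), fun x hx => ?_⟩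
  set q : ℤ := x.valuation / n with hq
  set y : ℚ_[p] := x * ((p : ℚ_[p]) ^ (-q)) ^ n with hy
  have hyK : y ∈ K := by
    have hny : ‖y‖ = (p : ℝ) ^ (-(x.valuation % n)) := by
      rw [hy, norm_mul, norm_pow, Padic.norm_p_zpow, Padic.norm_eq_zpow_neg_valuation hx,
        ← zpow_natCast, ← zpow_mul, ← zpow_add₀ (by positivity)]
      congr 1
      rw [Int.emod_def]
      ring
    have h1 := Int.emod_nonneg x.valuation (b := (n : ℤ)) (by omega)
    have h2 := Int.emod_lt_of_pos x.valuation (b := (n : ℤ)) (by omega)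
    constructor
    · rw [mem_closedBall_zero_iff, hny]
      exact zpow_le_one_of_nonpos₀ hp1.le (by omega)
    · show _ ≤ ‖y‖
      rw [hny]
      exact zpow_le_zpow_right₀ hp1.le (by omega)
  obtain ⟨μ, hμ, hyμ⟩ := Set.mem_iUnion₂.1 (hcov hyK)
  refine ⟨μ, hμ, ?_⟩
  have h1 : y / μ ∈ Pset p n := hyμ
  have h2 : ((p : ℚ_[p]) ^ (-q)) ^ n ∈ Pset p n := ⟨_, zpow_ne_zero _ hp, rfl⟩
  rw [Pset_mul_iff h2]
  convert h1 using 1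
  rw [hy]
  ring

/-- Basic semialgebraic sets. -/
def Bas {m : ℕ} (X : Set (Fin m → ℚ_[p])) : Prop :=
  (∃ f : MvPolynomial (Fin m) ℚ_[p], X = {x | MvPolynomial.eval x f = 0}) ∨
    (∃ (f : MvPolynomial (Fin m) ℚ_[p]) (n : ℕ), 0 < n ∧
      X = {x | MvPolynomial.eval x f ∈ Pset p n})

variable {m : ℕ}

lemma Bas.univ : Bas (Set.univ : Set (Fin m → ℚ_[p])) := Or.inl ⟨0, by simp⟩

lemma sa_of_finite {ι κ : Type} [Fintype ι] [Fintype κ] (F : ι → κ → Set (Fin m → ℚ_[p]))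
    (hF : ∀ i j, Bas (F i j)) : IsSemialgebraic p (⋃ i, ⋂ j, F i j) := by
  refine ⟨Fintype.card ι, Fintype.card κ,
    fun i j => F ((Fintype.equivFin ι).symm i) ((Fintype.equivFin κ).symm j),
    fun i j => hF _ _, ?_⟩
  ext x
  simp only [Set.mem_iUnion, Set.mem_iInter]
  constructor
  · rintro ⟨i, hi⟩
    exact ⟨Fintype.equivFin ι i, fun j => by simpa using hi _⟩
  · rintro ⟨i, hi⟩
    exact ⟨_, fun j => by simpa using hi (Fintype.equivFin κ j)⟩

lemma Bas.sa {X : Set (Fin m → ℚ_[p])} (h : Bas X) : IsSemialgebraic p X := by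
  have := sa_of_finite (ι := Unit) (κ := Unit) (fun _ _ => X) (fun _ _ => h)
  simpa [Set.iUnion_const, Set.iInter_const] using this

lemma sa_univ : IsSemialgebraic p (Set.univ : Set (Fin m → ℚ_[p])) := Bas.univ.sa

lemma sa_empty : IsSemialgebraic p (∅ : Set (Fin m → ℚ_[p])) := by
  have := sa_of_finite (p := p) (m := m) (ι := Empty) (κ := Unit) (fun _ _ => Set.univ)
    (fun _ _ => Bas.univ)
  simpa using this

lemma sa_union {X Y : Set (Fin m → ℚ_[p])} (hX : IsSemialgebraic p X) (hY : IsSemialgebraic p Y) :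
    IsSemialgebraic p (X ∪ Y) := by
  obtain ⟨r, s, F, hF, rfl⟩ := hX
  obtain ⟨r', s', F', hF', rfl⟩ := hY
  have := sa_of_finite (p := p) (m := m) (ι := Fin r ⊕ Fin r') (κ := Fin s ⊕ Fin s')
    (Sum.elim (fun i => Sum.elim (F i) (fun _ => Set.univ))
      (fun i => Sum.elim (fun _ => Set.univ) (F' i)))
    (by
      rintro (i | i) (j | j)
      · exact hF i j
      · exact Bas.univ
      · exact Bas.univ
      · exact hF' i j)
  convert this using 1
  ext x
  simp [Set.mem_iUnion, Set.mem_iInter]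

lemma sa_inter {X Y : Set (Fin m → ℚ_[p])} (hX : IsSemialgebraic p X) (hY : IsSemialgebraic p Y) :
    IsSemialgebraic p (X ∩ Y) := by
  obtain ⟨r, s, F, hF, rfl⟩ := hX
  obtain ⟨r', s', F', hF', rfl⟩ := hY
  have := sa_of_finite (p := p) (m := m) (ι := Fin r × Fin r') (κ := Fin s ⊕ Fin s')
    (fun i => Sum.elim (F i.1) (F' i.2))
    (by
      rintro i (j | j)
      · exact hF i.1 j
      · exact hF' i.2 j)
  convert this using 1
  ext x
  simp [Set.mem_iUnion, Set.mem_iInter]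

lemma sa_biUnion {ι : Type*} (s : Finset ι) {X : ι → Set (Fin m → ℚ_[p])}
    (h : ∀ i ∈ s, IsSemialgebraic p (X i)) : IsSemialgebraic p (⋃ i ∈ s, X i) := by
  classical
  induction s using Finset.induction_on with
  | empty => simpa using sa_empty
  | insert a s ha ih =>
    rw [Finset.set_biUnion_insert]
    exact sa_union (h a (by simp)) (ih fun i hi => h i (by simp [hi]))

lemma sa_biInter {ι : Type*} (s : Finset ι) {X : ι → Set (Fin m → ℚ_[p])}
    (h : ∀ i ∈ s, IsSemialgebraic p (X i)) : IsSemialgebraic p (⋂ i ∈ s, X i) := by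
  classical
  induction s using Finset.induction_on with
  | empty => simpa using sa_univ
  | insert a s ha ih =>
    rw [Finset.set_biInter_insert]
    exact sa_inter (h a (by simp)) (ih fun i hi => h i (by simp [hi]))

lemma Bas.compl {X : Set (Fin m → ℚ_[p])} (h : Bas X) : IsSemialgebraic p Xᶜ := by
  classical
  rcases h with ⟨f, rfl⟩ | ⟨f, n, hn, rfl⟩
  · refine Bas.sa (Or.inr ⟨f, 1, one_pos, ?_⟩)
    ext x
    simp [Pset]
  · obtain ⟨R, hR0, hR⟩ := exists_reps (p := p) n hn
    have h1 : IsSemialgebraic p ({x | MvPolynomial.eval x f = 0} ∪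
        ⋃ μ ∈ R.filter (fun μ => μ ∉ Pset p n),
          {x | MvPolynomial.eval x (f * MvPolynomial.C μ⁻¹) ∈ Pset p n}) :=
      sa_union (Bas.sa (Or.inl ⟨f, rfl⟩))
        (sa_biUnion _ fun μ _ => Bas.sa (Or.inr ⟨_, n, hn, rfl⟩))
    convert h1 using 1
    ext x
    simp only [Set.mem_compl_iff, Set.mem_ofPred_eq, Set.mem_union, Set.mem_iUnion,
      Finset.mem_filter, map_mul, MvPolynomial.eval_C, exists_prop]
    simp only [← div_eq_mul_inv]
    constructor
    · intro hx
      by_cases h0 : MvPolynomial.eval x f = 0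
      · exact Or.inl h0
      · right
        obtain ⟨μ, hμ, hxμ⟩ := hR _ h0
        refine ⟨μ, ⟨hμ, fun hμP => hx ?_⟩, hxμ⟩
        have := Pset_mul hxμ hμP
        rwa [div_mul_cancel₀ _ (hR0 μ hμ)] at this
    · rintro (h0 | ⟨μ, ⟨hμ, hμP⟩, hxμ⟩) hx
      · exact Pset_ne hx h0
      · apply hμP
        have := Pset_div hx hxμ
        rwa [div_div_cancel₀ (Pset_ne hx)] at this

lemma sa_compl {X : Set (Fin m → ℚ_[p])} (h : IsSemialgebraic p X) : IsSemialgebraic p Xᶜ := by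
  obtain ⟨r, s, F, hF, rfl⟩ := h
  have : (⋃ i, ⋂ j, F i j)ᶜ = ⋂ i ∈ (Finset.univ : Finset (Fin r)),
      ⋃ j ∈ (Finset.univ : Finset (Fin s)), (F i j)ᶜ := by
    simp [Set.compl_iUnion, Set.compl_iInter]
  rw [this]
  exact sa_biInter _ fun i _ => sa_biUnion _ fun j _ => Bas.compl (hF i j)

lemma sa1_pset {φ : ℚ_[p] → ℚ_[p]} (q : MvPolynomial (Fin 1) ℚ_[p])
    (h : ∀ z : Fin 1 → ℚ_[p], MvPolynomial.eval z q = φ (z 0)) {n : ℕ} (hn : 0 < n) :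
    IsSemialgebraic1 p {x | φ x ∈ Pset p n} :=
  Bas.sa (Or.inr ⟨q, n, hn, by ext z; simp [h]⟩)

lemma sa1_zero {φ : ℚ_[p] → ℚ_[p]} (q : MvPolynomial (Fin 1) ℚ_[p])
    (h : ∀ z : Fin 1 → ℚ_[p], MvPolynomial.eval z q = φ (z 0)) :
    IsSemialgebraic1 p {x | φ x = 0} :=
  Bas.sa (Or.inl ⟨q, by ext z; simp [h]⟩)

lemma sa1_nhds (x0 : ℚ_[p]) {ε : ℝ} (hε : 0 < ε) : ∃ B : Set ℚ_[p], IsSemialgebraic1 p B ∧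
    B ∈ 𝓝 x0 ∧ ∀ x ∈ B, ‖x - x0‖ < ε := by
  have hp : (p : ℚ_[p]) ≠ 0 := Nat.cast_ne_zero.2 (Fact.out : p.Prime).ne_zero
  obtain ⟨δ, hδ0, hδ⟩ := NormedField.exists_norm_lt ℚ_[p] hε
  have hδ' : δ ≠ 0 := norm_pos_iff.1 hδ0
  refine ⟨{x | 1 + p * ((x - x0) / δ) ^ 2 ∈ Pset p 2}, ?_, ?_, ?_⟩
  · refine sa1_pset (φ := fun x : ℚ_[p] => (1 : ℚ_[p]) + (p : ℚ_[p]) * ((x - x0) / δ) ^ 2)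
      (1 + MvPolynomial.C (p : ℚ_[p]) *
        ((MvPolynomial.X 0 - MvPolynomial.C x0) * MvPolynomial.C δ⁻¹) ^ 2) ?_ two_pos
    intro z
    simp [div_eq_mul_inv]
  · have h1 : Tendsto (fun x : ℚ_[p] => 1 + p * ((x - x0) / δ) ^ 2) (𝓝 x0) (𝓝 1) := by
      have : Continuous (fun x : ℚ_[p] => 1 + p * ((x - x0) / δ) ^ 2) := by fun_prop
      exact this.tendsto' _ _ (by simp)
    exact h1.eventually ((isOpen_Pset two_pos).mem_nhds (Pset_one 2))
  · rintro x ⟨w, hw0, hw⟩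
    refine lt_of_le_of_lt ?_ hδ
    by_contra hlt
    push Not at hlt
    set z := (x - x0) / δ with hz
    have hz1 : 1 < ‖z‖ := by
      rw [hz, norm_div, one_lt_div hδ0]
      exact hlt
    have hz0 : z ≠ 0 := norm_pos_iff.1 (one_pos.trans hz1)
    have hp1 : (1 : ℝ) < p := by exact_mod_cast (Fact.out : p.Prime).one_lt
    have hvz : z.valuation < 0 := by
      rw [Padic.norm_eq_zpow_neg_valuation hz0] at hz1
      have := (one_lt_zpow_iff_right₀ hp1).1 hz1
      omega
    have hpz : (p : ℚ_[p]) * z ^ 2 ≠ 0 := mul_ne_zero hp (pow_ne_zero _ hz0)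
    have hpzn : ‖(p : ℚ_[p]) * z ^ 2‖ = (p : ℝ) ^ (-(1 + 2 * z.valuation)) := by
      rw [norm_mul, norm_pow, Padic.norm_p, Padic.norm_eq_zpow_neg_valuation hz0,
        ← zpow_natCast, ← zpow_mul, ← zpow_neg_one, ← zpow_add₀ (by positivity)]
      congr 1
      push_cast
      ring
    have hbig : 1 < ‖(p : ℚ_[p]) * z ^ 2‖ := by
      rw [hpzn]
      exact one_lt_zpow₀ hp1 (by omega)
    have hsum : ‖w ^ 2‖ = ‖(p : ℚ_[p]) * z ^ 2‖ := by
      rw [hw, Padic.add_eq_max_of_ne (by rw [norm_one]; exact hbig.ne), norm_one,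
        max_eq_right hbig.le]
    rw [hpzn, norm_pow, Padic.norm_eq_zpow_neg_valuation hw0, ← zpow_natCast, ← zpow_mul] at hsum
    have := (zpow_right_injective₀ (by positivity) hp1.ne') hsum
    push_cast at this
    omega

end PadicSub

end

section

open scoped Topology

namespace PadicSub

variable {p : ℕ} [Fact p.Prime] {f : ℚ_[p] → ℚ_[p]}

/-- `Y` has a finite partition into good semialgebraic pieces. -/
def Part (f : ℚ_[p] → ℚ_[p]) (Y : Set ℚ_[p]) : Prop :=
  IsSemialgebraic1 p Y ∧ ∃ (k : ℕ) (A : Fin k → Set ℚ_[p]),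
    (∀ i j, i ≠ j → Disjoint (A i) (A j)) ∧ (⋃ i, A i) = Y ∧
    (∀ i, IsSemialgebraic1 p (A i)) ∧ ∀ i, Good f (A i)

lemma Part.empty : Part f ∅ :=
  ⟨sa_empty, 0, fun _ => ∅, by simp, by simp, fun i => i.elim0, fun i => i.elim0⟩

lemma Part.single {Z : Set ℚ_[p]} (h : IsSemialgebraic1 p Z) (h' : Good f Z) : Part f Z :=
  ⟨h, 1, fun _ => Z, fun i j hij => absurd (Subsingleton.elim i j) hij, by simp [Set.iUnion_const],
    fun _ => h, fun _ => h'⟩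

lemma Part.union {Y Z : Set ℚ_[p]} (h : Part f Y) (h' : Part f Z) : Part f (Y ∪ Z) := by
  obtain ⟨hY, k, A, h1, h2, h3, h4⟩ := h
  obtain ⟨hZ, k', A', h1', h2', h3', h4'⟩ := h'
  set B : Fin k ⊕ Fin k' → Set ℚ_[p] := Sum.elim A (fun i => A' i ∩ Yᶜ) with hB
  have hYA : ∀ i, A i ⊆ Y := fun i => by rw [← h2]; exact Set.subset_iUnion _ i
  have hd : ∀ i j, i ≠ j → Disjoint (B i) (B j) := by
    rintro (i | i) (j | j) hij
    · exact h1 i j fun h => hij (by rw [h])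
    · exact Set.disjoint_left.2 fun x hx hx' => hx'.2 (hYA i hx)
    · exact Set.disjoint_left.2 fun x hx hx' => hx.2 (hYA j hx')
    · exact (h1' i j fun h => hij (by rw [h])).mono Set.inter_subset_left Set.inter_subset_left
  refine ⟨sa_union hY hZ, k + k', fun i => B (finSumFinEquiv.symm i), ?_, ?_, ?_, ?_⟩
  · exact fun i j hij => hd _ _ fun h => hij (finSumFinEquiv.symm.injective h)
  · have : (⋃ i, B (finSumFinEquiv.symm i)) = ⋃ i, B i :=
      finSumFinEquiv.symm.surjective.iUnion_comp B
    rw [this, Set.iUnion_sum]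
    simp only [hB, Sum.elim_inl, Sum.elim_inr]
    rw [← Set.iUnion_inter, h2, h2']
    ext x
    by_cases hx : x ∈ Y <;> simp [hx]
  · intro i
    beta_reduce
    generalize finSumFinEquiv.symm i = i'
    rcases i' with i' | i'
    · exact h3 i'
    · exact sa_inter (h3' i') (sa_compl hY)
  · intro i
    beta_reduce
    generalize finSumFinEquiv.symm i = i'
    rcases i' with i' | i'
    · exact h4 i'
    · exact (h4' i').mono Set.inter_subset_left

lemma Part.biUnion {ι : Type*} (s : Finset ι) {X : ι → Set ℚ_[p]}
    (h : ∀ i ∈ s, Part f (X i)) : Part f (⋃ i ∈ s, X i) := by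
  classical
  induction s using Finset.induction_on with
  | empty => simpa using Part.empty
  | insert a s ha ih =>
    rw [Finset.set_biUnion_insert]
    exact Part.union (h a (by simp)) (ih fun i hi => h i (by simp [hi]))

lemma local_part (hf : IsSubanalyticFnOn1 p {x | ‖x‖ ≤ 1} f) {x0 : ℚ_[p]} (hx0 : ‖x0‖ ≤ 1) :
    ∃ B ∈ 𝓝 x0, (∀ x ∈ B, ‖x‖ ≤ 1) ∧ Part f B := by
  obtain ⟨N, hN, ε, hε, h⟩ := local_good hf hx0
  obtain ⟨B, hB, hBn, hBε⟩ := sa1_nhds x0 (lt_min hε one_pos)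
  obtain ⟨R, hR0, hR⟩ := exists_reps (p := p) N hN
  refine ⟨B, hBn, fun x hx => ?_, ?_⟩
  · have := Padic.nonarchimedean (p := p) (x - x0) x0
    rw [sub_add_cancel] at this
    exact this.trans (max_le ((hBε x hx).le.trans (min_le_right _ _)) hx0)
  · have e : B = {x | x - x0 = 0} ∪ ⋃ μ ∈ R, (B ∩ {x | (x - x0) / μ ∈ Pset p N}) := by
      ext x
      simp only [Set.mem_union, Set.mem_iUnion, exists_prop, Set.mem_inter_iff]
      constructor
      · intro hx
        by_cases h0 : x - x0 = 0
        · exact Or.inl h0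
        · obtain ⟨μ, h1, h2⟩ := hR _ h0
          exact Or.inr ⟨μ, h1, hx, h2⟩
      · rintro (h0 | ⟨μ, h1, h2, h3⟩)
        · have h0' : x - x0 = 0 := h0
          rw [sub_eq_zero.1 h0']
          exact mem_of_mem_nhds hBn
        · exact h2
    rw [e]
    refine Part.union (Part.single ?_ ?_) (Part.biUnion _ fun μ hμ => Part.single ?_ ?_)
    · exact sa1_zero (φ := fun x : ℚ_[p] => x - x0)
        (MvPolynomial.X 0 - MvPolynomial.C x0) (fun z => by simp)
    · refine ⟨Polynomial.C (f x0), 1, 1, one_pos, by simp, fun x hx => ?_⟩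
      have hx' : x - x0 = 0 := hx
      rw [sub_eq_zero.1 hx']
      simp
    · exact sa_inter hB (sa1_pset (φ := fun x : ℚ_[p] => (x - x0) / μ)
        ((MvPolynomial.X 0 - MvPolynomial.C x0) * MvPolynomial.C μ⁻¹)
        (fun z => by simp [div_eq_mul_inv]) hN)
    · exact (h μ (hR0 μ hμ)).mono fun x hx =>
        ⟨(hBε x hx.1).trans_le (min_le_left _ _), hx.2⟩

lemma global_part (hf : IsSubanalyticFnOn1 p {x | ‖x‖ ≤ 1} f) : Part f {x | ‖x‖ ≤ 1} := by
  have hK : IsCompact {x : ℚ_[p] | ‖x‖ ≤ 1} := by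
    have := isCompact_closedBall (0 : ℚ_[p]) 1
    convert this using 1
    ext x
    simp
  have h : ∀ x0 : ℚ_[p], ∃ B : Set ℚ_[p], ‖x0‖ ≤ 1 →
      B ∈ 𝓝 x0 ∧ (∀ x ∈ B, ‖x‖ ≤ 1) ∧ Part f B := by
    intro x0
    by_cases hx0 : ‖x0‖ ≤ 1
    · obtain ⟨B, h1, h2, h3⟩ := local_part hf hx0
      exact ⟨B, fun _ => ⟨h1, h2, h3⟩⟩
    · exact ⟨∅, fun h => absurd h hx0⟩
  choose B hB using h
  obtain ⟨t, ht, hcov⟩ := hK.elim_nhds_subcover B (fun x hx => (hB x hx).1)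
  have e : {x : ℚ_[p] | ‖x‖ ≤ 1} = ⋃ x ∈ t, B x := by
    refine Set.Subset.antisymm hcov ?_
    intro y hy
    obtain ⟨x, hx, hy⟩ := Set.mem_iUnion₂.1 hy
    exact (hB x (ht x hx)).2.1 y hy
  rw [e]
  exact Part.biUnion _ fun x hx => (hB x (ht x hx)).2.2

end PadicSub

end

open PadicSub in
/-- Lemma 2.5 of the paper.  For a subanalytic function `f : ℤ_p → ℚ_p` there is a finite
partition of `ℤ_p` into semialgebraic sets `A` such that on each `A`,
`|f(x)| = |P(x)/Q(x)|^{1/e}` for polynomials `P`, `Q` over `ℚ_p` with `Q` nonvanishing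
on `A` and an integer `e > 0`. -/
theorem subanalytic_norm_is_piecewise_algebraic
    (p : ℕ) [Fact p.Prime] (f : ℚ_[p] → ℚ_[p])
    (hf : IsSubanalyticFnOn1 p {x : ℚ_[p] | ‖x‖ ≤ 1} f) :
    ∃ (k : ℕ) (A : Fin k → Set ℚ_[p]),
      (∀ i j, i ≠ j → Disjoint (A i) (A j)) ∧
      (⋃ i, A i) = {x : ℚ_[p] | ‖x‖ ≤ 1} ∧
      (∀ i, IsSemialgebraic1 p (A i)) ∧
      ∀ i, ∃ (P Q : Polynomial ℚ_[p]) (e : ℕ), 0 < e ∧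
        (∀ x ∈ A i, Polynomial.eval x Q ≠ 0) ∧
        ∀ x ∈ A i, ‖f x‖ = ‖Polynomial.eval x P / Polynomial.eval x Q‖ ^ ((e : ℝ)⁻¹) := by
  exact (global_part hf).2
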